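/- arXiv:math/0004134 — 4 statements merged into one kernel-verified Lean document; each statement's English description precedes it below -/
import Mathlib

section
/- Let q ≥ 2 be an even integer and set N = q(q+3)/2 − ⌊q(q−2)/8⌋. Then there exists a set of N + 1 points in ℝP² such that for every nonzero homogeneous polynomial F ∈ ℝ[x₀,x₁,x₂] of degree q, no connected component of the real point set Z(F) contains all N + 1 points (i.e. c'(q) ≤ q(q+3)/2 − ⌊q(q−2)/8⌋ for even q). -/
noncomputable section

/-- The real projective plane, the projectivization of `ℝ³`. -/
abbrev RP2 := Projectivization ℝ (Fin 3 → ℝ)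

/-- `ℝP²` carries the quotient topology from `ℝ³ ∖ {0}`. -/
instance : TopologicalSpace RP2 :=
  inferInstanceAs (TopologicalSpace (Quotient (projectivizationSetoid ℝ (Fin 3 → ℝ))))

/-- The real point set of the plane curve defined by `F ∈ ℝ[x₀,x₁,x₂]`; for homogeneous `F`
this is well defined (independent of the representative). -/
def zeroSet (F : MvPolynomial (Fin 3) ℝ) : Set RP2 :=
  {p | MvPolynomial.eval p.rep F = 0}

/-- The set `S` lies in a single connected component of `Z ⊆ ℝP²` (with the subspace topology):
some connected component of `Z` contains `S`. -/
def inOneComponent (Z S : Set RP2) : Prop :=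
  ∃ p ∈ Z, S ⊆ connectedComponentIn Z p

open Polynomial in
lemma exists_matrix_charpoly_eq {A : Type*} [CommRing A] [Nontrivial A] {P : A[X]} (hP : P.Monic) :
    ∃ (m : ℕ) (M : Matrix (Fin m) (Fin m) A), M.charpoly = P := by
  let b := AdjoinRoot.powerBasis' hP
  refine ⟨b.dim, Algebra.leftMulMatrix b.basis b.gen, ?_⟩
  refine (eq_of_monic_of_dvd_of_natDegree_le hP (Matrix.charpoly_monic _) ?_ ?_)
  · rw [← AdjoinRoot.mk_eq_zero, ← AdjoinRoot.aeval_eq]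
    apply (injective_iff_map_eq_zero _).mp (Algebra.leftMulMatrix_injective b.basis)
    rw [← Polynomial.aeval_algHom_apply]
    exact Matrix.aeval_self_charpoly _
  · rw [Matrix.charpoly_natDegree_eq_dim, Fintype.card_fin]
    exact le_of_eq rfl

open Polynomial in
/-- The curve `u ↦ (u ^ n, (1 + u) ^ n)` is the zero set of a polynomial which is monic of degree
`n` in the variable `X 0`, the second coordinate. -/
lemma exists_curve_equation {n : ℕ} (hn : n ≠ 0) :
    ∃ H : MvPolynomial (Fin 2) ℂ, (MvPolynomial.finSuccEquiv ℂ 1 H).Monic ∧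
      (MvPolynomial.finSuccEquiv ℂ 1 H).natDegree = n ∧
      ∀ x z : ℂ, MvPolynomial.eval ![z, x] H = 0 ↔ ∃ u : ℂ, u ^ n = x ∧ (1 + u) ^ n = z := by
  let A := MvPolynomial (Fin 1) ℂ
  obtain ⟨m, M, hM⟩ := exists_matrix_charpoly_eq (monic_X_pow_sub_C (MvPolynomial.X 0 : A) hn)
  refine ⟨(MvPolynomial.finSuccEquiv ℂ 1).symm ((1 + M) ^ n).charpoly, ?_, ?_, fun x z ↦ ?_⟩
  · simpa using Matrix.charpoly_monic _
  · rw [AlgEquiv.apply_symm_apply, Matrix.charpoly_natDegree_eq_dim,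
      ← Matrix.charpoly_natDegree_eq_dim M, hM, natDegree_X_pow_sub_C]
  · have hvec : (![z, x] : Fin 2 → ℂ) = Fin.cons z ![x] := rfl
    let φ : A →+* ℂ := MvPolynomial.eval ![x]
    have hmap : φ.mapMatrix ((1 + M) ^ n) = aeval (φ.mapMatrix M) ((1 + X : ℂ[X]) ^ n) := by
      rw [map_pow, map_add, map_one, map_pow, map_add, map_one, aeval_X]
    rw [hvec, MvPolynomial.eval_eq_eval_mv_eval', AlgEquiv.apply_symm_apply,
      ← Matrix.charpoly_map]
    change IsRoot (φ.mapMatrix ((1 + M) ^ n)).charpoly z ↔ _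
    rw [← Matrix.mem_spectrum_iff_isRoot_charpoly, hmap,
      spectrum.map_polynomial_aeval_of_degree_pos]
    · have hroot (u : ℂ) : u ∈ spectrum ℂ (φ.mapMatrix M) ↔ u ^ n = x := by
        rw [Matrix.mem_spectrum_iff_isRoot_charpoly]
        change IsRoot (M.map φ).charpoly u ↔ _
        rw [Matrix.charpoly_map, hM]
        simp [φ, sub_eq_zero]
      simp only [Set.mem_image, hroot]
      simp
    · rw [degree_pow, add_comm, ← C_1, degree_X_add_C]
      simpa using Nat.pos_of_ne_zero hn

lemma le_totalDegree_of_natDegree_finSuccEquiv {H : MvPolynomial (Fin 2) ℂ} {n : ℕ}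
    (hH : (MvPolynomial.finSuccEquiv ℂ 1 H).Monic)
    (hdeg : (MvPolynomial.finSuccEquiv ℂ 1 H).natDegree = n) : n ≤ H.totalDegree := by
  have h := MvPolynomial.totalDegree_coeff_finSuccEquiv_add_le H n
    (by rw [← hdeg, hH.coeff_natDegree]; exact one_ne_zero)
  omega

open Polynomial in
lemma dvd_of_eval_curve_eq_zero {n : ℕ} (hn : n ≠ 0) {H f : MvPolynomial (Fin 2) ℂ}
    (hH : (MvPolynomial.finSuccEquiv ℂ 1 H).Monic)
    (hdeg : (MvPolynomial.finSuccEquiv ℂ 1 H).natDegree = n)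
    (hroot : ∀ u : ℂ, MvPolynomial.eval ![(1 + u) ^ n, u ^ n] H = 0)
    (hf : ∀ u : ℂ, MvPolynomial.eval ![(1 + u) ^ n, u ^ n] f = 0) : H ∣ f := by
  let e := MvPolynomial.finSuccEquiv ℂ 1
  suffices e H ∣ e f by simpa using map_dvd e.symm this
  rw [← modByMonic_eq_zero_iff_dvd hH]
  set r := e f %ₘ e H with hr
  have hrdeg : r.natDegree < n := by
    rw [← hdeg]
    exact natDegree_modByMonic_lt _ hH (fun h ↦ by simp [e, h] at hdeg; omega)
  have heval (g : MvPolynomial (Fin 2) ℂ) (z x : ℂ) :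
      MvPolynomial.eval ![z, x] g = eval z ((e g).map (MvPolynomial.eval ![x])) :=
    MvPolynomial.eval_eq_eval_mv_eval' ![x] z g
  have hreval (u : ℂ) : eval ((1 + u) ^ n) (r.map (MvPolynomial.eval ![u ^ n])) = 0 := by
    have h1 := hf u
    have h2 := hroot u
    rw [heval] at h1 h2
    have h3 := congrArg (fun p ↦ eval ((1 + u) ^ n) (p.map (MvPolynomial.eval ![u ^ n])))
      (modByMonic_add_div (e f) (e H))
    simpa [h1, h2] using h3
  -- substitute `x = U ^ n`
  let ψ : MvPolynomial (Fin 1) ℂ →+* ℂ[X] := (MvPolynomial.aeval ![(X : ℂ[X]) ^ n]).toRingHom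
  have hψ (u : ℂ) (a : MvPolynomial (Fin 1) ℂ) :
      eval u (ψ a) = MvPolynomial.eval ![u ^ n] a := by
    have : ((evalRingHom u).comp ψ) = MvPolynomial.eval ![u ^ n] := by
      apply MvPolynomial.ringHom_ext
      · intro c; simp [ψ]
      · intro i; fin_cases i; simp [ψ]
    exact RingHom.congr_fun this a
  have hψinj : Function.Injective ψ := by
    rw [injective_iff_map_eq_zero]
    intro a ha
    apply MvPolynomial.funext
    intro v
    obtain ⟨u, hu⟩ := IsAlgClosed.exists_pow_nat_eq (v 0) (Nat.pos_of_ne_zero hn)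
    have hv : v = ![u ^ n] := by ext i; fin_cases i; simp [hu]
    rw [hv, ← hψ, ha]; simp
  suffices r.map ψ = 0 from (Polynomial.map_eq_zero_iff hψinj).mp this
  let ζ : ℂ := Complex.exp (2 * Real.pi * Complex.I / n)
  have hζ : IsPrimitiveRoot ζ n := Complex.isPrimitiveRoot_exp n hn
  refine eq_zero_of_natDegree_lt_card_of_eval_eq_zero (ι := Fin n) _
    (f := fun j ↦ (1 + C (ζ ^ (j : ℕ)) * X) ^ n) ?_ ?_ ?_
  · intro i j hij
    have h := congrArg (fun p : ℂ[X] ↦ eval 0 (derivative p)) hij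
    simp [derivative_pow, hn] at h
    exact Fin.ext (hζ.pow_inj i.2 j.2 h)
  · intro j
    apply Polynomial.funext
    intro u
    have h := hreval (ζ ^ (j : ℕ) * u)
    have hpow : (ζ ^ (j : ℕ) * u) ^ n = u ^ n := by
      rw [mul_pow, ← pow_mul, mul_comm (j : ℕ), pow_mul, hζ.pow_eq_one, one_pow, one_mul]
    have hcomp : (evalRingHom u).comp ψ = MvPolynomial.eval ![u ^ n] :=
      RingHom.ext fun a ↦ hψ u a
    rw [hpow, ← hcomp, ← Polynomial.map_map] at h
    rw [eval_zero, ← h, ← coe_evalRingHom, eval_map, hom_eval₂]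
    simp [eval_map, eval₂_map]
  · rw [Fintype.card_fin]
    exact (natDegree_map_le).trans_lt hrdeg

open Polynomial in
lemma eval_curve_eq_zero_of_card {n d : ℕ} {f : MvPolynomial (Fin 2) ℂ} (hd : f.totalDegree ≤ d)
    (s : Finset ℂ) (hs : d * n < s.card)
    (hf : ∀ u ∈ s, MvPolynomial.eval ![(1 + u) ^ n, u ^ n] f = 0) (u : ℂ) :
    MvPolynomial.eval ![(1 + u) ^ n, u ^ n] f = 0 := by
  let g : ℂ[X] := MvPolynomial.aeval ![(1 + X : ℂ[X]) ^ n, X ^ n] f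
  have hg (u : ℂ) : eval u g = MvPolynomial.eval ![(1 + u) ^ n, u ^ n] f := by
    have : ((evalRingHom u).comp (MvPolynomial.aeval ![(1 + X : ℂ[X]) ^ n, X ^ n]).toRingHom) =
        MvPolynomial.eval ![(1 + u) ^ n, u ^ n] := by
      apply MvPolynomial.ringHom_ext
      · intro c; simp
      · intro i; fin_cases i <;> simp
    exact RingHom.congr_fun this f
  have hgdeg : g.natDegree ≤ d * n := by
    apply MvPolynomial.aeval_natDegree_le _ hd
    intro i
    fin_cases i
    · have : natDegree (1 + X : ℂ[X]) ≤ 1 := by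
        rw [add_comm, ← C_1, natDegree_X_add_C]
      simpa using natDegree_pow_le_of_le n this
    · simp
  have : g = 0 := eq_zero_of_natDegree_lt_card_of_eval_eq_zero' g s
    (fun u hu ↦ by rw [hg, hf u hu]) (hgdeg.trans_lt hs)
  rw [← hg, this, eval_zero]

/-- A plane curve of degree at most `2 * k` that meets the curve `u ↦ (u ^ n, (1 + u) ^ n)`,
`n = k + 2`, too often contains it, with a residual curve missing one of sufficiently many points. -/
lemma exists_residual {k : ℕ} {H f : MvPolynomial (Fin 2) ℂ}
    (hH : (MvPolynomial.finSuccEquiv ℂ 1 H).Monic)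
    (hdeg : (MvPolynomial.finSuccEquiv ℂ 1 H).natDegree = k + 2)
    (hroot : ∀ u : ℂ, MvPolynomial.eval ![(1 + u) ^ (k + 2), u ^ (k + 2)] H = 0)
    (hf0 : f ≠ 0) (hfdeg : f.totalDegree ≤ 2 * k) (s t : Finset ℂ)
    (hs : 2 * k * (k + 2) < s.card) (ht : k * (k + 1) ≤ t.card)
    (hf : ∀ u ∈ s, MvPolynomial.eval ![(1 + u) ^ (k + 2), u ^ (k + 2)] f = 0) :
    ∃ g, f = H * g ∧ ∃ u ∈ t, MvPolynomial.eval ![(1 + u) ^ (k + 2), u ^ (k + 2)] g ≠ 0 := by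
  have hHdeg := le_totalDegree_of_natDegree_finSuccEquiv hH hdeg
  have hH0 : H ≠ 0 := by rintro rfl; simp at hH
  obtain ⟨g, rfl⟩ := dvd_of_eval_curve_eq_zero (by omega) hH hdeg hroot
    (eval_curve_eq_zero_of_card hfdeg s hs hf)
  have hg0 := right_ne_zero_of_mul hf0
  rw [MvPolynomial.totalDegree_mul_of_isDomain hH0 hg0] at hfdeg
  refine ⟨g, rfl, ?_⟩
  by_contra! hcon
  obtain ⟨j, rfl⟩ : ∃ j, k = j + 2 := ⟨k - 2, by omega⟩
  have hgdeg : g.totalDegree ≤ j := by omega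
  obtain ⟨g', rfl⟩ := dvd_of_eval_curve_eq_zero (by omega) hH hdeg hroot
    (eval_curve_eq_zero_of_card hgdeg t (by nlinarith) hcon)
  rw [MvPolynomial.totalDegree_mul_of_isDomain hH0 (right_ne_zero_of_mul hg0)] at hgdeg
  omega

open Real in
lemma exists_solitary_nodes (k : ℕ) :
    ∃ s : Finset ℂ, 2 * s.card = k * (k + 1) ∧
      ∀ u ∈ s, 0 < u.im ∧ (u ^ (k + 2)).im = 0 ∧ ((1 + u) ^ (k + 2)).im = 0 := by
  classical
  set θ : ℝ := π / (k + 2) with hθ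
  have hθ0 : 0 < θ := by positivity
  have hnθ : (k + 2 : ℝ) * θ = π := by rw [hθ]; field_simp
  have hlt {a : ℕ} (ha : a < k + 2) : a * θ < π := by
    rw [← hnθ]
    have : (a : ℝ) < k + 2 := by exact_mod_cast ha
    gcongr
  have hsin {a : ℕ} (h0 : 0 < a) (ha : a < k + 2) : 0 < sin (a * θ) :=
    sin_pos_of_pos_of_lt_pi (by positivity) (hlt ha)
  have hreal (r : ℝ) (a : ℕ) :
      (((r : ℂ) * (Complex.cos ((a * θ : ℝ) : ℂ) + Complex.sin ((a * θ : ℝ) : ℂ) * Complex.I)) ^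
        (k + 2)).im = 0 := by
    rw [mul_pow, Complex.cos_add_sin_mul_I_pow]
    have h : ((k + 2 : ℕ) : ℂ) * ((a * θ : ℝ) : ℂ) = ((a * π : ℝ) : ℂ) := by
      rw [← hnθ]; push_cast; ring
    rw [h, ← Complex.ofReal_pow, Complex.im_ofReal_mul, ← Complex.ofReal_cos,
      ← Complex.ofReal_sin, sin_nat_mul_pi]
    simp only [Complex.ofReal_im, Complex.ofReal_zero, zero_mul, add_zero, mul_zero]
  have harg {r : ℝ} (hr : 0 < r) {a : ℕ} (h0 : 0 < a) (ha : a < k + 2) :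
      Complex.arg ((r : ℂ) *
        (Complex.cos ((a * θ : ℝ) : ℂ) + Complex.sin ((a * θ : ℝ) : ℂ) * Complex.I)) = a * θ :=
    Complex.arg_mul_cos_add_sin_mul_I hr
      ⟨by have : 0 < a * θ := by positivity
          linarith [pi_pos], (hlt ha).le⟩
  have hsine {s a b c d : ℝ} (hs : s ≠ 0) (h : s = a * d - c * b) :
      1 + ((b / s : ℝ) : ℂ) * (c + a * Complex.I) =
        ((a / s : ℝ) : ℂ) * (d + b * Complex.I) := by
    have hs' : (s : ℂ) ≠ 0 := by exact_mod_cast hs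
    have h' : (s : ℂ) = a * d - c * b := by exact_mod_cast h
    push_cast
    field_simp
    linear_combination h'
  let u : (Σ _ : ℕ, ℕ) → ℂ := fun p ↦
    ((sin ((p.2 + 1 : ℕ) * θ) / sin ((p.1 - p.2 : ℕ) * θ) : ℝ) : ℂ) *
      (Complex.cos (((p.1 + 1 : ℕ) * θ : ℝ) : ℂ) +
        Complex.sin (((p.1 + 1 : ℕ) * θ : ℝ) : ℂ) * Complex.I)
  have hu1 (p : Σ _ : ℕ, ℕ) (h21 : p.2 < p.1) (h1 : p.1 < k + 1) :
      1 + u p = ((sin ((p.1 + 1 : ℕ) * θ) / sin ((p.1 - p.2 : ℕ) * θ) : ℝ) : ℂ) *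
      (Complex.cos (((p.2 + 1 : ℕ) * θ : ℝ) : ℂ) +
        Complex.sin (((p.2 + 1 : ℕ) * θ : ℝ) : ℂ) * Complex.I) := by
    have hs : sin ((p.1 - p.2 : ℕ) * θ) ≠ 0 := (hsin (by omega) (by omega)).ne'
    have hsub : sin ((p.1 - p.2 : ℕ) * θ) =
        sin ((p.1 + 1 : ℕ) * θ) * cos ((p.2 + 1 : ℕ) * θ) -
          cos ((p.1 + 1 : ℕ) * θ) * sin ((p.2 + 1 : ℕ) * θ) := by
      rw [← sin_sub, Nat.cast_sub h21.le]; push_cast; ring_nf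
    simp only [u, ← Complex.ofReal_cos, ← Complex.ofReal_sin]
    exact hsine hs hsub
  let I : Finset (Σ _ : ℕ, ℕ) := (Finset.range (k + 1)).sigma fun a ↦ Finset.range a
  have hI {p} (hp : p ∈ I) : p.2 < p.1 ∧ p.1 < k + 1 := by
    simp only [I, Finset.mem_sigma, Finset.mem_range] at hp
    exact ⟨hp.2, hp.1⟩
  have hpos {p} (hp : p ∈ I) : 0 < sin ((p.2 + 1 : ℕ) * θ) / sin ((p.1 - p.2 : ℕ) * θ) := by
    have := hI hp
    exact div_pos (hsin (by omega) (by omega)) (hsin (by omega) (by omega))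
  have hpos' {p} (hp : p ∈ I) : 0 < sin ((p.1 + 1 : ℕ) * θ) / sin ((p.1 - p.2 : ℕ) * θ) := by
    have := hI hp
    exact div_pos (hsin (by omega) (by omega)) (hsin (by omega) (by omega))
  refine ⟨I.image u, ?_, ?_⟩
  · rw [Finset.card_image_of_injOn]
    · rw [Finset.card_sigma]
      simp only [Finset.card_range]
      rw [mul_comm, Finset.sum_range_id_mul_two]
      simp [mul_comm]
    · intro p hp p' hp' h
      have h1 := congrArg Complex.arg h
      have h2 := congrArg (fun w ↦ Complex.arg (1 + w)) h
      have hlt := hI hp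
      have hlt' := hI hp'
      beta_reduce at h2
      rw [hu1 p hlt.1 hlt.2, hu1 p' hlt'.1 hlt'.2, harg (hpos' hp) (by omega) (by omega),
        harg (hpos' hp') (by omega) (by omega)] at h2
      simp only [u] at h1
      rw [harg (hpos hp) (by omega) (by omega), harg (hpos hp') (by omega) (by omega)] at h1
      have e1 := mul_right_cancel₀ hθ0.ne' h1
      have e2 := mul_right_cancel₀ hθ0.ne' h2
      norm_cast at e1 e2
      obtain ⟨a, b⟩ := p
      obtain ⟨a', b'⟩ := p'
      simp only at e1 e2
      obtain rfl : a = a' := by omega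
      obtain rfl : b = b' := by omega
      rfl
  · intro w hw
    obtain ⟨p, hp, rfl⟩ := Finset.mem_image.mp hw
    have b := hI hp
    refine ⟨?_, hreal _ _, ?_⟩
    · simp only [u, ← Complex.ofReal_cos, ← Complex.ofReal_sin, Complex.im_ofReal_mul]
      refine mul_pos (hpos hp) ?_
      rw [Complex.add_im, Complex.ofReal_im, Complex.im_ofReal_mul, Complex.I_im, mul_one, zero_add]
      exact hsin (by omega) (by omega)
    · rw [hu1 p b.1 b.2]
      exact hreal _ _

/-- Only finitely many non-real `u` have both `u ^ n` and `(1 + u) ^ n` real. -/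
lemma finite_setOf_solitary {n : ℕ} (hn : n ≠ 0) :
    {u : ℂ | u.im ≠ 0 ∧ (u ^ n).im = 0 ∧ ((1 + u) ^ n).im = 0}.Finite := by
  have hfin : {ζ : ℂ | ζ ^ n = 1}.Finite := by
    refine (Polynomial.nthRoots n (1 : ℂ)).toFinset.finite_toSet.subset fun ζ hζ ↦ ?_
    simpa [Polynomial.mem_nthRoots (Nat.pos_of_ne_zero hn)] using hζ
  refine ((hfin.prod hfin).image fun p : ℂ × ℂ ↦ (p.2 - 1) / (p.1 - p.2)).subset ?_
  rintro u ⟨him, h1, h2⟩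
  have hratio {w : ℂ} (hw : w.im ≠ 0) (hwn : (w ^ n).im = 0) :
      (starRingEnd ℂ w / w) ^ n = 1 := by
    have hw0 : w ≠ 0 := by rintro rfl; simp at hw
    rw [div_pow, ← map_pow, Complex.conj_eq_iff_im.mpr hwn, div_self (pow_ne_zero _ hw0)]
  have him' : (1 + u).im ≠ 0 := by simpa using him
  have hu0 : u ≠ 0 := by rintro rfl; simp at him
  have hu1 : 1 + u ≠ 0 := by intro h; simp [h] at him'
  refine ⟨(starRingEnd ℂ u / u, starRingEnd ℂ (1 + u) / (1 + u)),
    ⟨hratio him h1, hratio him' h2⟩, ?_⟩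
  have hne : starRingEnd ℂ u - u ≠ 0 := fun h ↦ him (Complex.conj_eq_iff_im.mp (sub_eq_zero.mp h))
  have e1 : starRingEnd ℂ (1 + u) / (1 + u) - 1 = (starRingEnd ℂ u - u) / (1 + u) := by
    rw [map_add, map_one]; field_simp; ring
  have e2 : starRingEnd ℂ u / u - starRingEnd ℂ (1 + u) / (1 + u) =
      (starRingEnd ℂ u - u) / (u * (1 + u)) := by
    rw [map_add, map_one]; field_simp; ring
  simp only [e1, e2]
  field_simp

lemma four_mul_im_sq (u : ℂ) :
    4 * u.im ^ 2 = 4 * ‖u‖ ^ 2 - (‖u‖ ^ 2 + 1 - ‖1 + u‖ ^ 2) ^ 2 := by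
  simp only [Complex.sq_norm, Complex.normSq_apply, Complex.add_re, Complex.add_im,
    Complex.one_re, Complex.one_im]
  ring

/-- A non-real parameter `u₀` with `u₀ ^ n` and `(1 + u₀) ^ n` real gives an isolated real point. -/
lemma exists_isOpen_solitary {n : ℕ} (hn : n ≠ 0) {u₀ : ℂ} (hu₀ : u₀.im ≠ 0) {x₀ z₀ : ℝ}
    (hx₀ : u₀ ^ n = x₀) (hz₀ : (1 + u₀) ^ n = z₀) :
    ∃ O : Set (ℝ × ℝ), IsOpen O ∧ (x₀, z₀) ∈ O ∧
      ∀ p ∈ O, ∀ u : ℂ, u ^ n = (p.1 : ℂ) → (1 + u) ^ n = (p.2 : ℂ) →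
        p = (x₀, z₀) ∧ u.im ≠ 0 := by
  let E : ℝ × ℝ → ℝ := fun p ↦ 4 * (|p.1| ^ (n : ℝ)⁻¹) ^ 2 -
    ((|p.1| ^ (n : ℝ)⁻¹) ^ 2 + 1 - (|p.2| ^ (n : ℝ)⁻¹) ^ 2) ^ 2
  have hinv : 0 ≤ (n : ℝ)⁻¹ := by positivity
  have hE : Continuous E := by
    have h1 : Continuous fun p : ℝ × ℝ ↦ |p.1| ^ (n : ℝ)⁻¹ :=
      (continuous_fst.abs).rpow_const fun _ ↦ Or.inr hinv
    have h2 : Continuous fun p : ℝ × ℝ ↦ |p.2| ^ (n : ℝ)⁻¹ :=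
      (continuous_snd.abs).rpow_const fun _ ↦ Or.inr hinv
    fun_prop
  have hroot {w : ℂ} {x : ℝ} (h : w ^ n = x) : |x| ^ (n : ℝ)⁻¹ = ‖w‖ := by
    have h1 : |x| = ‖w‖ ^ n := by rw [← norm_pow, h, Complex.norm_real, Real.norm_eq_abs]
    rw [h1, Real.pow_rpow_inv_natCast (norm_nonneg _) hn]
  have hEu {u : ℂ} {x z : ℝ} (hx : u ^ n = x) (hz : (1 + u) ^ n = z) :
      E (x, z) = 4 * u.im ^ 2 := by
    simp only [E, hroot hx, hroot hz, four_mul_im_sq]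
  let T : Set (ℝ × ℝ) := (fun u : ℂ ↦ ((u ^ n).re, ((1 + u) ^ n).re)) ''
    {u : ℂ | u.im ≠ 0 ∧ (u ^ n).im = 0 ∧ ((1 + u) ^ n).im = 0} \ {(x₀, z₀)}
  have hT : T.Finite := ((finite_setOf_solitary hn).image _).subset Set.sdiff_subset
  refine ⟨{p | E p ≠ 0} ∩ Tᶜ, (isOpen_ne_fun hE continuous_const).inter hT.isClosed.isOpen_compl,
    ⟨?_, fun h ↦ h.2 rfl⟩, ?_⟩
  · rw [Set.mem_ofPred_eq, hEu hx₀ hz₀]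
    positivity
  · rintro ⟨x, z⟩ ⟨hEp, hTp⟩ u hx hz
    have him : u.im ≠ 0 := fun h ↦ hEp (by rw [hEu hx hz, h]; simp)
    refine ⟨?_, him⟩
    by_contra hne
    exact hTp ⟨⟨u, ⟨him, by simp [hx], by simp [hz]⟩, by simp [hx, hz]⟩, hne⟩

lemma rep_mk_mem_iff {W : Set (Fin 3 → ℝ)} (hW : ∀ a : ℝ, a ≠ 0 → ∀ v ∈ W, a • v ∈ W)
    (v : Fin 3 → ℝ) (hv : v ≠ 0) : (Projectivization.mk ℝ v hv).rep ∈ W ↔ v ∈ W := by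
  obtain ⟨a, ha⟩ := Projectivization.exists_smul_eq_mk_rep ℝ v hv
  rw [← ha]
  refine ⟨fun h ↦ ?_, fun h ↦ hW a a.ne_zero v h⟩
  simpa [Units.smul_def, smul_smul] using hW (a : ℝ)⁻¹ (inv_ne_zero a.ne_zero) _ h

lemma isOpen_setOf_rep_mem {W : Set (Fin 3 → ℝ)} (hopen : IsOpen W)
    (hW : ∀ a : ℝ, a ≠ 0 → ∀ v ∈ W, a • v ∈ W) : IsOpen {p : RP2 | p.rep ∈ W} := by
  have hq : Topology.IsQuotientMap (Quotient.mk (projectivizationSetoid ℝ (Fin 3 → ℝ))) :=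
    isQuotientMap_quotient_mk'
  refine hq.isOpen_preimage.mp ?_
  convert hopen.preimage continuous_subtype_val using 1
  ext ⟨v, hv⟩
  exact rep_mk_mem_iff hW v hv

namespace MvPolynomial

lemma totalDegree_aeval_le {σ τ R : Type*} [CommRing R] (F : MvPolynomial σ R)
    (φ : σ → MvPolynomial τ R) (hφ : ∀ i, (φ i).totalDegree ≤ 1) :
    (aeval φ F).totalDegree ≤ F.totalDegree := by
  rw [aeval_def, eval₂]
  refine totalDegree_finsetSum_le fun d hd ↦ ?_
  rw [algebraMap_eq]
  refine (totalDegree_mul _ _).trans ?_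
  rw [totalDegree_C, zero_add]
  refine (totalDegree_finsetProd _ _).trans (le_trans ?_ (le_totalDegree hd))
  refine Finset.sum_le_sum fun i _ ↦ (totalDegree_pow _ _).trans ?_
  simpa using Nat.mul_le_mul_left (d i) (hφ i)

lemma IsHomogeneous.eval_smul {σ R : Type*} [CommRing R] {F : MvPolynomial σ R} {d : ℕ}
    (hF : F.IsHomogeneous d) (a : R) (v : σ → R) : eval (a • v) F = a ^ d * eval v F := by
  rw [eval_eq, eval_eq, Finset.mul_sum]
  refine Finset.sum_congr rfl fun m hm ↦ ?_
  have hdeg : ∑ i ∈ m.support, m i = d := by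
    rw [← hF (mem_support_iff.mp hm), Finsupp.weight_apply, Finsupp.sum]
    simp
  simp only [Pi.smul_apply, smul_eq_mul, mul_pow, Finset.prod_mul_distrib,
    Finset.prod_pow_eq_pow_sum, hdeg]
  ring

end MvPolynomial

/-- The complexified equation of a projective plane curve in the affine chart `x₁ = 1`, with the
coordinates `x₂`, `x₀` as variables `X 0`, `X 1`. -/
def chartPoly (F : MvPolynomial (Fin 3) ℝ) : MvPolynomial (Fin 2) ℂ :=
  MvPolynomial.aeval ![MvPolynomial.X 1, 1, MvPolynomial.X 0]
    (MvPolynomial.map (algebraMap ℝ ℂ) F)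

lemma eval_chartPoly (F : MvPolynomial (Fin 3) ℝ) (x z : ℝ) :
    MvPolynomial.eval ![(z : ℂ), (x : ℂ)] (chartPoly F) =
      (MvPolynomial.eval ![x, 1, z] F : ℝ) := by
  have : ((MvPolynomial.eval ![(z : ℂ), (x : ℂ)]).comp
      ((MvPolynomial.aeval ![MvPolynomial.X 1, 1, MvPolynomial.X 0] :
        MvPolynomial (Fin 3) ℂ →ₐ[ℂ] MvPolynomial (Fin 2) ℂ).toRingHom.comp
        (MvPolynomial.map (algebraMap ℝ ℂ)))) =
      Complex.ofRealHom.comp (MvPolynomial.eval ![x, 1, z]) := by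
    apply MvPolynomial.ringHom_ext
    · intro c; simp
    · intro i; fin_cases i <;> simp
  exact RingHom.congr_fun this F

lemma totalDegree_chartPoly_le {F : MvPolynomial (Fin 3) ℝ} {q : ℕ} (hF : F.IsHomogeneous q) :
    (chartPoly F).totalDegree ≤ q := by
  refine (MvPolynomial.totalDegree_aeval_le _ _ fun i ↦ ?_).trans
    ((hF.map (algebraMap ℝ ℂ)).totalDegree_le)
  fin_cases i <;> simp

lemma eval_eq_pow_mul_eval_chart {F : MvPolynomial (Fin 3) ℝ} {q : ℕ} (hF : F.IsHomogeneous q)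
    {v : Fin 3 → ℝ} (hv : v 1 ≠ 0) :
    MvPolynomial.eval v F = v 1 ^ q * MvPolynomial.eval ![v 0 / v 1, 1, v 2 / v 1] F := by
  rw [← hF.eval_smul]
  congr 2
  ext i
  fin_cases i <;> simp <;> field_simp

lemma chartPoly_ne_zero {F : MvPolynomial (Fin 3) ℝ} {q : ℕ} (hF : F.IsHomogeneous q)
    (h0 : F ≠ 0) : chartPoly F ≠ 0 := by
  intro h
  have hX : (MvPolynomial.X 1 : MvPolynomial (Fin 3) ℝ) * F = 0 := by
    apply MvPolynomial.funext
    intro v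
    rw [map_mul, MvPolynomial.eval_X, map_zero]
    by_cases hv : v 1 = 0
    · rw [hv, zero_mul]
    · have he := eval_chartPoly F (v 0 / v 1) (v 2 / v 1)
      rw [h, map_zero, eq_comm, Complex.ofReal_eq_zero] at he
      rw [eval_eq_pow_mul_eval_chart hF hv, he, mul_zero, mul_zero]
  exact (mul_ne_zero (MvPolynomial.X_ne_zero 1) h0) hX

/-- The point of `ℝP²` with affine coordinates `Re (u ^ n)` and `Re ((1 + u) ^ n)`. -/
def curvePoint (n : ℕ) (u : ℂ) : RP2 :=
  Projectivization.mk ℝ ![(u ^ n).re, 1, ((1 + u) ^ n).re] fun h ↦ by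
    simpa using congrFun h 1

lemma eval_chartPoly_eq_zero_of_mem_zeroSet {F : MvPolynomial (Fin 3) ℝ} {q n : ℕ}
    (hF : F.IsHomogeneous q) {u : ℂ} (h1 : (u ^ n).im = 0) (h2 : ((1 + u) ^ n).im = 0)
    (hu : curvePoint n u ∈ zeroSet F) :
    MvPolynomial.eval ![(1 + u) ^ n, u ^ n] (chartPoly F) = 0 := by
  have hW : ∀ a : ℝ, a ≠ 0 → ∀ v ∈ {v : Fin 3 → ℝ | MvPolynomial.eval v F = 0},
      a • v ∈ {v : Fin 3 → ℝ | MvPolynomial.eval v F = 0} := by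
    intro a _ v hv
    rw [Set.mem_ofPred_eq] at hv ⊢
    rw [hF.eval_smul, hv, mul_zero]
  have he : MvPolynomial.eval ![(u ^ n).re, 1, ((1 + u) ^ n).re] F = 0 :=
    (rep_mk_mem_iff hW _ _).mp hu
  have e1 : u ^ n = ((u ^ n).re : ℂ) := Complex.ext rfl (by simpa using h1)
  have e2 : (1 + u) ^ n = (((1 + u) ^ n).re : ℂ) := Complex.ext rfl (by simpa using h2)
  rw [e1, e2, eval_chartPoly, he, Complex.ofReal_zero]

lemma curvePoint_conj (n : ℕ) (u : ℂ) : curvePoint n (starRingEnd ℂ u) = curvePoint n u := by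
  have h : (1 + starRingEnd ℂ u) = starRingEnd ℂ (1 + u) := by simp
  simp only [curvePoint, h, ← map_pow, Complex.conj_re]

/-- If `F = H * g` in the affine chart and `g` does not vanish at a solitary node of the curve, then
that node is an isolated point of the zero set of `F`. -/
lemma curvePoint_one_notMem_of_isPreconnected {n q : ℕ} (hn : n ≠ 0) {H g : MvPolynomial (Fin 2) ℂ}
    (hH : ∀ x z : ℂ, MvPolynomial.eval ![z, x] H = 0 → ∃ u : ℂ, u ^ n = x ∧ (1 + u) ^ n = z)
    {F : MvPolynomial (Fin 3) ℝ} (hF : F.IsHomogeneous q) (hfac : chartPoly F = H * g)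
    {u₀ : ℂ} (him : u₀.im ≠ 0) (h1 : (u₀ ^ n).im = 0) (h2 : ((1 + u₀) ^ n).im = 0)
    (hg : MvPolynomial.eval ![(1 + u₀) ^ n, u₀ ^ n] g ≠ 0) {C : Set RP2} (hC : IsPreconnected C)
    (hCF : C ⊆ zeroSet F) (hu₀ : curvePoint n u₀ ∈ C) : curvePoint n 1 ∉ C := by
  intro hone
  obtain ⟨x₀, hx₀⟩ : ∃ x : ℝ, u₀ ^ n = x := ⟨(u₀ ^ n).re, Complex.ext rfl (by simpa using h1)⟩
  obtain ⟨z₀, hz₀⟩ : ∃ z : ℝ, (1 + u₀) ^ n = z :=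
    ⟨((1 + u₀) ^ n).re, Complex.ext rfl (by simpa using h2)⟩
  obtain ⟨O, hO, hmem, hiso⟩ := exists_isOpen_solitary hn him hx₀ hz₀
  let G : ℝ × ℝ → ℂ := fun p ↦ MvPolynomial.eval ![(p.2 : ℂ), (p.1 : ℂ)] g
  have hG : Continuous G := by
    refine (MvPolynomial.continuous_eval g).comp ?_
    refine continuous_pi fun i ↦ ?_
    fin_cases i
    · exact Complex.continuous_ofReal.comp continuous_snd
    · exact Complex.continuous_ofReal.comp continuous_fst
  let O' : Set (ℝ × ℝ) := O ∩ {p | G p ≠ 0}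
  have hO' : IsOpen O' := hO.inter (isOpen_ne_fun hG continuous_const)
  let W : Set (Fin 3 → ℝ) := {v | v 1 ≠ 0} ∩ (fun v ↦ (v 0 / v 1, v 2 / v 1)) ⁻¹' O'
  have hWopen : IsOpen W := by
    refine ContinuousOn.isOpen_inter_preimage ?_ ?_ hO'
    · refine ContinuousOn.prodMk ?_ ?_ <;>
        exact ContinuousOn.div (by fun_prop) (by fun_prop) fun v hv ↦ hv
    · exact isOpen_ne_fun (continuous_apply 1) continuous_const
  have hW (a : ℝ) (ha : a ≠ 0) (v) (hv : v ∈ W) : a • v ∈ W := by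
    refine ⟨mul_ne_zero ha hv.1, ?_⟩
    simpa [mul_div_mul_left _ _ ha] using hv.2
  let W' : Set (Fin 3 → ℝ) := {v | v 0 ≠ x₀ * v 1} ∪ {v | v 2 ≠ z₀ * v 1}
  have hW'open : IsOpen W' :=
    (isOpen_ne_fun (by fun_prop) (by fun_prop)).union (isOpen_ne_fun (by fun_prop) (by fun_prop))
  have hW' (a : ℝ) (ha : a ≠ 0) (v) (hv : v ∈ W') : a • v ∈ W' := by
    refine hv.imp (fun h h' ↦ h ?_) (fun h h' ↦ h ?_) <;>
    · simp only [Pi.smul_apply, smul_eq_mul] at h'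
      apply mul_left_cancel₀ ha
      rw [h']; ring
  have hsub : C ⊆ {p : RP2 | p.rep ∈ W} ∪ {p : RP2 | p.rep ∈ W'} := by
    intro p _
    by_contra hp
    simp only [Set.mem_union, not_or, Set.mem_ofPred_eq, W', ne_eq, not_not] at hp
    obtain ⟨hp, hp0, hp2⟩ := hp
    have hp1 : p.rep 1 ≠ 0 := by
      intro h
      refine p.rep_nonzero ?_
      ext i
      fin_cases i
      · simpa [h] using hp0
      · exact h
      · simpa [h] using hp2
    refine hp ⟨hp1, ?_⟩
    rw [Set.mem_preimage, hp0, hp2, mul_div_cancel_right₀ _ hp1, mul_div_cancel_right₀ _ hp1]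
    exact ⟨hmem, by simpa [G, ← hx₀, ← hz₀] using hg⟩
  have hmemW : curvePoint n u₀ ∈ {p : RP2 | p.rep ∈ W} := by
    refine (rep_mk_mem_iff hW _ _).mpr ⟨by simp, ?_⟩
    simpa [hx₀, hz₀, O', G, hmem] using hg
  have hmemW' : curvePoint n 1 ∈ {p : RP2 | p.rep ∈ W'} := by
    refine (rep_mk_mem_iff hW' _ _).mpr ?_
    by_contra hcon
    simp only [Set.mem_union, not_or, Set.mem_ofPred_eq, W', ne_eq, not_not] at hcon
    obtain ⟨hx, hz⟩ := hcon
    refine (hiso _ hmem 1 ?_ ?_).2 Complex.one_im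
    · apply Complex.ext
      · simpa using hx
      · simp
    · have h2n : (1 + 1 : ℂ) ^ n = ((2 ^ n : ℝ) : ℂ) := by push_cast; norm_num
      rw [h2n] at hz ⊢
      change (((2 ^ n : ℝ) : ℂ)).re = z₀ * 1 at hz
      rw [Complex.ofReal_re, mul_one] at hz
      rw [hz]
  obtain ⟨p, hpC, hpW, hpW'⟩ := hC _ _ (isOpen_setOf_rep_mem hWopen hW)
    (isOpen_setOf_rep_mem hW'open hW') hsub ⟨_, hu₀, hmemW⟩ ⟨_, hone, hmemW'⟩
  obtain ⟨hp1, hpO, hpG⟩ := hpW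
  have he := eval_chartPoly F (p.rep 0 / p.rep 1) (p.rep 2 / p.rep 1)
  have hz : MvPolynomial.eval p.rep F = 0 := hCF hpC
  rw [eval_eq_pow_mul_eval_chart hF hp1] at hz
  rw [(mul_eq_zero.mp hz).resolve_left (pow_ne_zero _ hp1), hfac, map_mul,
    Complex.ofReal_zero] at he
  obtain ⟨u, hux, huz⟩ := hH _ _ ((mul_eq_zero.mp he).resolve_right hpG)
  have heq := (hiso _ hpO u hux huz).1
  rw [Prod.mk.injEq, div_eq_iff hp1, div_eq_iff hp1] at heq
  exact hpW'.elim (fun h ↦ h heq.1) (fun h ↦ h heq.2)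

/-- For even `q`, `c'(q) ≤ q(q+3)/2 - ⌊q(q-2)/8⌋`: with `N = q(q+3)/2 - ⌊q(q-2)/8⌋` there exist
`N + 1` points of `ℝP²` such that no connected component of the real point set of a real
curve of degree `q` contains all of them. -/
theorem stmt_12 (q : ℕ) (hq : 2 ≤ q) (heven : Even q) :
    ∃ p : Fin (q * (q + 3) / 2 - q * (q - 2) / 8 + 1) → RP2,
      ∀ F : MvPolynomial (Fin 3) ℝ, F ≠ 0 → F.IsHomogeneous q →
        ¬ inOneComponent (zeroSet F) (Set.range p) := by
  obtain ⟨k, rfl⟩ := heven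
  classical
  obtain ⟨s, hscard, hs⟩ := exists_solitary_nodes k
  obtain ⟨H, hmonic, hdeg, hH⟩ := exists_curve_equation (n := k + 2) (by omega)
  let r : Finset ℂ := (Finset.range (k ^ 2 + 3 * k + 1)).image fun j : ℕ ↦ ((j + 1 : ℝ) : ℂ)
  have hrcard : r.card = k ^ 2 + 3 * k + 1 := by
    rw [Finset.card_image_of_injective, Finset.card_range]
    intro i j hij
    simpa using hij
  have hr0 {u : ℂ} (hu : u ∈ r) : u.im = 0 := by
    obtain ⟨j, -, rfl⟩ := Finset.mem_image.mp hu
    exact Complex.ofReal_im _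
  have hr {u : ℂ} (hu : u ∈ r) :
      (u ^ (k + 2)).im = 0 ∧ ((1 + u) ^ (k + 2)).im = 0 := by
    obtain ⟨j, -, rfl⟩ := Finset.mem_image.mp hu
    constructor
    · rw [← Complex.ofReal_pow, Complex.ofReal_im]
    · rw [← Complex.ofReal_one, ← Complex.ofReal_add, ← Complex.ofReal_pow, Complex.ofReal_im]
  have hone : (1 : ℂ) ∈ r := Finset.mem_image.mpr ⟨0, by simp, by simp⟩
  let s' : Finset ℂ := s.image (starRingEnd ℂ)
  have hs'card : s'.card = s.card := Finset.card_image_of_injective _ (starRingEnd ℂ).injective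
  have hs' {u : ℂ} (hu : u ∈ s') :
      u.im < 0 ∧ (u ^ (k + 2)).im = 0 ∧ ((1 + u) ^ (k + 2)).im = 0 := by
    obtain ⟨w, hw, rfl⟩ := Finset.mem_image.mp hu
    have hconj : 1 + starRingEnd ℂ w = starRingEnd ℂ (1 + w) := by simp
    rw [hconj, ← map_pow, ← map_pow, Complex.conj_im, Complex.conj_im, Complex.conj_im]
    simpa using hs w hw
  have hsr : Disjoint s r := Finset.disjoint_left.mpr fun u hu hu' ↦
    (hs u hu).1.ne' (hr0 hu')
  have hss' : Disjoint s s' := Finset.disjoint_left.mpr fun u hu hu' ↦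
    ((hs u hu).1.trans (hs' hu').1).false
  have hrs' : Disjoint r s' := Finset.disjoint_left.mpr fun u hu hu' ↦
    (hs' hu').1.ne (hr0 hu)
  have hcard : (k + k) * (k + k + 3) / 2 - (k + k) * (k + k - 2) / 8 + 1 = (s ∪ r).card := by
    rw [Finset.card_union_of_disjoint hsr, hrcard]
    obtain ⟨j, rfl⟩ : ∃ j, k = j + 1 := ⟨k - 1, by omega⟩
    have e1 : (j + 1 + (j + 1)) * (j + 1 + (j + 1) + 3) = 2 * ((j + 1) * (2 * j + 5)) := by ring
    have e2 : (j + 1 + (j + 1)) * (j + 1 + (j + 1) - 2) = 4 * (j * (j + 1)) := by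
      rw [show j + 1 + (j + 1) - 2 = 2 * j by omega]; ring
    obtain ⟨c, hc⟩ : 2 ∣ j * (j + 1) := (Nat.even_mul_succ_self j).two_dvd
    rw [e1, e2, hc, Nat.mul_div_cancel_left _ two_pos, show 4 * (2 * c) = 8 * c by ring,
      Nat.mul_div_cancel_left _ (by norm_num)]
    have : s.card + ((j + 1) ^ 2 + 3 * (j + 1) + 1) + c = (j + 1) * (2 * j + 5) + 1 := by nlinarith
    omega
  refine ⟨fun i ↦ curvePoint (k + 2) ((s ∪ r).equivFin.symm (i.cast hcard)), ?_⟩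
  rintro F hF0 hF ⟨p₀, -, hp₀⟩
  set C := connectedComponentIn (zeroSet F) p₀
  have hCF : C ⊆ zeroSet F := connectedComponentIn_subset _ _
  have hsrC {u : ℂ} (hu : u ∈ s ∪ r) : curvePoint (k + 2) u ∈ C :=
    hp₀ ⟨((s ∪ r).equivFin ⟨u, hu⟩).cast hcard.symm, by simp⟩
  have hs'C {u : ℂ} (hu : u ∈ s') : curvePoint (k + 2) u ∈ C := by
    obtain ⟨w, hw, rfl⟩ := Finset.mem_image.mp hu
    rw [curvePoint_conj]
    exact hsrC (Finset.mem_union_left _ hw)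
  have hcard₁ : 2 * k * (k + 2) < (s ∪ r ∪ s').card := by
    rw [Finset.card_union_of_disjoint (Finset.disjoint_union_left.mpr ⟨hss', hrs'⟩),
      Finset.card_union_of_disjoint hsr, hs'card, hrcard]
    nlinarith
  have hcard₂ : k * (k + 1) ≤ (s ∪ s').card := by
    rw [Finset.card_union_of_disjoint hss', hs'card]
    omega
  have hvanish : ∀ u ∈ s ∪ r ∪ s',
      MvPolynomial.eval ![(1 + u) ^ (k + 2), u ^ (k + 2)] (chartPoly F) = 0 := by
    intro u hu
    rcases Finset.mem_union.mp hu with h | h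
    · refine eval_chartPoly_eq_zero_of_mem_zeroSet hF ?_ ?_ (hCF (hsrC h)) <;>
      rcases Finset.mem_union.mp h with h | h
      exacts [(hs _ h).2.1, (hr h).1, (hs _ h).2.2, (hr h).2]
    · exact eval_chartPoly_eq_zero_of_mem_zeroSet hF (hs' h).2.1 (hs' h).2.2 (hCF (hs'C h))
  obtain ⟨g, hfac, u₀, hu₀, hg⟩ := exists_residual hmonic hdeg (fun u ↦ (hH _ _).mpr ⟨u, rfl, rfl⟩)
    (chartPoly_ne_zero hF hF0) ((totalDegree_chartPoly_le hF).trans_eq (two_mul k).symm)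
    (s ∪ r ∪ s') (s ∪ s') hcard₁ hcard₂ hvanish
  have hu₀C : u₀.im ≠ 0 ∧ (u₀ ^ (k + 2)).im = 0 ∧ ((1 + u₀) ^ (k + 2)).im = 0 ∧
      curvePoint (k + 2) u₀ ∈ C := by
    rcases Finset.mem_union.mp hu₀ with h | h
    · exact ⟨(hs _ h).1.ne', (hs _ h).2.1, (hs _ h).2.2, hsrC (Finset.mem_union_left _ h)⟩
    · exact ⟨(hs' h).1.ne, (hs' h).2.1, (hs' h).2.2, hs'C h⟩
  exact curvePoint_one_notMem_of_isPreconnected (by omega) (fun x z ↦ (hH x z).mp) hF hfac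
    hu₀C.1 hu₀C.2.1 hu₀C.2.2.1 hg isPreconnected_connectedComponentIn hCF hu₀C.2.2.2
    (hsrC (Finset.mem_union_right _ hone))
end
end

section
/- There exist 24 points in ℝP² such that for every nonzero homogeneous polynomial F ∈ ℝ[x₀,x₁,x₂] of degree 6, no connected component of the real point set Z(F) contains all twenty-four points (i.e. c'(6) ≤ 23). -/
noncomputable section

open Polynomial in
/-- If `D` vanishes at `w` and `A w`, `B w` are linearly independent over `ℝ`, then a relation
`(a A + b B) M + D P = 0` with `M w ≠ 0` forces `a`, `b` and `P` to vanish. -/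
lemma eq_zero_of_combination_eq_zero {w : ℂ} {A B M D P : ℝ[X]} {a b β : ℝ}
    (hD : aeval w D = 0) (hD0 : D ≠ 0) (hM : aeval w M ≠ 0) (hA : (aeval w A).im ≠ 0)
    (hB : aeval w B = (β : ℂ)) (hβ : β ≠ 0)
    (h : (C a * A + C b * B) * M + D * P = 0) : a = 0 ∧ b = 0 ∧ P = 0 := by
  have hw := congrArg (aeval w) h
  simp only [map_add, map_mul, aeval_C, hD, zero_mul, add_zero, map_zero, mul_eq_zero, hM,
    or_false, hB, Complex.coe_algebraMap] at hw
  have him := congrArg Complex.im hw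
  simp only [Complex.add_im, Complex.im_ofReal_mul, Complex.ofReal_im, mul_zero, add_zero,
    Complex.zero_im, mul_eq_zero, hA, or_false] at him
  subst him
  have hb : b = 0 := by simpa [hβ] using hw
  subst hb
  simpa [hD0] using h

/-- The homogeneous form of degree `n` in three variables with coefficients `c`. -/
def ternaryForm (n : ℕ) (c : ℕ → ℕ → ℝ) (v : Fin 3 → ℝ) : ℝ :=
  ∑ i ∈ Finset.range (n + 1), ∑ j ∈ Finset.range (n + 1 - i),
    c i j * (v 0 ^ i * v 1 ^ j * v 2 ^ (n - i - j))

lemma exists_eval_eq_ternaryForm {n : ℕ} {F : MvPolynomial (Fin 3) ℝ} (hF : F.IsHomogeneous n) :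
    ∃ c, ∀ v, MvPolynomial.eval v F = ternaryForm n c v := by
  refine ⟨fun i j => F.coeff (Finsupp.equivFunOnFinite.symm ![i, j, n - i - j]), fun v => ?_⟩
  have hdeg : ∀ d ∈ F.support, d 0 + d 1 + d 2 = n := fun d hd => by
    rw [← Fin.sum_univ_three, ← Finsupp.degree_eq_sum]
    exact (hF.degree_eq_sum_deg_support hd).symm
  have heq : ∀ d : Fin 3 →₀ ℕ, d 0 + d 1 + d 2 = n →
      Finsupp.equivFunOnFinite.symm ![d 0, d 1, n - d 0 - d 1] = d := fun d hd => by
    ext i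
    fin_cases i
    · rfl
    · rfl
    · change n - d 0 - d 1 = d 2
      omega
  rw [MvPolynomial.eval_eq', ternaryForm, Finset.sum_sigma']
  refine Finset.sum_of_injOn (fun d => ⟨d 0, d 1⟩) ?_ ?_ ?_ ?_
  · intro d hd e he hde
    simp only [Sigma.mk.injEq, heq_eq_eq] at hde
    rw [← heq d (hdeg d hd), ← heq e (hdeg e he), hde.1, hde.2]
  · intro d hd
    have := hdeg d hd
    simp only [Finset.coe_sigma, Set.mem_sigma_iff, Finset.coe_range, Set.mem_Iio]
    omega
  · rintro ⟨i, j⟩ - hij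
    rw [mul_eq_zero, ← MvPolynomial.notMem_support_iff]
    exact Or.inl fun hs => hij ⟨_, hs, rfl⟩
  · intro d hd
    have := hdeg d hd
    rw [heq d this, Fin.prod_univ_three, show n - d 0 - d 1 = d 2 by omega]

/-- A rational quartic with three solitary nodes at the coordinate points, and one oval. -/
def trinodalQuartic (v : Fin 3 → ℝ) : ℝ :=
  v 0 ^ 2 * v 1 ^ 2 - 2 * v 0 * v 1 ^ 2 * v 2 - 3 * v 0 * v 1 * v 2 ^ 2 + 3 * v 1 ^ 2 * v 2 ^ 2
    + v 0 ^ 2 * v 2 ^ 2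

/-- A parametrization of the oval of `trinodalQuartic`. -/
def ovalPoint (t : ℝ) : Fin 3 → ℝ :=
  ![(t ^ 2 + 2) * (t ^ 2 + t + 1), (t ^ 2 + 1) * (t ^ 2 + t + 1), (t ^ 2 + 1) * (t ^ 2 + 2)]

/-- The quadratic form with coefficients `q`. -/
def conic (q : Fin 6 → ℝ) (v : Fin 3 → ℝ) : ℝ :=
  q 0 * v 0 ^ 2 + q 1 * v 0 * v 1 + q 2 * v 1 ^ 2 + q 3 * v 0 * v 2 + q 4 * v 1 * v 2
    + q 5 * v 2 ^ 2

open Polynomial in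
/-- The pullback to the oval of a sextic form through the nodes, divided by the common factor
coming from the nodes. -/
def ovalPullback (c : ℕ → ℕ → ℝ) : ℝ[X] :=
  ∑ i ∈ Finset.range 7, ∑ j ∈ Finset.range (7 - i),
    C (c i j) * ((X ^ 2 + 1) ^ (5 - i) * (X ^ 2 + 2) ^ (5 - j) * (X ^ 2 + X + 1) ^ (i + j - 1))

open Polynomial in
lemma natDegree_ovalPullback_le {c : ℕ → ℕ → ℝ} (h₀ : c 6 0 = 0) (h₁ : c 0 6 = 0)
    (h₂ : c 0 0 = 0) : (ovalPullback c).natDegree ≤ 18 := by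
  refine natDegree_sum_le_of_forall_le _ _ fun i hi =>
    natDegree_sum_le_of_forall_le _ _ fun j hj => ?_
  rw [Finset.mem_range] at hi hj
  by_cases hc : c i j = 0
  · simp [hc]
  have hij : i ≤ 5 ∧ j ≤ 5 ∧ 1 ≤ i + j := by
    refine ⟨?_, ?_, ?_⟩ <;> by_contra hlt
    · obtain ⟨rfl, rfl⟩ : i = 6 ∧ j = 0 := by omega
      exact hc h₀
    · obtain ⟨rfl, rfl⟩ : i = 0 ∧ j = 6 := by omega
      exact hc h₁
    · obtain ⟨rfl, rfl⟩ : i = 0 ∧ j = 0 := by omega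
      exact hc h₂
  have hx : (X ^ 2 + 1 : ℝ[X]).natDegree ≤ 2 := by compute_degree
  have hy : (X ^ 2 + 2 : ℝ[X]).natDegree ≤ 2 := by compute_degree
  have hz : (X ^ 2 + X + 1 : ℝ[X]).natDegree ≤ 2 := by compute_degree
  refine (natDegree_C_mul_le _ _).trans ((natDegree_mul_le_of_le (natDegree_mul_le_of_le
    (natDegree_pow_le_of_le (5 - i) hx) (natDegree_pow_le_of_le (5 - j) hy))
    (natDegree_pow_le_of_le (i + j - 1) hz)).trans ?_)
  omega

open Polynomial in
lemma ternaryForm_ovalPoint {c : ℕ → ℕ → ℝ} (h₀ : c 6 0 = 0) (h₁ : c 0 6 = 0)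
    (h₂ : c 0 0 = 0) (t : ℝ) :
    ternaryForm 6 c (ovalPoint t) =
      (t ^ 2 + 1) * (t ^ 2 + 2) * (t ^ 2 + t + 1) * (ovalPullback c).eval t := by
  simp only [ternaryForm, ovalPullback, ovalPoint, Finset.sum_range_succ, Finset.sum_range_zero,
    eval_add, eval_mul, eval_pow, eval_C, eval_X, eval_one, eval_ofNat, h₀, h₁, h₂, eval_zero,
    Nat.reduceAdd, Nat.reduceSub, Matrix.cons_val]
  ring

open Polynomial in
/-- A sextic form through the nodes whose pullback to the oval vanishes is divisible by the
quartic. -/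
lemma ternaryForm_eq_trinodalQuartic_mul_conic {c : ℕ → ℕ → ℝ} (h₀ : c 6 0 = 0)
    (h₁ : c 0 6 = 0) (h₂ : c 0 0 = 0) (hP : ovalPullback c = 0) :
    ∃ q, ∀ v, ternaryForm 6 c v = trinodalQuartic v * conic q v := by
  obtain ⟨q₁, hq₁⟩ : ∃ q, q = c 4 2 := ⟨_, rfl⟩
  obtain ⟨q₂, hq₂⟩ : ∃ q, q = c 3 3 := ⟨_, rfl⟩
  obtain ⟨q₃, hq₃⟩ : ∃ q, q = c 2 4 := ⟨_, rfl⟩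
  obtain ⟨q₄, hq₄⟩ : ∃ q, q = c 3 2 + 2 * q₁ := ⟨_, rfl⟩
  obtain ⟨q₅, hq₅⟩ : ∃ q, q = c 2 3 + 2 * q₂ := ⟨_, rfl⟩
  obtain ⟨q₆, hq₆⟩ : ∃ q, q = c 2 2 + 2 * q₄ + 3 * q₂ - 3 * q₁ - q₃ := ⟨_, rfl⟩
  obtain ⟨x, hx⟩ : ∃ x : ℝ[X], x = X ^ 2 + 1 := ⟨_, rfl⟩
  obtain ⟨y, hy⟩ : ∃ y : ℝ[X], y = X ^ 2 + 2 := ⟨_, rfl⟩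
  obtain ⟨z, hz⟩ : ∃ z : ℝ[X], z = X ^ 2 + X + 1 := ⟨_, rfl⟩
  have hrel : (z - x) ^ 2 = (y - x) * (2 * x - y) := by
    rw [hx, hy, hz]
    ring
  have horner :
      (C (c 5 1) * z + C (c 5 0) * y) * (y ^ 4 * z ^ 4) + x * (
      (C (c 4 1) * z + C (c 4 0 - q₁) * y) * (y ^ 4 * z ^ 3) + x * (
      (C (c 3 1 + 3 * q₁ - q₂) * z + C (c 3 0 - q₄) * y) * (y ^ 4 * z ^ 2) + x * (
      (C (c 2 1 + 3 * q₄ - q₅) * z + C (c 2 0 - q₆) * y) * (y ^ 4 * z) + x * (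
      (C (c 1 5) * z + C (c 0 5) * x) * z ^ 4 + y * (
      (C (c 1 4 + 2 * q₃) * z + C (c 0 4 - 3 * q₃) * x) * z ^ 3 + y * (
      (C (c 1 3 + 2 * q₅ + 3 * q₃ - 3 * q₂) * z + C (c 0 3 - 3 * q₅) * x) * z ^ 2 + y * (
      (C (c 1 2 + 2 * q₆ + 3 * q₅ - 3 * q₄) * z + C (c 0 2 - 3 * q₆) * x) * z + y * (
      (C (c 1 1 + 3 * q₆) * z + C (c 0 1) * x) * 1 + y * C (c 1 0))))))))) = 0 := by
    simp only [ovalPullback, ← hx, ← hy, ← hz, Finset.sum_range_succ, Finset.sum_range_zero,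
      h₀, h₁, h₂, Nat.reduceAdd, Nat.reduceSub, map_zero] at hP
    have e₂ : c 2 2 = q₆ - 2 * q₄ - 3 * q₂ + 3 * q₁ + q₃ := by linarith
    have e₃ : c 2 3 = q₅ - 2 * q₂ := by linarith
    have e₄ : c 3 2 = q₄ - 2 * q₁ := by linarith
    rw [e₂, e₃, e₄, ← hq₁, ← hq₂, ← hq₃] at hP
    simp only [map_add, map_sub, map_mul, map_ofNat] at hP ⊢
    linear_combination hP - x * y * z * (C q₁ * y ^ 2 * z ^ 2 + C q₂ * x * y * z ^ 2
      + C q₃ * x ^ 2 * z ^ 2 + C q₄ * x * y ^ 2 * z + C q₅ * x ^ 2 * y * z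
      + C q₆ * x ^ 2 * y ^ 2) * hrel
  have hs : (√2 : ℂ) ^ 2 = 2 := by norm_cast; simp
  have hs0 : √2 ≠ 0 := by positivity
  have hxI : aeval Complex.I x = 0 := by simp [hx]
  have hyI : aeval Complex.I y = ((1 : ℝ) : ℂ) := by
    simp only [hy, map_add, map_pow, aeval_X, map_ofNat, Complex.I_sq]
    norm_num
  have hzI : aeval Complex.I z = Complex.I := by simp [hz]
  have hxs : aeval (√2 * Complex.I) x = ((-1 : ℝ) : ℂ) := by
    simp only [hx, map_add, map_pow, aeval_X, map_one, mul_pow, Complex.I_sq, hs]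
    norm_num
  have hys : aeval (√2 * Complex.I) y = 0 := by
    simp only [hy, map_add, map_pow, aeval_X, map_ofNat, mul_pow, Complex.I_sq, hs]
    norm_num
  have hzs : (aeval (√2 * Complex.I) z).im ≠ 0 := by
    simp only [hz, map_add, map_pow, aeval_X, map_one, mul_pow, Complex.I_sq, hs]
    simp
  have hzs' : aeval (√2 * Complex.I) z ≠ 0 := fun h => hzs (by simp [h])
  have hx0 : x ≠ 0 := fun h => by simp [h] at hxs
  have hy0 : y ≠ 0 := fun h => by simp [h] at hyI
  have peel_x {a b : ℝ} {k : ℕ} {P : ℝ[X]}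
      (h : (C a * z + C b * y) * (y ^ 4 * z ^ k) + x * P = 0) : a = 0 ∧ b = 0 ∧ P = 0 :=
    eq_zero_of_combination_eq_zero hxI hx0 (by simp [hyI, hzI]) (by simp [hzI]) hyI one_ne_zero h
  have peel_y {a b : ℝ} {k : ℕ} {P : ℝ[X]}
      (h : (C a * z + C b * x) * z ^ k + y * P = 0) : a = 0 ∧ b = 0 ∧ P = 0 :=
    eq_zero_of_combination_eq_zero hys hy0 (by simp [hzs']) hzs hxs (by norm_num) h
  obtain ⟨r₅₁, r₅₀, horner⟩ := peel_x horner
  obtain ⟨r₄₁, r₄₀, horner⟩ := peel_x horner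
  obtain ⟨r₃₁, r₃₀, horner⟩ := peel_x horner
  obtain ⟨r₂₁, r₂₀, horner⟩ := peel_x (k := 1) (by rw [pow_one]; exact horner)
  obtain ⟨r₁₅, r₀₅, horner⟩ := peel_y horner
  obtain ⟨r₁₄, r₀₄, horner⟩ := peel_y horner
  obtain ⟨r₁₃, r₀₃, horner⟩ := peel_y horner
  obtain ⟨r₁₂, r₀₂, horner⟩ := peel_y (k := 1) (by rw [pow_one]; exact horner)
  obtain ⟨r₁₁, r₀₁, horner⟩ := peel_y (k := 0) (by rw [pow_zero]; exact horner)
  have r₁₀ : c 1 0 = 0 := by simpa using horner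
  refine ⟨![q₁, q₂, q₃, q₄, q₅, q₆], fun v => ?_⟩
  simp only [ternaryForm, trinodalQuartic, conic, Finset.sum_range_succ, Finset.sum_range_zero,
    h₀, h₁, h₂, Nat.reduceAdd, Nat.reduceSub, Matrix.cons_val]
  rw [r₅₁, r₅₀, r₄₁, r₁₅, r₀₅, r₀₁, r₁₀, ← hq₁, ← hq₂, ← hq₃, eq_of_sub_eq_zero r₄₀,
    eq_of_sub_eq_zero r₃₀, eq_of_sub_eq_zero r₂₀, eq_of_sub_eq_zero r₀₄,
    eq_of_sub_eq_zero r₀₃, eq_of_sub_eq_zero r₀₂,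
    show c 3 1 = q₂ - 3 * q₁ by linarith, show c 2 1 = q₅ - 3 * q₄ by linarith,
    show c 1 4 = -2 * q₃ by linarith, show c 1 3 = 3 * q₂ - 3 * q₃ - 2 * q₅ by linarith,
    show c 1 2 = 3 * q₄ - 3 * q₅ - 2 * q₆ by linarith, show c 1 1 = -3 * q₆ by linarith,
    show c 2 2 = q₆ - 2 * q₄ - 3 * q₂ + 3 * q₁ + q₃ by linarith,
    show c 2 3 = q₅ - 2 * q₂ by linarith, show c 3 2 = q₄ - 2 * q₁ by linarith]
  ring

lemma isOpen_setOf_rep_pos {f : (Fin 3 → ℝ) → ℝ} (hf : Continuous f)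
    (hhom : ∀ (a : ℝ) (v), a ≠ 0 → 0 < f v → 0 < f (a • v)) : IsOpen {p : RP2 | 0 < f p.rep} := by
  have hpre : (fun v : { v : Fin 3 → ℝ // v ≠ 0 } => Projectivization.mk ℝ v.1 v.2) ⁻¹'
      {p : RP2 | 0 < f p.rep} = {v | 0 < f v.1} := by
    ext ⟨v, hv⟩
    obtain ⟨a, ha⟩ := Projectivization.exists_smul_eq_mk_rep ℝ v hv
    simp only [Set.mem_preimage, Set.mem_ofPred_eq, ← ha]
    refine ⟨fun h => ?_, hhom a v a.ne_zero⟩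
    simpa [Units.smul_def, smul_smul] using hhom _ _ a⁻¹.ne_zero h
  refine isOpen_coinduced.2 ?_
  change IsOpen ((fun v : { v : Fin 3 → ℝ // v ≠ 0 } => Projectivization.mk ℝ v.1 v.2) ⁻¹'
      {p : RP2 | 0 < f p.rep})
  rw [hpre]
  exact isOpen_lt continuous_const (hf.comp continuous_subtype_val)

lemma MvPolynomial.IsHomogeneous.eval_smul_eq {F : MvPolynomial (Fin 3) ℝ} {n : ℕ}
    (hF : F.IsHomogeneous n) (a : ℝ) (v : Fin 3 → ℝ) :
    MvPolynomial.eval (a • v) F = a ^ n * MvPolynomial.eval v F := by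
  rw [MvPolynomial.eval_eq, MvPolynomial.eval_eq, Finset.mul_sum]
  refine Finset.sum_congr rfl fun d hd => ?_
  rw [hF.degree_eq_sum_deg_support hd]
  simp only [Pi.smul_apply, smul_eq_mul, mul_pow, Finset.prod_mul_distrib,
    Finset.prod_pow_eq_pow_sum]
  ring

lemma mk_mem_zeroSet_iff {F : MvPolynomial (Fin 3) ℝ} {n : ℕ} (hF : F.IsHomogeneous n)
    {v : Fin 3 → ℝ} (hv : v ≠ 0) :
    Projectivization.mk ℝ v hv ∈ zeroSet F ↔ MvPolynomial.eval v F = 0 := by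
  obtain ⟨a, ha⟩ := Projectivization.exists_smul_eq_mk_rep ℝ v hv
  have h : MvPolynomial.eval ((a : ℝ) • v) F = a ^ n * MvPolynomial.eval v F :=
    hF.eval_smul_eq a v
  rw [zeroSet, Set.mem_ofPred_eq, ← ha]
  change MvPolynomial.eval ((a : ℝ) • v) F = 0 ↔ _
  simp [h]

lemma conic_smul (q : Fin 6 → ℝ) (a : ℝ) (v : Fin 3 → ℝ) : conic q (a • v) = a ^ 2 * conic q v := by
  simp only [conic, Pi.smul_apply, smul_eq_mul]
  ring

lemma continuous_conic (q : Fin 6 → ℝ) : Continuous (conic q) := by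
  unfold conic
  fun_prop

lemma isOpen_setOf_conic_pos (q : Fin 6 → ℝ) : IsOpen {p : RP2 | 0 < conic q p.rep} :=
  isOpen_setOf_rep_pos (continuous_conic q) fun a v ha hv => by
    rw [conic_smul]
    positivity

lemma isOpen_setOf_conic_ne_zero (q : Fin 6 → ℝ) : IsOpen {p : RP2 | conic q p.rep ≠ 0} := by
  have h : IsOpen {p : RP2 | 0 < conic q p.rep ^ 2} :=
    isOpen_setOf_rep_pos (f := fun v => conic q v ^ 2) ((continuous_conic q).pow 2) fun a v ha hv => by
      simp only [conic_smul, mul_pow]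
      positivity
  simpa only [sq_pos_iff] using h

lemma conic_rep_mk_pos_iff (q : Fin 6 → ℝ) {v : Fin 3 → ℝ} (hv : v ≠ 0) :
    0 < conic q (Projectivization.mk ℝ v hv).rep ↔ 0 < conic q v := by
  obtain ⟨a, ha⟩ := Projectivization.exists_smul_eq_mk_rep ℝ v hv
  rw [← ha]
  change 0 < conic q ((a : ℝ) • v) ↔ _
  rw [conic_smul, mul_pos_iff_of_pos_left (sq_pos_of_ne_zero a.ne_zero)]

lemma conic_rep_mk_eq_zero_iff (q : Fin 6 → ℝ) {v : Fin 3 → ℝ} (hv : v ≠ 0) :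
    conic q (Projectivization.mk ℝ v hv).rep = 0 ↔ conic q v = 0 := by
  obtain ⟨a, ha⟩ := Projectivization.exists_smul_eq_mk_rep ℝ v hv
  rw [← ha]
  change conic q ((a : ℝ) • v) = 0 ↔ _
  simp [conic_smul]

/-- Suppose that `e` is the only zero of the positive semidefinite form `g`, and an isolated zero
of the quartic in the region `f > 0`. Then a connected set of zeros of the product of the quartic
and a conic joins `e` to another point only if the conic passes through `e`. -/
lemma conic_eq_zero_of_isPreconnected {T : Set RP2} (hT : IsPreconnected T)
    {q : Fin 6 → ℝ} (hTq : ∀ p ∈ T, trinodalQuartic p.rep * conic q p.rep = 0)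
    (f g : Fin 6 → ℝ) {e o : Fin 3 → ℝ} (he : e ≠ 0) (ho : o ≠ 0)
    (heT : Projectivization.mk ℝ e he ∈ T) (hoT : Projectivization.mk ℝ o ho ∈ T)
    (hfe : 0 < conic f e) (hgo : 0 < conic g o)
    (hg : ∀ v, ¬ 0 < conic g v → ∃ a : ℝ, v = a • e)
    (hS : ∀ v, trinodalQuartic v = 0 → 0 < conic f v → ¬ 0 < conic g v) :
    conic q e = 0 := by
  by_contra hq
  obtain ⟨p, hpT, ⟨hpf, hpq⟩, hpg⟩ := hT
    ({p : RP2 | 0 < conic f p.rep} ∩ {p : RP2 | conic q p.rep ≠ 0}) {p : RP2 | 0 < conic g p.rep}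
    ((isOpen_setOf_conic_pos f).inter (isOpen_setOf_conic_ne_zero q)) (isOpen_setOf_conic_pos g)
    (fun p _ => by
      by_cases hgp : 0 < conic g p.rep
      · exact Or.inr hgp
      · obtain ⟨a, ha⟩ := hg _ hgp
        have ha0 : a ≠ 0 := fun h => p.rep_nonzero (by rw [ha, h, zero_smul])
        refine Or.inl ⟨?_, ?_⟩
        · change 0 < conic f p.rep
          rw [ha, conic_smul]
          positivity
        · change conic q p.rep ≠ 0
          rw [ha, conic_smul]
          positivity)
    ⟨_, heT, (conic_rep_mk_pos_iff f he).2 hfe, mt (conic_rep_mk_eq_zero_iff q he).1 hq⟩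
    ⟨_, hoT, (conic_rep_mk_pos_iff g ho).2 hgo⟩
  exact hS _ ((mul_eq_zero.1 (hTq p hpT)).resolve_right hpq) hpf hpg

lemma mul_nonpos_of_trinodalQuartic_eq_zero {v : Fin 3 → ℝ} (h : trinodalQuartic v = 0) :
    (v 0 * v 2) ^ 2 * ((2 * v 0 - v 2) * (2 * v 0 - 3 * v 2)) ≤ 0 ∧
      (v 0 * v 1) ^ 2 * ((v 0 - v 1) * (v 0 - 2 * v 1)) ≤ 0 := by
  unfold trinodalQuartic at h
  constructor
  · linear_combination sq_nonneg
      (2 * (v 0 ^ 2 - 2 * v 0 * v 2 + 3 * v 2 ^ 2) * v 1 - 3 * v 0 * v 2 ^ 2)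
      + 4 * (v 0 ^ 2 - 2 * v 0 * v 2 + 3 * v 2 ^ 2) * h
  · linear_combination sq_nonneg
      ((v 0 ^ 2 - 3 * v 0 * v 1 + 3 * v 1 ^ 2) * v 2 - v 0 * v 1 ^ 2)
      + (v 0 ^ 2 - 3 * v 0 * v 1 + 3 * v 1 ^ 2) * h

lemma eq_zero_of_trinodalQuartic_of_lt₀ {v : Fin 3 → ℝ} (h : trinodalQuartic v = 0)
    (hv : 9 * v 2 ^ 2 < v 0 ^ 2) : v 1 = 0 ∧ v 2 = 0 := by
  have h0 : v 0 ≠ 0 := fun h0 => by rw [h0] at hv; nlinarith [sq_nonneg (v 2)]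
  have h2 : v 2 = 0 := by
    by_contra h2
    have hpos : 0 < (2 * v 0 - v 2) * (2 * v 0 - 3 * v 2) := by
      nlinarith [sq_nonneg (v 0 - 3 * v 2), sq_nonneg (v 0 + 3 * v 2)]
    have := (mul_nonpos_of_trinodalQuartic_eq_zero h).1
    have : 0 < (v 0 * v 2) ^ 2 := by positivity
    nlinarith
  simpa [trinodalQuartic, h2, h0] using h

lemma eq_zero_of_trinodalQuartic_of_lt₁ {v : Fin 3 → ℝ} (h : trinodalQuartic v = 0)
    (hv : 9 * v 0 ^ 2 < v 1 ^ 2) : v 0 = 0 ∧ v 2 = 0 := by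
  have h1 : v 1 ≠ 0 := fun h1 => by rw [h1] at hv; nlinarith [sq_nonneg (v 0)]
  have h0 : v 0 = 0 := by
    by_contra h0
    have hpos : 0 < (v 0 - v 1) * (v 0 - 2 * v 1) := by
      nlinarith [sq_nonneg (v 1 - 3 * v 0), sq_nonneg (v 1 + 3 * v 0)]
    have := (mul_nonpos_of_trinodalQuartic_eq_zero h).2
    have : 0 < (v 0 * v 1) ^ 2 := by positivity
    nlinarith
  simpa [trinodalQuartic, h0, h1] using h

lemma eq_zero_of_trinodalQuartic_of_lt₂ {v : Fin 3 → ℝ} (h : trinodalQuartic v = 0)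
    (hv : 9 * v 0 ^ 2 < v 2 ^ 2) : v 0 = 0 ∧ v 1 = 0 := by
  have h2 : v 2 ≠ 0 := fun h2 => by rw [h2] at hv; nlinarith [sq_nonneg (v 0)]
  have h0 : v 0 = 0 := by
    by_contra h0
    have hpos : 0 < (2 * v 0 - v 2) * (2 * v 0 - 3 * v 2) := by
      nlinarith [sq_nonneg (v 2 - 3 * v 0), sq_nonneg (v 2 + 3 * v 0)]
    have := (mul_nonpos_of_trinodalQuartic_eq_zero h).1
    have : 0 < (v 0 * v 2) ^ 2 := by positivity
    nlinarith
  simpa [trinodalQuartic, h0, h2] using h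

/-- The oval of the quartic stays away from the conic `xy + yz + zx = 0`. -/
lemma separation_of_trinodalQuartic_eq_zero {v : Fin 3 → ℝ} (h : trinodalQuartic v = 0) :
    v 0 * v 1 + v 1 * v 2 + v 0 * v 2 = 0 ∨
      v 0 ^ 2 + v 1 ^ 2 + v 2 ^ 2 < 10 * (v 0 * v 1 + v 1 * v 2 + v 0 * v 2) := by
  by_cases h0 : v 0 = 0
  · left
    simpa [trinodalQuartic, h0] using h
  by_cases h1 : v 1 = 0
  · left
    have h2 : v 2 = 0 := by simpa [trinodalQuartic, h0, h1] using h
    simp [h1, h2]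
  by_cases h2 : v 2 = 0
  · left
    have h1 : v 1 = 0 := by simpa [trinodalQuartic, h0, h2] using h
    simp [h1, h2]
  right
  obtain ⟨hz, hy⟩ := mul_nonpos_of_trinodalQuartic_eq_zero h
  replace hz := nonpos_of_mul_nonpos_right hz (by positivity)
  replace hy := nonpos_of_mul_nonpos_right hy (by positivity)
  have : 0 < v 0 ^ 2 := by positivity
  nlinarith [sq_nonneg (v 1 - v 2), sq_nonneg (v 0 - v 2), sq_nonneg (v 0 - v 1)]

lemma ovalPoint_ne_zero (t : ℝ) : ovalPoint t ≠ 0 := fun h => by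
  have h2 : (t ^ 2 + 1) * (t ^ 2 + 2) = 0 := congrFun h 2
  have : 0 < (t ^ 2 + 1) * (t ^ 2 + 2) := by positivity
  exact this.ne' h2

/-- The points on the oval, the nodes, and two points on the conic `xy + yz + zx = 0`. -/
def specialVector : Fin 24 → Fin 3 → ℝ :=
  Fin.append (fun i : Fin 19 => ovalPoint (i : ℕ))
    ![![1, 0, 0], ![0, 1, 0], ![0, 0, 1], ![2, 2, -1], ![2, -1, 2]]

lemma specialVector_ne_zero (i : Fin 24) : specialVector i ≠ 0 := by
  refine Fin.addCases (m := 19) (n := 5) (fun i => ?_) (fun i => ?_) i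
  · rw [specialVector, Fin.append_left]
    exact ovalPoint_ne_zero _
  · rw [specialVector, Fin.append_right]
    fin_cases i <;> simp

/-- There exist 24 points of `ℝP²` such that no connected component of the real point set of
a real sextic contains all of them (i.e. `c'(6) ≤ 23`). -/
theorem stmt_13 :
    ∃ p : Fin 24 → RP2, ∀ F : MvPolynomial (Fin 3) ℝ, F ≠ 0 → F.IsHomogeneous 6 →
      ¬ inOneComponent (zeroSet F) (Set.range p) := by
  refine ⟨fun i => Projectivization.mk ℝ (specialVector i) (specialVector_ne_zero i), ?_⟩
  rintro F hF0 hF ⟨p₀, -, hsub⟩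
  obtain ⟨T, hTdef⟩ : ∃ T, T = connectedComponentIn (zeroSet F) p₀ := ⟨_, rfl⟩
  have hT : IsPreconnected T := hTdef ▸ isPreconnected_connectedComponentIn
  have hTF : T ⊆ zeroSet F := hTdef ▸ connectedComponentIn_subset _ _
  rw [← hTdef] at hsub
  have hmem (i : Fin 24) : Projectivization.mk ℝ _ (specialVector_ne_zero i) ∈ T := hsub ⟨i, rfl⟩
  have heval (i : Fin 24) : MvPolynomial.eval (specialVector i) F = 0 :=
    (mk_mem_zeroSet_iff hF (specialVector_ne_zero i)).1 (hTF (hmem i))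
  have v₀ : specialVector 19 = ![1, 0, 0] := rfl
  have v₁ : specialVector 20 = ![0, 1, 0] := rfl
  have v₂ : specialVector 21 = ![0, 0, 1] := rfl
  have v₃ : specialVector 22 = ![2, 2, -1] := rfl
  have v₄ : specialVector 23 = ![2, -1, 2] := rfl
  have vo : specialVector 0 = ![2, 1, 2] := by
    change ovalPoint (0 : ℕ) = _
    simp [ovalPoint]
  obtain ⟨c, hc⟩ := exists_eval_eq_ternaryForm hF
  have h₀ : c 6 0 = 0 := by
    have := heval 19
    rw [hc, v₀] at this
    simpa [ternaryForm, Finset.sum_range_succ] using this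
  have h₁ : c 0 6 = 0 := by
    have := heval 20
    rw [hc, v₁] at this
    simpa [ternaryForm, Finset.sum_range_succ] using this
  have h₂ : c 0 0 = 0 := by
    have := heval 21
    rw [hc, v₂] at this
    simpa [ternaryForm, Finset.sum_range_succ] using this
  have hP : ovalPullback c = 0 := by
    refine Polynomial.eq_zero_of_natDegree_lt_card_of_eval_eq_zero _
      (f := fun i : Fin 19 => ((i : ℕ) : ℝ)) (Nat.cast_injective.comp Fin.val_injective)
      (fun i => ?_) ((natDegree_ovalPullback_le h₀ h₁ h₂).trans_lt (by simp))
    have := heval (Fin.castAdd 5 i)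
    rw [specialVector, Fin.append_left, hc, ternaryForm_ovalPoint h₀ h₁ h₂] at this
    refine (mul_eq_zero.1 this).resolve_left ?_
    positivity
  obtain ⟨q, hq⟩ := ternaryForm_eq_trinodalQuartic_mul_conic h₀ h₁ h₂ hP
  have hFq (v) : MvPolynomial.eval v F = trinodalQuartic v * conic q v := (hc v).trans (hq v)
  have hTq (p) (hp : p ∈ T) : trinodalQuartic p.rep * conic q p.rep = 0 :=
    (hFq p.rep).symm.trans (hTF hp)
  have q₀ : q 0 = 0 := by
    have := conic_eq_zero_of_isPreconnected hT hTq ![1, 0, 0, 0, 0, -9] ![0, 0, 1, 0, 0, 1]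
      (specialVector_ne_zero 19) (specialVector_ne_zero 0) (hmem 19) (hmem 0)
      (by simp [conic, v₀]) (by simp [conic, vo]; norm_num)
      (fun v hv => by
        have hv' : v 1 = 0 ∧ v 2 = 0 := by
          simp [conic] at hv
          constructor <;> nlinarith [sq_nonneg (v 1), sq_nonneg (v 2)]
        refine ⟨v 0, ?_⟩
        ext i
        fin_cases i <;> simp [v₀, hv'])
      (fun v hv hf => by
        obtain ⟨h1, h2⟩ := eq_zero_of_trinodalQuartic_of_lt₀ hv (by simp [conic] at hf; linarith)
        simp [conic, h1, h2])
    simpa [conic, v₀] using this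
  have q₂ : q 2 = 0 := by
    have := conic_eq_zero_of_isPreconnected hT hTq ![-9, 0, 1, 0, 0, 0] ![1, 0, 0, 0, 0, 1]
      (specialVector_ne_zero 20) (specialVector_ne_zero 0) (hmem 20) (hmem 0)
      (by simp [conic, v₁]) (by simp [conic, vo])
      (fun v hv => by
        have hv' : v 0 = 0 ∧ v 2 = 0 := by
          simp [conic] at hv
          constructor <;> nlinarith [sq_nonneg (v 0), sq_nonneg (v 2)]
        refine ⟨v 1, ?_⟩
        ext i
        fin_cases i <;> simp [v₁, hv'])
      (fun v hv hf => by
        obtain ⟨h1, h2⟩ := eq_zero_of_trinodalQuartic_of_lt₁ hv (by simp [conic] at hf; linarith)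
        simp [conic, h1, h2])
    simpa [conic, v₁] using this
  have q₅ : q 5 = 0 := by
    have := conic_eq_zero_of_isPreconnected hT hTq ![-9, 0, 0, 0, 0, 1] ![1, 0, 1, 0, 0, 0]
      (specialVector_ne_zero 21) (specialVector_ne_zero 0) (hmem 21) (hmem 0)
      (by simp [conic, v₂]) (by simp [conic, vo]; norm_num)
      (fun v hv => by
        have hv' : v 0 = 0 ∧ v 1 = 0 := by
          simp [conic] at hv
          constructor <;> nlinarith [sq_nonneg (v 0), sq_nonneg (v 1)]
        refine ⟨v 2, ?_⟩
        ext i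
        fin_cases i <;> simp [v₂, hv'])
      (fun v hv hf => by
        obtain ⟨h1, h2⟩ := eq_zero_of_trinodalQuartic_of_lt₂ hv (by simp [conic] at hf; linarith)
        simp [conic, h1, h2])
    simpa [conic, v₂] using this
  have e₃ : -2 * q 4 - 2 * q 3 + 4 * q 1 = 0 := by
    have h := heval 22
    rw [hFq, v₃] at h
    simp [trinodalQuartic, conic, q₀, q₂, q₅] at h
    norm_num at h
    linarith
  have e₄ : -2 * q 4 + 4 * q 3 - 2 * q 1 = 0 := by
    have h := heval 23
    rw [hFq, v₄] at h
    simp [trinodalQuartic, conic, q₀, q₂, q₅] at h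
    norm_num at h
    linarith
  have hconic (v) : conic q v = q 1 * (v 0 * v 1 + v 1 * v 2 + v 0 * v 2) := by
    rw [conic, q₀, q₂, q₅, show q 3 = q 1 by linarith, show q 4 = q 1 by linarith]
    ring
  have hq₁ : q 1 ≠ 0 := fun h =>
    hF0 (MvPolynomial.funext fun v => by rw [hFq, hconic, h, zero_mul, mul_zero, map_zero])
  obtain ⟨p, -, hp⟩ := hT {p : RP2 | 0 < conic ![-1, 10, -1, 10, 10, -1] p.rep}
    {p : RP2 | 0 < conic ![1, -10, 1, -10, -10, 1] p.rep}
    (isOpen_setOf_conic_pos _) (isOpen_setOf_conic_pos _)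
    (fun p hp => by
      have hS := hTq p hp
      have hcases : p.rep 0 * p.rep 1 + p.rep 1 * p.rep 2 + p.rep 0 * p.rep 2 = 0 ∨
          p.rep 0 ^ 2 + p.rep 1 ^ 2 + p.rep 2 ^ 2
            < 10 * (p.rep 0 * p.rep 1 + p.rep 1 * p.rep 2 + p.rep 0 * p.rep 2) := by
        rcases mul_eq_zero.1 hS with h | h
        · exact separation_of_trinodalQuartic_eq_zero h
        · rw [hconic] at h
          exact Or.inl ((mul_eq_zero.1 h).resolve_left hq₁)
      rcases hcases with h | h
      · right
        have hpos : 0 < p.rep 0 ^ 2 + p.rep 1 ^ 2 + p.rep 2 ^ 2 := by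
          by_contra hneg
          refine p.rep_nonzero (funext fun i => ?_)
          fin_cases i <;> simp <;>
            nlinarith [sq_nonneg (p.rep 0), sq_nonneg (p.rep 1), sq_nonneg (p.rep 2)]
        simp [conic]
        linarith
      · left
        simp [conic]
        linarith)
    ⟨_, hmem 0, (conic_rep_mk_pos_iff _ _).2 (by simp [conic, vo]; norm_num)⟩
    ⟨_, hmem 19, (conic_rep_mk_pos_iff _ _).2 (by simp [conic, v₀])⟩
  have hp₁ : 0 < conic ![-1, 10, -1, 10, 10, -1] p.rep := hp.1
  have hp₂ : 0 < conic ![1, -10, 1, -10, -10, 1] p.rep := hp.2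
  simp only [conic, Matrix.cons_val] at hp₁ hp₂
  linarith
end
end

section
/- Let F, G ∈ ℝ[x₀,x₁,x₂] be homogeneous polynomials of degrees p ≥ 1 and q ≥ 1 respectively, having no common nonconstant factor (i.e. coprime in the unique factorization domain ℝ[x₀,x₁,x₂]). Then the set of common real zeros {x ∈ ℝP² : F(x) = 0 and G(x) = 0} is finite and has cardinality at most p·q. -/
noncomputable section

namespace MvPolynomial

open Module

variable {σ K : Type*} [Field K]

/-- The space of ternary forms of degree `n` has dimension `(n + 2 choose 2)`. -/
theorem finrank_homogeneousSubmodule_fin_three (n : ℕ) :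
    finrank K (homogeneousSubmodule (Fin 3) K n) = (n + 2).choose 2 := by
  have hset : {d : Fin 3 →₀ ℕ | d.degree = n} =
      ↑((Finset.univ : Finset (Fin 3)).finsuppAntidiag n) := by
    ext d
    simp [Finset.mem_finsuppAntidiag, Finsupp.degree_eq_sum]
  rw [homogeneousSubmodule_eq_finsupp_supported, hset,
    (AddMonoidAlgebra.supportedEquivFinsupp (R := K) (S := K) _).finrank_eq, finrank_finsupp_self]
  simp only [SetLike.coe_sort_coe, Fintype.card_coe, Finset.card_finsuppAntidiag_nat_eq_choose,
    Finset.card_univ, Fintype.card_fin]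
  rw [show 3 + n - 1 = n + 2 by lia, Nat.choose_symm_add]

instance [Finite σ] (n : ℕ) : FiniteDimensional K (homogeneousSubmodule σ K n) :=
  Module.Finite.iff_fg.mpr (homogeneousSubmodule_fg σ K n)

theorem IsHomogeneous.homogeneousComponent_mul {F : MvPolynomial σ K} {p : ℕ}
    (hF : F.IsHomogeneous p) (C : MvPolynomial σ K) (m : ℕ) :
    homogeneousComponent (p + m) (F * C) = F * homogeneousComponent m C := by
  let := gradedAlgebra (σ := σ) (R := K)
  have h := DirectSum.coe_decompose_mul_add_of_left_mem (homogeneousSubmodule σ K)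
    (i := p) (j := m) (a := F) (b := C) hF
  simpa [← decomposition.decompose'_apply] using h

/-- Multiplication by a form of degree `p`, as a linear map between spaces of forms. -/
def homogeneousMul {F : MvPolynomial σ K} {p : ℕ} (hF : F.IsHomogeneous p) {m n : ℕ}
    (h : p + m = n) : homogeneousSubmodule σ K m →ₗ[K] homogeneousSubmodule σ K n :=
  (LinearMap.mulLeft K F).restrict fun _ hA => h ▸ hF.mul hA

@[simp]
theorem coe_homogeneousMul {F : MvPolynomial σ K} {p : ℕ} (hF : F.IsHomogeneous p) {m n : ℕ}
    (h : p + m = n) (A : homogeneousSubmodule σ K m) :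
    (homogeneousMul hF h A : MvPolynomial σ K) = F * A := rfl

/-- Every syzygy `F * A + G * B = 0` between coprime forms is a multiple of the Koszul syzygy. -/
theorem exists_koszul_of_syzygy {F G A B : MvPolynomial σ K} {p m : ℕ} (hF0 : F ≠ 0)
    (hF : F.IsHomogeneous p) (hFG : IsRelPrime F G) (hB : B.IsHomogeneous (p + m))
    (h : F * A + G * B = 0) :
    ∃ C : MvPolynomial σ K, C.IsHomogeneous m ∧ A = -(G * C) ∧ B = F * C := by
  obtain ⟨C, hC⟩ : F ∣ B := hFG.dvd_of_dvd_mul_left (z := B) ⟨-A, by linear_combination h⟩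
  have hBC : B = F * homogeneousComponent m C := by
    rw [← hF.homogeneousComponent_mul, ← hC, homogeneousComponent_eq_self hB]
  refine ⟨homogeneousComponent m C, homogeneousComponent_isHomogeneous m C, ?_, hBC⟩
  refine mul_left_cancel₀ hF0 ?_
  linear_combination h - G * hBC

/-- In degree `p + q + m`, the ideal generated by coprime ternary forms of degrees `p` and `q`
has codimension at most `p * q`. -/
theorem finrank_homogeneousSubmodule_le_finrank_range_add {F G : MvPolynomial (Fin 3) K}
    {p q : ℕ} (hF0 : F ≠ 0) (hF : F.IsHomogeneous p) (hG : G.IsHomogeneous q)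
    (hFG : IsRelPrime F G) {m d : ℕ} (hp : p + (q + m) = d) (hq : q + (p + m) = d) :
    finrank K (homogeneousSubmodule (Fin 3) K d) ≤
      finrank K (LinearMap.range ((homogeneousMul hF hp).coprod (homogeneousMul hG hq))) +
        p * q := by
  set φ := (homogeneousMul hF hp).coprod (homogeneousMul hG hq)
  set ψ := (-homogeneousMul hG (m := m) rfl).prod (homogeneousMul hF (m := m) rfl)
  have hker : LinearMap.ker φ ≤ LinearMap.range ψ := by
    rintro ⟨A, B⟩ hAB
    have hAB : F * (A : MvPolynomial (Fin 3) K) + G * B = 0 := by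
      simpa [φ] using congrArg Subtype.val (LinearMap.mem_ker.mp hAB)
    obtain ⟨C, hC, hAC, hBC⟩ := exists_koszul_of_syzygy hF0 hF hFG B.2 hAB
    exact ⟨⟨C, hC⟩, Prod.ext (Subtype.ext hAC.symm) (Subtype.ext hBC.symm)⟩
  have hle := (Submodule.finrank_mono hker).trans (LinearMap.finrank_range_le ψ)
  have hrn := LinearMap.finrank_range_add_finrank_ker φ
  rw [finrank_prod] at hrn
  simp only [finrank_homogeneousSubmodule_fin_three] at hle hrn ⊢
  have hchoose : (d + 2).choose 2 + (m + 2).choose 2 =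
      (q + m + 2).choose 2 + (p + m + 2).choose 2 + p * q := by
    subst hp
    have : (((p + (q + m) + 2).choose 2 + (m + 2).choose 2 : ℕ) : ℚ) =
        ((q + m + 2).choose 2 + (p + m + 2).choose 2 + p * q : ℕ) := by
      push_cast [Nat.cast_choose_two]
      ring
    exact_mod_cast this
  omega

/-- The linear form with the same values as a functional on `σ → K`. -/
theorem exists_isHomogeneous_one_eval_eq [Fintype σ] (l : (σ → K) →ₗ[K] K) :
    ∃ L : MvPolynomial σ K, L.IsHomogeneous 1 ∧ ∀ v, eval v L = l v := by
  classical
  refine ⟨∑ i, C (l (Pi.single i 1)) * X i,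
    IsHomogeneous.sum _ _ _ fun i _ => isHomogeneous_C_mul_X _ i, fun v => ?_⟩
  rw [LinearMap.pi_apply_eq_sum_univ l v]
  simp only [map_sum, map_mul, eval_C, eval_X, smul_eq_mul]
  refine Finset.sum_congr rfl fun i _ => ?_
  rw [mul_comm]
  congr 2
  ext j
  simp [Pi.single_apply, eq_comm]

/-- Two distinct points of a projective space are separated by a linear form. -/
theorem exists_isHomogeneous_one_separating [Fintype σ] {P Q : Projectivization K (σ → K)}
    (h : P ≠ Q) :
    ∃ L : MvPolynomial σ K, L.IsHomogeneous 1 ∧ eval P.rep L ≠ 0 ∧ eval Q.rep L = 0 := by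
  have hPQ : P.rep ∉ K ∙ Q.rep := by
    intro hmem
    obtain ⟨a, ha⟩ := Submodule.mem_span_singleton.mp hmem
    refine h ?_
    rw [← P.mk_rep, ← Q.mk_rep, Projectivization.mk_eq_mk_iff']
    exact ⟨a, ha⟩
  obtain ⟨l, hl, hlQ⟩ := Submodule.exists_le_ker_of_notMem hPQ
  obtain ⟨L, hL, hLl⟩ := exists_isHomogeneous_one_eval_eq l
  exact ⟨L, hL, by rwa [hLl], by
    rw [hLl]; exact hlQ (Submodule.mem_span_singleton_self _)⟩

/-- Forms of large degree isolate any point of a finite set of projective points. -/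
theorem exists_isHomogeneous_isolating [Fintype σ] (S : Finset (Projectivization K (σ → K)))
    {d : ℕ} (hd : S.card ≤ d) (P : Projectivization K (σ → K)) :
    ∃ f : MvPolynomial σ K, f.IsHomogeneous d ∧ eval P.rep f ≠ 0 ∧
      ∀ Q ∈ S, Q ≠ P → eval Q.rep f = 0 := by
  classical
  have hsep (Q : Projectivization K (σ → K)) : ∃ L : MvPolynomial σ K,
      L.IsHomogeneous 1 ∧ eval P.rep L ≠ 0 ∧ (Q ≠ P → eval Q.rep L = 0) := by
    by_cases hQ : Q = P
    · obtain ⟨i, hi⟩ := Function.ne_iff.mp P.rep_nonzero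
      exact ⟨X i, isHomogeneous_X K i, by simpa using hi, fun h => absurd hQ h⟩
    · obtain ⟨L, hL, hP, hLQ⟩ := exists_isHomogeneous_one_separating (Ne.symm hQ)
      exact ⟨L, hL, hP, fun _ => hLQ⟩
  choose L hL hLP hLQ using hsep
  refine ⟨(∏ Q ∈ S, L Q) * L P ^ (d - S.card), ?_, ?_, fun Q hQ hQP => ?_⟩
  · have h := (IsHomogeneous.prod S L (fun _ => 1) fun Q _ => hL Q).mul
      ((hL P).pow (d - S.card))
    simpa [Nat.add_sub_cancel' hd] using h
  · simp [map_prod, Finset.prod_eq_zero_iff, hLP]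
  · rw [map_mul, map_prod, Finset.prod_eq_zero hQ (hLQ Q hQP), zero_mul]

/-- Evaluation of forms of degree `d` at chosen representatives of projective points. -/
def evalRep (S : Finset (Projectivization K (σ → K))) (d : ℕ) :
    homogeneousSubmodule σ K d →ₗ[K] (S → K) :=
  (LinearMap.pi fun P : S => (aeval P.1.rep : MvPolynomial σ K →ₐ[K] K).toLinearMap) ∘ₗ
    (homogeneousSubmodule σ K d).subtype

@[simp]
theorem evalRep_apply (S : Finset (Projectivization K (σ → K))) (d : ℕ)
    (f : homogeneousSubmodule σ K d) (P : S) :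
    evalRep S d f P = eval P.1.rep (f : MvPolynomial σ K) := by
  simp [evalRep]

theorem evalRep_surjective [Fintype σ] (S : Finset (Projectivization K (σ → K))) {d : ℕ}
    (hd : S.card ≤ d) : Function.Surjective (evalRep S d) := by
  choose f hf hfP hfQ using exists_isHomogeneous_isolating S hd
  intro g
  refine ⟨∑ P : S, (g P / eval P.1.rep (f P)) • ⟨f P, hf P⟩, ?_⟩
  ext Q
  rw [map_sum, Finset.sum_apply, Finset.sum_eq_single Q]
  · simp [hfP]
  · intro P _ hPQ
    simp [hfQ P Q Q.2 fun h => hPQ (Subtype.ext h.symm)]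
  · simp

/-- Bezout's inequality for a finite set of common zeros of two coprime ternary forms. -/
theorem card_le_mul_of_forall_eval_eq_zero {F G : MvPolynomial (Fin 3) K} {p q : ℕ}
    (hF0 : F ≠ 0) (hF : F.IsHomogeneous p) (hG : G.IsHomogeneous q) (hFG : IsRelPrime F G)
    (S : Finset (Projectivization K (Fin 3 → K)))
    (hS : ∀ P ∈ S, eval P.rep F = 0 ∧ eval P.rep G = 0) : S.card ≤ p * q := by
  have hp : p + (q + S.card) = p + q + S.card := by lia
  have hq : q + (p + S.card) = p + q + S.card := by lia
  have hcodim := finrank_homogeneousSubmodule_le_finrank_range_add hF0 hF hG hFG hp hq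
  have hsurj := evalRep_surjective S (show S.card ≤ p + q + S.card by lia)
  have hrange : LinearMap.range ((homogeneousMul hF hp).coprod (homogeneousMul hG hq)) ≤
      LinearMap.ker (evalRep S (p + q + S.card)) := by
    rintro _ ⟨⟨A, B⟩, rfl⟩
    ext P
    simp [hS P.1 P.2]
  have hle := Submodule.finrank_mono hrange
  have hrn := LinearMap.finrank_range_add_finrank_ker (evalRep S (p + q + S.card))
  rw [LinearMap.range_eq_top.mpr hsurj, finrank_top, finrank_fintype_fun_eq_card,
    Fintype.card_coe] at hrn
  omega

end MvPolynomial

/-- The real Bezout theorem: if `F`, `G` are homogeneous of degrees `p, q ≥ 1` and have no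
common nonconstant factor, then their set of common real zeros in `ℝP²` is finite, of
cardinality at most `p * q`. -/
theorem stmt_15 (p q : ℕ) (hp : 1 ≤ p) (hq : 1 ≤ q)
    (F G : MvPolynomial (Fin 3) ℝ) (hF0 : F ≠ 0) (hG0 : G ≠ 0)
    (hF : F.IsHomogeneous p) (hG : G.IsHomogeneous q)
    (hcop : ∀ d : MvPolynomial (Fin 3) ℝ, d ∣ F → d ∣ G → IsUnit d) :
    (zeroSet F ∩ zeroSet G).Finite ∧ (zeroSet F ∩ zeroSet G).ncard ≤ p * q := by
  have hbound (S : Finset RP2) (hS : ↑S ⊆ zeroSet F ∩ zeroSet G) : S.card ≤ p * q :=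
    MvPolynomial.card_le_mul_of_forall_eval_eq_zero hF0 hF hG (fun d => hcop d) S
      fun P hP => hS hP
  have hfin : (zeroSet F ∩ zeroSet G).Finite := by
    by_contra hinf
    obtain ⟨S, hS, hcard⟩ := Set.Infinite.exists_subset_card_eq hinf (p * q + 1)
    have := hbound S hS
    lia
  refine ⟨hfin, ?_⟩
  rw [Set.ncard_eq_toFinset_card _ hfin]
  exact hbound _ (by simp)
end
end

section
/- Let m₁, m₂ ≥ 1 and let F ∈ ℝ[x₀,x₁,y₀,y₁] be a nonzero polynomial that is homogeneous of degree m₁ in (x₀,x₁) and of degree m₂ in (y₀,y₁), and suppose the curve defined by F is nonsingular over ℂ, i.e. for every pair (x, y) ∈ (ℂ²∖{0}) × (ℂ²∖{0}) with F(x,y) = 0, the four partial derivatives ∂F/∂x₀, ∂F/∂x₁, ∂F/∂y₀, ∂F/∂y₁ do not all vanish at (x,y). Then the number of connected components of the real point set Z_ℝ(F) ⊆ ℝP¹ × ℝP¹ is at most (m₁ − 1)(m₂ − 1) + 1 (the Harnack inequality for curves of bidegree (m₁,m₂) on a quadric). -/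
noncomputable section

/-- The real projective line, the projectivization of `ℝ²`. -/
abbrev RP1 := Projectivization ℝ (Fin 2 → ℝ)

/-- `ℝP¹` carries the quotient topology from `ℝ² ∖ {0}`. -/
instance : TopologicalSpace RP1 :=
  inferInstanceAs (TopologicalSpace (Quotient (projectivizationSetoid ℝ (Fin 2 → ℝ))))

section Bihomogeneous
open MvPolynomial

/-- The bigrading on polynomials in `x₀, x₁, y₀, y₁`. -/
def biweight : Fin 4 → ℕ × ℕ := ![(1, 0), (1, 0), (0, 1), (0, 1)]

/-- Bihomogeneous polynomials of a given bidegree. -/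
abbrev bihom (K : Type*) [Field K] (m : ℕ × ℕ) : Submodule K (MvPolynomial (Fin 4) K) :=
  weightedHomogeneousSubmodule K biweight m

theorem weight_biweight (d : Fin 4 →₀ ℕ) :
    Finsupp.weight biweight d = (d 0 + d 1, d 2 + d 3) := by
  rw [Finsupp.weight_apply, Finsupp.sum_fintype _ _ (by simp)]
  ext <;> simp [Fin.sum_univ_four, biweight]

theorem mem_bihom_iff {K : Type*} [Field K] {m : ℕ × ℕ} {P : MvPolynomial (Fin 4) K} :
    P ∈ bihom K m ↔ ∀ d ∈ P.support, d 0 + d 1 = m.1 ∧ d 2 + d 3 = m.2 := by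
  simp only [mem_weightedHomogeneousSubmodule, IsWeightedHomogeneous, weight_biweight,
    mem_support_iff, Prod.ext_iff]

section Factor
variable {σ K : Type*} [Field K] (w : σ → ℕ)

/-- Scaling each variable `X i` by `T ^ w i`. -/
def weightScale : MvPolynomial σ K →ₐ[K] Polynomial (MvPolynomial σ K) :=
  aeval fun i => Polynomial.monomial (w i) (X i)

theorem coeff_weightScale (A : MvPolynomial σ K) (k : ℕ) :
    (weightScale w A).coeff k = weightedHomogeneousComponent w k A := by
  classical
  induction A using MvPolynomial.monomial_add_induction_on with
  | C a =>
    rw [weightScale, MvPolynomial.algHom_C, Polynomial.algebraMap_apply, Polynomial.coeff_C,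
      weightedHomogeneousComponent_of_mem (n := 0) (isWeightedHomogeneous_C w a)]
    rfl
  | monomial_add d c p hd hc ih =>
    rw [map_add, Polynomial.coeff_add, ih, map_add]
    congr 1
    rw [weightedHomogeneousComponent_of_mem (isWeightedHomogeneous_monomial w d c rfl)]
    have : weightScale w (monomial d c) =
        Polynomial.monomial (Finsupp.weight w d) (monomial d c) := by
      rw [weightScale, aeval_monomial, Finsupp.weight_apply]
      simp only [Finsupp.prod, Finsupp.sum, ← Polynomial.C_mul_X_pow_eq_monomial, mul_pow,
        ← pow_mul,
        ← map_pow]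
      rw [Finset.prod_mul_distrib, Finset.prod_pow_eq_pow_sum, ← map_prod,
        Polynomial.algebraMap_apply, ← mul_assoc, ← map_mul]
      congr 2
      · rw [monomial_eq]; rfl
      · exact Finset.sum_congr rfl fun i _ => by simp [mul_comm]
    rw [this, Polynomial.coeff_monomial]
    simp only [eq_comm]

/-- A factor of a nonzero weighted homogeneous polynomial is weighted homogeneous. -/
theorem IsWeightedHomogeneous.exists_of_mul {A B : MvPolynomial σ K} {n : ℕ}
    (h : IsWeightedHomogeneous w (A * B) n) (hAB : A * B ≠ 0) :
    ∃ k, IsWeightedHomogeneous w A k := by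
  classical
  have key : weightScale w A * weightScale w B = Polynomial.monomial n (A * B) := by
    rw [← map_mul]
    ext1 k
    rw [coeff_weightScale, weightedHomogeneousComponent_of_mem h, Polynomial.coeff_monomial]
    simp only [eq_comm]
  have hne : weightScale w A * weightScale w B ≠ 0 := by
    rw [key]; simpa using hAB
  have h1 := Polynomial.natDegree_mul (left_ne_zero_of_mul hne) (right_ne_zero_of_mul hne)
  have h2 := Polynomial.natTrailingDegree_mul (left_ne_zero_of_mul hne) (right_ne_zero_of_mul hne)
  rw [key, Polynomial.natDegree_monomial_eq _ hAB] at h1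
  rw [key, Polynomial.natTrailingDegree_monomial hAB] at h2
  have h3 := Polynomial.natTrailingDegree_le_natDegree (weightScale w A)
  have h4 := Polynomial.natTrailingDegree_le_natDegree (weightScale w B)
  refine ⟨(weightScale w A).natDegree, fun d hd => ?_⟩
  by_contra hc
  have h0 : (weightScale w A).coeff (Finsupp.weight w d) = 0 := by
    rcases lt_or_gt_of_ne hc with h | h
    · exact Polynomial.coeff_eq_zero_of_lt_natTrailingDegree (by omega)
    · exact Polynomial.coeff_eq_zero_of_natDegree_lt h
  rw [coeff_weightScale] at h0
  apply hd
  have := congrArg (coeff d) h0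
  rwa [coeff_weightedHomogeneousComponent, if_pos rfl, coeff_zero] at this

end Factor

section
variable {K : Type*} [Field K]

theorem bihom_of_mul {A B : MvPolynomial (Fin 4) K} {m : ℕ × ℕ} (h : A * B ∈ bihom K m)
    (hAB : A * B ≠ 0) : ∃ k, A ∈ bihom K k := by
  have hw : ∀ d : Fin 4 →₀ ℕ, Finsupp.weight ![1, 1, 0, 0] d = d 0 + d 1 ∧
      Finsupp.weight ![0, 0, 1, 1] d = d 2 + d 3 := fun d => by
    rw [Finsupp.weight_apply, Finsupp.sum_fintype _ _ (by simp), Finsupp.weight_apply,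
      Finsupp.sum_fintype _ _ (by simp)]
    simp [Fin.sum_univ_four]
  rw [mem_bihom_iff] at h
  obtain ⟨k, hk⟩ := IsWeightedHomogeneous.exists_of_mul (n := m.1) ![1, 1, 0, 0]
    (fun d hd => by rw [(hw d).1]; exact (h d (mem_support_iff.2 hd)).1) hAB
  obtain ⟨l, hl⟩ := IsWeightedHomogeneous.exists_of_mul (n := m.2) ![0, 0, 1, 1]
    (fun d hd => by rw [(hw d).2]; exact (h d (mem_support_iff.2 hd)).2) hAB
  refine ⟨(k, l), mem_bihom_iff.2 fun d hd => ?_⟩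
  have h1 := hk (mem_support_iff.1 hd)
  have h2 := hl (mem_support_iff.1 hd)
  rw [(hw d).1] at h1
  rw [(hw d).2] at h2
  exact ⟨h1, h2⟩

theorem mul_mem_bihom {A B : MvPolynomial (Fin 4) K} {m n : ℕ × ℕ} (hA : A ∈ bihom K m)
    (hB : B ∈ bihom K n) : A * B ∈ bihom K (m + n) :=
  IsWeightedHomogeneous.mul hA hB

theorem component_mul {A B : MvPolynomial (Fin 4) K} {m : ℕ × ℕ} (hB : B ∈ bihom K m)
    (n : ℕ × ℕ) : weightedHomogeneousComponent biweight (n + m) (A * B) =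
      weightedHomogeneousComponent biweight n A * B := by
  let := weightedGradedAlgebra K biweight
  have := DirectSum.coe_decompose_mul_add_of_right_mem (bihom K) (a := A) (i := n) hB
  rw [← weightedDecomposition.decompose'_apply, ← weightedDecomposition.decompose'_apply]
  exact this

/-- Cofactors of bihomogeneous polynomials are bihomogeneous. -/
theorem cofactor_mem_bihom {A B : MvPolynomial (Fin 4) K} {m n : ℕ × ℕ} (hB : B ∈ bihom K m)
    (hB0 : B ≠ 0) (h : A * B ∈ bihom K (n + m)) : A ∈ bihom K n := by
  have h1 := component_mul (A := A) hB n
  rw [weightedHomogeneousComponent_eq_self h] at h1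
  rw [mul_right_cancel₀ hB0 h1]
  exact weightedHomogeneousComponent_mem _ _ _

/-- Bidegrees are monotone under divisibility. -/
theorem bidegree_le_of_mul {A B : MvPolynomial (Fin 4) K} {m n : ℕ × ℕ} (hB : B ∈ bihom K m)
    (h : A * B ∈ bihom K n) (hAB : A * B ≠ 0) : m ≤ n := by
  obtain ⟨k, hk⟩ := bihom_of_mul h hAB
  have := (IsWeightedHomogeneous.inj_right hAB (mul_mem_bihom hk hB) h)
  rw [← this]
  exact le_add_self

theorem isUnit_of_mem_bihom_zero {A : MvPolynomial (Fin 4) K} (hA : A ∈ bihom K 0) (hA0 : A ≠ 0) :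
    IsUnit A := by
  have : A = C (coeff 0 A) := by
    ext d
    rw [coeff_C]
    split_ifs with h
    · rw [h]
    · by_contra hd
      have := mem_bihom_iff.1 hA d (mem_support_iff.2 hd)
      apply h
      ext i
      fin_cases i <;> simp_all
  rw [this]
  refine IsUnit.map C (isUnit_iff_ne_zero.2 fun h => hA0 ?_)
  rw [this, h, map_zero]

/-- Exponents of bidegree `(p, q)`. -/
def biexponentEquiv (p q : ℕ) :
    {d : Fin 4 →₀ ℕ | Finsupp.weight biweight d = (p, q)} ≃ Fin (p + 1) × Fin (q + 1) where
  toFun d :=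
    (⟨d.1 0, by
      have := d.2
      simp only [Set.mem_ofPred_eq, weight_biweight, Prod.mk.injEq] at this
      omega⟩,
    ⟨d.1 2, by
      have := d.2
      simp only [Set.mem_ofPred_eq, weight_biweight, Prod.mk.injEq] at this
      omega⟩)
  invFun a := ⟨Finsupp.equivFunOnFinite.symm ![a.1, p - a.1, a.2, q - a.2], by
    have h1 := a.1.2
    have h2 := a.2.2
    simp [weight_biweight]; omega⟩
  left_inv d := by
    have := d.2; simp only [Set.mem_ofPred_eq, weight_biweight, Prod.mk.injEq] at this
    ext i
    fin_cases i <;> simp <;> omega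
  right_inv a := by simp

theorem finrank_bihom (p q : ℕ) : Module.finrank K (bihom K (p, q)) = (p + 1) * (q + 1) := by
  have : bihom K (p, q) = restrictSupport K {d | Finsupp.weight biweight d = (p, q)} := by
    ext P
    rw [mem_restrictSupport_iff, mem_weightedHomogeneousSubmodule]
    exact ⟨fun h d hd => h (mem_support_iff.1 hd), fun h d hd => h (mem_support_iff.2 hd)⟩
  rw [this, Module.finrank_eq_nat_card_basis (basisRestrictSupport K _),
    Nat.card_congr (biexponentEquiv p q)]
  simp

instance finite_bihom (m : ℕ × ℕ) : Module.Finite K (bihom K m) :=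
  Module.finite_of_finrank_pos (by rw [finrank_bihom m.1 m.2]; positivity)

end

end Bihomogeneous

section Bezout
open MvPolynomial

section
variable {K : Type*} [Field K]

/-- The bidegree `f + g + r` piece of the ideal generated by `F` and `G` of bidegrees `f`, `g`. -/
def idealPiece (F G : MvPolynomial (Fin 4) K) (f g r : ℕ × ℕ) :
    Submodule K (MvPolynomial (Fin 4) K) :=
  (bihom K (g + r)).map (LinearMap.mulRight K F) ⊔ (bihom K (f + r)).map (LinearMap.mulRight K G)

theorem finrank_map_mulRight {F : MvPolynomial (Fin 4) K} (hF : F ≠ 0) (m : ℕ × ℕ) :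
    Module.finrank K ((bihom K m).map (LinearMap.mulRight K F)) = (m.1 + 1) * (m.2 + 1) := by
  rw [← finrank_bihom (K := K)]
  exact (Submodule.equivMapOfInjective _ (mul_left_injective₀ hF) _).finrank_eq.symm

variable {F G : MvPolynomial (Fin 4) K} {f g : ℕ × ℕ}

instance finite_idealPiece (r : ℕ × ℕ) : Module.Finite K (idealPiece F G f g r) := by
  unfold idealPiece; infer_instance

theorem idealPiece_le (hF : F ∈ bihom K f) (hG : G ∈ bihom K g) (r : ℕ × ℕ) :
    idealPiece F G f g r ≤ bihom K (f + g + r) := by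
  rw [idealPiece, sup_le_iff, Submodule.map_le_iff_le_comap, Submodule.map_le_iff_le_comap]
  constructor
  · intro A hA
    have := mul_mem_bihom hA hF
    rwa [add_comm, ← add_assoc] at this
  · intro A hA
    have := mul_mem_bihom hA hG
    rwa [add_right_comm] at this

theorem finrank_idealPiece_le (hF : F ∈ bihom K f) (hG : G ∈ bihom K g) (hF0 : F ≠ 0)
    (hG0 : G ≠ 0) (r : ℕ × ℕ) :
    Module.finrank K (idealPiece F G f g r) + (f.1 * g.2 + f.2 * g.1) ≤
      Module.finrank K (bihom K (f + g + r)) := by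
  have h := Submodule.finrank_sup_add_finrank_inf_eq
    ((bihom K (g + r)).map (LinearMap.mulRight K F))
    ((bihom K (f + r)).map (LinearMap.mulRight K G))
  have hle : (bihom K r).map (LinearMap.mulRight K (F * G)) ≤
      (bihom K (g + r)).map (LinearMap.mulRight K F) ⊓
        (bihom K (f + r)).map (LinearMap.mulRight K G) := by
    rintro _ ⟨A, hA, rfl⟩
    refine ⟨⟨G * A, mul_mem_bihom hG hA, ?_⟩, ⟨F * A, mul_mem_bihom hF hA, ?_⟩⟩ <;>
    · simp only [LinearMap.mulRight_apply]; ring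
  have h2 := Submodule.finrank_mono hle
  rw [finrank_map_mulRight (mul_ne_zero hF0 hG0)] at h2
  rw [finrank_map_mulRight hF0, finrank_map_mulRight hG0] at h
  have h3 := finrank_bihom (K := K) (f + g + r).1 (f + g + r).2
  rw [Prod.mk.eta] at h3
  rw [h3]
  change Module.finrank K (idealPiece F G f g r) + _ = _ at h
  simp only [Prod.fst_add, Prod.snd_add] at h h2 ⊢
  nlinarith

theorem le_finrank_idealPiece (hF : F ∈ bihom K f) (hF0 : F ≠ 0)
    (hG0 : G ≠ 0) (hp : Prime F) (hFG : ¬ F ∣ G) (r : ℕ × ℕ) :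
    Module.finrank K (bihom K (f + g + r)) ≤
      Module.finrank K (idealPiece F G f g r) + (f.1 * g.2 + f.2 * g.1) := by
  have h := Submodule.finrank_sup_add_finrank_inf_eq
    ((bihom K (g + r)).map (LinearMap.mulRight K F))
    ((bihom K (f + r)).map (LinearMap.mulRight K G))
  have hle : (bihom K (g + r)).map (LinearMap.mulRight K F) ⊓
        (bihom K (f + r)).map (LinearMap.mulRight K G) ≤
      (bihom K r).map (LinearMap.mulRight K (F * G)) := by
    rintro _ ⟨⟨A, hA, rfl⟩, ⟨B, hB, hAB⟩⟩
    simp only [LinearMap.mulRight_apply] at hAB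
    obtain ⟨D, rfl⟩ := (hp.dvd_or_dvd (Dvd.intro_left A hAB.symm)).resolve_right hFG
    refine ⟨D, cofactor_mem_bihom hF hF0 ?_, ?_⟩
    · rwa [mul_comm, add_comm]
    · simp only [LinearMap.mulRight_apply]
      rw [← hAB]; ring
  have h2 := Submodule.finrank_mono hle
  rw [finrank_map_mulRight (mul_ne_zero hF0 hG0)] at h2
  rw [finrank_map_mulRight hF0, finrank_map_mulRight hG0] at h
  have h3 := finrank_bihom (K := K) (f + g + r).1 (f + g + r).2
  rw [Prod.mk.eta] at h3
  rw [h3]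
  change Module.finrank K (idealPiece F G f g r) + _ = _ at h
  simp only [Prod.fst_add, Prod.snd_add] at h h2 ⊢
  nlinarith

theorem X_mem_bihom (i : Fin 4) : (X i : MvPolynomial (Fin 4) K) ∈ bihom K (biweight i) :=
  isWeightedHomogeneous_X K biweight i

/-- Distinct points of `ℙ¹ × ℙ¹` impose independent conditions in large bidegree. -/
theorem exists_separating {ι : Type*} [Fintype ι] (P : ι → Fin 4 → K)
    (hx : ∀ i, P i 0 ≠ 0 ∨ P i 1 ≠ 0) (hy : ∀ i, P i 2 ≠ 0 ∨ P i 3 ≠ 0)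
    (hne : ∀ i j, i ≠ j → P i 0 * P j 1 - P i 1 * P j 0 ≠ 0 ∨ P i 2 * P j 3 - P i 3 * P j 2 ≠ 0)
    (m : ℕ × ℕ) (i : ι) :
    ∃ E ∈ bihom K (m + (Fintype.card ι, Fintype.card ι)),
      eval (P i) E ≠ 0 ∧ ∀ j, j ≠ i → eval (P j) E = 0 := by
  classical
  obtain ⟨L, hL, hLi⟩ : ∃ L ∈ bihom K (1, 0), eval (P i) L ≠ 0 :=
    (hx i).elim (fun h => ⟨X 0, X_mem_bihom 0, by simpa⟩) fun h => ⟨X 1, X_mem_bihom 1, by simpa⟩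
  obtain ⟨M, hM, hMi⟩ : ∃ L ∈ bihom K (0, 1), eval (P i) L ≠ 0 :=
    (hy i).elim (fun h => ⟨X 2, X_mem_bihom 2, by simpa⟩) fun h => ⟨X 3, X_mem_bihom 3, by simpa⟩
  have hs : ∀ j, ∃ S ∈ bihom K (1, 1), eval (P i) S ≠ 0 ∧ (j ≠ i → eval (P j) S = 0) := by
    intro j
    by_cases hji : j = i
    · exact ⟨L * M, mul_mem_bihom hL hM, by simp [hLi, hMi], fun h => absurd hji h⟩
    · rcases hne i j (Ne.symm hji) with h | h
      · refine ⟨(P j 1 • X 0 - P j 0 • X 1) * M, mul_mem_bihom (m := (1, 0)) (Submodule.sub_mem _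
          (Submodule.smul_mem _ _ (X_mem_bihom 0)) (Submodule.smul_mem _ _ (X_mem_bihom 1))) hM,
          ?_, fun _ => ?_⟩
        · simp only [map_mul, map_sub, smul_eval, eval_X]
          refine mul_ne_zero ?_ hMi
          convert h using 1; ring
        · simp [mul_comm]
      · refine ⟨L * (P j 3 • X 2 - P j 2 • X 3), mul_mem_bihom (n := (0, 1)) hL
          (Submodule.sub_mem _
          (Submodule.smul_mem _ _ (X_mem_bihom 2)) (Submodule.smul_mem _ _ (X_mem_bihom 3))),
          ?_, fun _ => ?_⟩
        · simp only [map_mul, map_sub, smul_eval, eval_X]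
          refine mul_ne_zero hLi ?_
          convert h using 1; ring
        · simp [mul_comm]
  choose S hS hSi hSj using hs
  refine ⟨L ^ m.1 * M ^ m.2 * ∏ j, S j, ?_, ?_, ?_⟩
  · refine mul_mem_bihom ?_ ?_
    · have := (IsWeightedHomogeneous.pow hL m.1).mul (IsWeightedHomogeneous.pow hM m.2)
      simpa using this
    · have := IsWeightedHomogeneous.prod Finset.univ S (fun _ => (1, 1)) fun j _ => hS j
      simpa using this
  · simp only [map_mul, map_pow, map_prod]
    exact mul_ne_zero (mul_ne_zero (pow_ne_zero _ hLi) (pow_ne_zero _ hMi))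
      (Finset.prod_ne_zero_iff.2 fun j _ => hSi j)
  · intro j hj
    simp only [map_mul, map_prod]
    rw [Finset.prod_eq_zero (Finset.mem_univ j) (hSj j hj), mul_zero]

/-- **Bézout's inequality** on `ℙ¹ × ℙ¹`, for distinct points. -/
theorem card_le_of_common_zeros (hF : F ∈ bihom K f) (hG : G ∈ bihom K g) (hG0 : G ≠ 0)
    (hp : Prime F) (hFG : ¬ F ∣ G) {ι : Type*} [Fintype ι] (P : ι → Fin 4 → K)
    (hx : ∀ i, P i 0 ≠ 0 ∨ P i 1 ≠ 0) (hy : ∀ i, P i 2 ≠ 0 ∨ P i 3 ≠ 0)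
    (hne : ∀ i j, i ≠ j → P i 0 * P j 1 - P i 1 * P j 0 ≠ 0 ∨ P i 2 * P j 3 - P i 3 * P j 2 ≠ 0)
    (hPF : ∀ i, eval (P i) F = 0) (hPG : ∀ i, eval (P i) G = 0) :
    Fintype.card ι ≤ f.1 * g.2 + f.2 * g.1 := by
  classical
  set r : ℕ × ℕ := (Fintype.card ι, Fintype.card ι) with hr
  let L : bihom K (f + g + r) →ₗ[K] (ι → K) :=
    LinearMap.pi fun i => (aeval (R := K) (P i)).toLinearMap ∘ₗ Submodule.subtype _
  have hL : ∀ E i, L E i = eval (P i) E.1 := fun E i => by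
    simp [L, aeval_eq_eval]
  have hsurj : LinearMap.range L = ⊤ := by
    rw [eq_top_iff, ← (Pi.basisFun K ι).span_eq, Submodule.span_le]
    rintro _ ⟨i, rfl⟩
    obtain ⟨E, hE, hEi, hEj⟩ := exists_separating P hx hy hne (f + g) i
    refine ⟨(eval (P i) E)⁻¹ • ⟨E, hE⟩, ?_⟩
    ext j
    rw [map_smul, Pi.smul_apply, hL, Pi.basisFun_apply]
    by_cases hj : j = i
    · subst hj; simp [hEi]
    · simp [hEj j hj, hj]
  have hker : (idealPiece F G f g r).comap (bihom K (f + g + r)).subtype ≤ LinearMap.ker L := by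
    rintro ⟨E, hE⟩ h
    rw [LinearMap.mem_ker]
    ext i
    rw [hL]
    obtain ⟨_, ⟨A, _, rfl⟩, _, ⟨B, _, rfl⟩, hAB⟩ := Submodule.mem_sup.1 h
    simp only [Submodule.subtype_apply] at hAB
    simp [← hAB, hPF, hPG]
  have h1 := LinearMap.finrank_range_add_finrank_ker L
  rw [hsurj, finrank_top, Module.finrank_fintype_fun_eq_card] at h1
  have h2 := Submodule.finrank_mono hker
  rw [(Submodule.comapSubtypeEquivOfLe (idealPiece_le hF hG r)).finrank_eq] at h2
  have h3 := le_finrank_idealPiece (g := g) hF hp.ne_zero hG0 hp hFG r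
  omega

/-- Two curves on `ℙ¹ × ℙ¹` with positive intersection number meet. -/
theorem exists_common_zero [IsAlgClosed K] (hF : F ∈ bihom K f) (hG : G ∈ bihom K g) (hF0 : F ≠ 0)
    (hG0 : G ≠ 0) (hpos : 0 < f.1 * g.2 + f.2 * g.1) :
    ∃ P : Fin 4 → K, (P 0 ≠ 0 ∨ P 1 ≠ 0) ∧ (P 2 ≠ 0 ∨ P 3 ≠ 0) ∧ eval P F = 0 ∧ eval P G = 0 := by
  by_contra! hcon
  set I : Ideal (MvPolynomial (Fin 4) K) := Ideal.span {F, G} with hI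
  have hrad : ∀ i j : Fin 4, i < 2 → 2 ≤ j → (X i * X j : MvPolynomial (Fin 4) K) ∈ I.radical := by
    intro i j hi hj
    rw [← vanishingIdeal_zeroLocus_eq_radical (K := K), mem_vanishingIdeal_iff]
    intro P hP
    rw [hI, zeroLocus_span] at hP
    have h1 : eval P F = 0 := by simpa [aeval_eq_eval] using hP F (by simp)
    have h2 : eval P G = 0 := by simpa [aeval_eq_eval] using hP G (by simp)
    by_contra h
    simp only [map_mul, aeval_X, mul_eq_zero, not_or] at h
    refine hcon P ?_ ?_ h1 h2
    · fin_cases i <;> simp_all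
    · fin_cases j <;> simp_all
  have hk : ∃ k : ℕ, ∀ i j : Fin 4, i < 2 → 2 ≤ j →
      (X i * X j : MvPolynomial (Fin 4) K) ^ k ∈ I := by
    have : ∀ p : Fin 4 × Fin 4, ∃ k, p.1 < 2 → 2 ≤ p.2 →
        (X p.1 * X p.2 : MvPolynomial (Fin 4) K) ^ k ∈ I := by
      intro p
      by_cases h : p.1 < 2 ∧ 2 ≤ p.2
      · obtain ⟨k, hk⟩ := hrad p.1 p.2 h.1 h.2
        exact ⟨k, fun _ _ => hk⟩
      · exact ⟨0, fun h1 h2 => absurd ⟨h1, h2⟩ h⟩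
    choose k hk using this
    refine ⟨∑ p, k p, fun i j hi hj => ?_⟩
    exact Ideal.pow_mem_of_pow_mem _ (hk (i, j) hi hj)
      (Finset.single_le_sum (f := k) (fun _ _ => Nat.zero_le _) (Finset.mem_univ (i, j)))
  obtain ⟨k, hk⟩ := hk
  set r : ℕ × ℕ := (2 * k, 2 * k) with hr
  have hle : bihom K (f + g + r) ≤ idealPiece F G f g r := by
    intro E hE
    have hEI : E ∈ I := by
      rw [E.as_sum]
      refine Ideal.sum_mem _ fun d hd => ?_
      have hd' := mem_bihom_iff.1 hE d hd
      simp only [Prod.fst_add, Prod.snd_add, hr] at hd'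
      obtain ⟨i, hi, hi'⟩ : ∃ i : Fin 4, i < 2 ∧ k ≤ d i := by
        by_cases h : k ≤ d 0
        · exact ⟨0, by decide, h⟩
        · exact ⟨1, by decide, by omega⟩
      obtain ⟨j, hj, hj'⟩ : ∃ i : Fin 4, 2 ≤ i ∧ k ≤ d i := by
        by_cases h : k ≤ d 2
        · exact ⟨2, by decide, h⟩
        · exact ⟨3, by decide, by omega⟩
      have hij : i ≠ j := (lt_of_lt_of_le hi hj).ne
      have hle : Finsupp.single i k + Finsupp.single j k ≤ d := by
        intro l
        simp only [Finsupp.add_apply, Finsupp.single_apply]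
        split_ifs <;> grind
      have : monomial d (coeff d E) = monomial (d - (Finsupp.single i k + Finsupp.single j k))
          (coeff d E) * (X i * X j) ^ k := by
        rw [mul_pow, X_pow_eq_monomial, X_pow_eq_monomial, monomial_mul, monomial_mul,
          tsub_add_cancel_of_le hle, mul_one, mul_one]
      rw [this]
      exact Ideal.mul_mem_left _ _ (hk i j hi hj)
    obtain ⟨A, B, hAB⟩ := Ideal.mem_span_pair.1 hEI
    have h := congrArg (weightedHomogeneousComponent biweight (f + g + r)) hAB
    rw [map_add, weightedHomogeneousComponent_eq_self hE] at h
    rw [← h]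
    refine Submodule.add_mem_sup ⟨weightedHomogeneousComponent biweight (g + r) A,
      weightedHomogeneousComponent_mem _ _ _, ?_⟩ ⟨weightedHomogeneousComponent biweight (f + r) B,
      weightedHomogeneousComponent_mem _ _ _, ?_⟩
    · rw [LinearMap.mulRight_apply, ← component_mul hF]
      congr 2; abel
    · rw [LinearMap.mulRight_apply, ← component_mul hG]
      congr 2; abel
  have h1 := Submodule.finrank_mono hle
  have h2 := finrank_idealPiece_le hF hG hF0 hG0 r
  omega
end

/-- A real curve of bidegree `(m₁, m₂)` with `m₁, m₂ ≥ 1`, nonsingular over `ℂ`, is irreducible. -/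
theorem prime_of_nonsingular {m₁ m₂ : ℕ} (hm₁ : 1 ≤ m₁) (hm₂ : 1 ≤ m₂)
    {F : MvPolynomial (Fin 4) ℝ} (hF0 : F ≠ 0) (hF : F ∈ bihom ℝ (m₁, m₂))
    (hns : ∀ u v : Fin 2 → ℂ, u ≠ 0 → v ≠ 0 →
      MvPolynomial.eval ![u 0, u 1, v 0, v 1] (MvPolynomial.map (algebraMap ℝ ℂ) F) = 0 →
      ∃ i : Fin 4, MvPolynomial.eval ![u 0, u 1, v 0, v 1]
        (MvPolynomial.pderiv i (MvPolynomial.map (algebraMap ℝ ℂ) F)) ≠ 0) : Prime F := by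
  rw [← UniqueFactorizationMonoid.irreducible_iff_prime]
  have hmap : ∀ {A : MvPolynomial (Fin 4) ℝ} {a : ℕ × ℕ}, A ∈ bihom ℝ a →
      map (algebraMap ℝ ℂ) A ∈ bihom ℂ a := fun {A a} hA =>
    mem_bihom_iff.2 fun d hd => mem_bihom_iff.1 hA d (support_map_subset _ _ hd)
  have hinj := map_injective (σ := Fin 4) (algebraMap ℝ ℂ) (algebraMap ℝ ℂ).injective
  refine ⟨fun hu => ?_, fun A B hAB => ?_⟩
  · obtain ⟨c, hc, rfl⟩ := MvPolynomial.isUnit_iff_eq_C_of_isReduced.1 hu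
    have := (isWeightedHomogeneous_C biweight c).inj_right hF0 hF
    simp [Prod.ext_iff] at this
    omega
  · subst hAB
    obtain ⟨a, ha⟩ := bihom_of_mul hF hF0
    obtain ⟨b, hb⟩ := bihom_of_mul (mul_comm A B ▸ hF) (mul_comm A B ▸ hF0)
    have hab : a + b = (m₁, m₂) := (mul_mem_bihom ha hb).inj_right hF0 hF
    rw [Prod.ext_iff] at hab
    by_contra! hcon
    have ha0 : a ≠ 0 := fun h =>
      hcon.1 (isUnit_of_mem_bihom_zero (h ▸ ha) (left_ne_zero_of_mul hF0))
    have hb0 : b ≠ 0 := fun h =>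
      hcon.2 (isUnit_of_mem_bihom_zero (h ▸ hb) (right_ne_zero_of_mul hF0))
    have hpos : 0 < a.1 * b.2 + a.2 * b.1 := by
      by_contra! h
      simp only [nonpos_iff_eq_zero, Nat.add_eq_zero_iff, mul_eq_zero] at h
      simp only [ne_eq, Prod.ext_iff] at ha0 hb0
      simp only [Prod.fst_add, Prod.snd_add, Prod.fst_zero, Prod.snd_zero] at *
      omega
    obtain ⟨P, hP0, hP2, hPA, hPB⟩ := exists_common_zero (hmap ha) (hmap hb)
      (by simpa using hinj.ne (left_ne_zero_of_mul hF0))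
      (by simpa using hinj.ne (right_ne_zero_of_mul hF0)) hpos
    have hP : ![P 0, P 1, P 2, P 3] = P := by
      ext i; fin_cases i <;> rfl
    obtain ⟨i, hi⟩ := hns ![P 0, P 1] ![P 2, P 3] (fun h => by simp_all) (fun h => by simp_all)
      (by simp [hP, hPA])
    apply hi
    simp [hP, hPA, hPB, Derivation.leibniz]

end Bezout

section Loops
open Set Filter Topology Metric NNReal

/-- A bounded Lipschitz vector field has global integral curves. -/
theorem exists_global_integralCurve {E : Type*} [NormedAddCommGroup E] [NormedSpace ℝ E]
    [CompleteSpace E] {v : E → E} {K L : ℝ≥0} (hK : LipschitzWith K v) (hL : ∀ x, ‖v x‖ ≤ L)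
    (x : E) : ∃ γ : ℝ → E, γ 0 = x ∧ ∀ t, HasDerivAt γ (v (γ t)) t := by
  have hex : ∀ a : ℝ, ∃ α : ℝ → E, 0 < a → α 0 = x ∧
      ∀ t ∈ Ioo (-a) a, HasDerivAt α (v (α t)) t := by
    intro a
    by_cases ha : 0 < a
    · have h0 : (0 : ℝ) ∈ Icc (-a) a := ⟨by linarith, ha.le⟩
      have hPL : IsPicardLindelof (fun _ => v) (⟨0, h0⟩ : Icc (-a) a) x (L * ⟨a, ha.le⟩) 0 L K :=
        IsPicardLindelof.of_time_independent (fun y _ => hL y) hK.lipschitzOnWith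
          (by simp only [sub_neg_eq_add, sub_zero, zero_add, max_self, NNReal.coe_zero]
              exact le_rfl)
      obtain ⟨α, h1, h2⟩ := hPL.exists_eq_forall_mem_Icc_hasDerivWithinAt₀
      exact ⟨α, fun _ => ⟨h1, fun t ht => (h2 t (Ioo_subset_Icc_self ht)).hasDerivAt
        (Icc_mem_nhds ht.1 ht.2)⟩⟩
    · exact ⟨fun _ => x, fun h => absurd h ha⟩
  choose α hα using hex
  have huniq : ∀ a b, 0 < a → a ≤ b → EqOn (α a) (α b) (Ioo (-a) a) := by
    intro a b ha hab
    refine ODE_solution_unique_of_mem_Ioo (v := fun _ => v) (s := fun _ => univ) (t₀ := 0) (K := K)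
      (fun _ _ => hK.lipschitzOnWith) ⟨by linarith, ha⟩
      (fun t ht => ⟨(hα a ha).2 t ht, trivial⟩)
      (fun t ht => ⟨(hα b (ha.trans_le hab)).2 t ⟨by linarith [ht.1], by linarith [ht.2]⟩, trivial⟩)
      ?_
    rw [(hα a ha).1, (hα b (ha.trans_le hab)).1]
  refine ⟨fun t => α (|t| + 1) t, by simpa using (hα 1 one_pos).1, fun t₀ => ?_⟩
  have heq : ∀ t, |t| < |t₀| + 1 → α (|t| + 1) t = α (|t₀| + 2) t := fun t ht =>
    huniq _ _ (by positivity) (by linarith)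
      ⟨by linarith [neg_abs_le t], by linarith [le_abs_self t]⟩
  have h := (hα (|t₀| + 2) (by positivity)).2 t₀
    ⟨by linarith [neg_abs_le t₀], by linarith [le_abs_self t₀]⟩
  rw [← heq t₀ (by linarith)] at h
  refine h.congr_of_eventuallyEq ?_
  have : ∀ᶠ t in 𝓝 t₀, |t| < |t₀| + 1 :=
    continuous_abs.continuousAt.eventually_lt continuousAt_const (by linarith)
  filter_upwards [this] with t ht using heq t ht

/-- The lattice vector `(kπ, lπ)`. -/
def latticeVec (k l : ℤ) : ℝ × ℝ := (k * Real.pi, l * Real.pi)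

theorem latticeVec_add (k l k' l' : ℤ) :
    latticeVec (k + k') (l + l') = latticeVec k l + latticeVec k' l' := by
  simp [latticeVec, add_mul]

theorem latticeVec_neg (k l : ℤ) : latticeVec (-k) (-l) = -latticeVec k l := by
  simp [latticeVec]

/-- Two points of the plane represent the same point of `ℝP¹ × ℝP¹`. -/
def LatticeRel (z z' : ℝ × ℝ) : Prop := ∃ k l : ℤ, z' = z + latticeVec k l

theorem LatticeRel.symm {z z' : ℝ × ℝ} : LatticeRel z z' → LatticeRel z' z := by
  rintro ⟨k, l, rfl⟩
  exact ⟨-k, -l, by rw [latticeVec_neg]; abel⟩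

theorem LatticeRel.trans {z z' z'' : ℝ × ℝ} :
    LatticeRel z z' → LatticeRel z' z'' → LatticeRel z z'' := by
  rintro ⟨k, l, rfl⟩ ⟨k', l', rfl⟩
  exact ⟨k + k', l + l', by rw [latticeVec_add]; abel⟩

theorem latticeRel_iff_sin {z z' : ℝ × ℝ} :
    LatticeRel z z' ↔ Real.sin (z'.1 - z.1) = 0 ∧ Real.sin (z'.2 - z.2) = 0 := by
  simp only [Real.sin_eq_zero_iff, LatticeRel, latticeVec, Prod.ext_iff, Prod.fst_add, Prod.snd_add]
  constructor
  · rintro ⟨k, l, h1, h2⟩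
    exact ⟨⟨k, by linarith⟩, ⟨l, by linarith⟩⟩
  · rintro ⟨⟨k, h1⟩, ⟨l, h2⟩⟩
    exact ⟨k, l, by linarith, by linarith⟩

theorem exists_latticeRel_mem_box (z : ℝ × ℝ) :
    ∃ k l : ℤ, z + latticeVec k l ∈ Icc (0 : ℝ) Real.pi ×ˢ Icc (0 : ℝ) Real.pi := by
  obtain ⟨k, hk, -⟩ := existsUnique_add_zsmul_mem_Ico Real.pi_pos z.1 0
  obtain ⟨l, hl, -⟩ := existsUnique_add_zsmul_mem_Ico Real.pi_pos z.2 0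
  simp only [zero_add, zsmul_eq_mul] at hk hl
  exact ⟨k, l, ⟨hk.1, hk.2.le⟩, ⟨hl.1, hl.2.le⟩⟩

/-- A function invariant up to sign under the lattice `(πℤ)²`. -/
def LatticeSemiinvariant (f : ℝ × ℝ → ℝ) : Prop :=
  ∀ k l : ℤ, ∃ σ : ℝ, (σ = 1 ∨ σ = -1) ∧ ∀ z, f (z + latticeVec k l) = σ * f z

/-- The Hamiltonian vector field of `f`. -/
def hamiltonian (f : ℝ × ℝ → ℝ) (z : ℝ × ℝ) : ℝ × ℝ :=
  (fderiv ℝ f z (0, 1), -fderiv ℝ f z (1, 0))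

theorem fderiv_apply_pair (f : ℝ × ℝ → ℝ) (z w : ℝ × ℝ) :
    fderiv ℝ f z w = w.2 * (hamiltonian f z).1 - w.1 * (hamiltonian f z).2 := by
  have : w = w.1 • ((1, 0) : ℝ × ℝ) + w.2 • ((0, 1) : ℝ × ℝ) := by ext <;> simp
  conv_lhs => rw [this]
  rw [map_add, map_smul, map_smul]
  simp [hamiltonian]; ring

theorem norm_bounded_of_lattice {E : Type*} [NormedAddCommGroup E] {g : ℝ × ℝ → E}
    (hg : Continuous g) (h : ∀ k l : ℤ, ∀ z, ‖g (z + latticeVec k l)‖ = ‖g z‖) :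
    ∃ C : ℝ≥0, ∀ z, ‖g z‖ ≤ C := by
  obtain ⟨C, hC⟩ := ((isCompact_Icc (a := (0 : ℝ)) (b := Real.pi)).prod
    (isCompact_Icc (a := (0 : ℝ)) (b := Real.pi))).exists_bound_of_continuousOn hg.continuousOn
  refine ⟨C.toNNReal, fun z => ?_⟩
  obtain ⟨k, l, hz⟩ := exists_latticeRel_mem_box z
  rw [← h k l]
  exact (hC _ hz).trans (Real.le_coe_toNNReal C)

section
variable {f : ℝ × ℝ → ℝ}

theorem hamiltonian_add {σ : ℝ} {w : ℝ × ℝ} (h : ∀ z, f (z + w) = σ * f z) (z : ℝ × ℝ) :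
    hamiltonian f (z + w) = σ • hamiltonian f z := by
  have h1 : fderiv ℝ f (z + w) = σ • fderiv ℝ f z := by
    rw [← fderiv_comp_add_right, funext h]
    exact congrFun (fderiv_const_smul_field (f := f) σ) z
  simp [hamiltonian, h1]

theorem contDiff_hamiltonian (hf : ContDiff ℝ 2 f) : ContDiff ℝ 1 (hamiltonian f) := by
  have h := hf.fderiv_right (m := 1) (by norm_num)
  exact (h.clm_apply contDiff_const).prodMk (h.clm_apply contDiff_const).neg

theorem norm_sign_smul {E : Type*} [NormedAddCommGroup E] [NormedSpace ℝ E] {σ : ℝ}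
    (h : σ = 1 ∨ σ = -1) (x : E) : ‖σ • x‖ = ‖x‖ := by
  rcases h with rfl | rfl <;> simp

theorem exists_bound_hamiltonian (hf : ContDiff ℝ 2 f) (hs : LatticeSemiinvariant f) :
    ∃ L : ℝ≥0, ∀ z, ‖hamiltonian f z‖ ≤ L := by
  refine norm_bounded_of_lattice (contDiff_hamiltonian hf).continuous fun k l z => ?_
  obtain ⟨σ, hσ, h⟩ := hs k l
  rw [hamiltonian_add h, norm_sign_smul hσ]

theorem exists_lipschitz_hamiltonian (hf : ContDiff ℝ 2 f) (hs : LatticeSemiinvariant f) :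
    ∃ K : ℝ≥0, LipschitzWith K (hamiltonian f) := by
  have hd := contDiff_hamiltonian hf
  obtain ⟨C, hC⟩ := norm_bounded_of_lattice (hd.continuous_fderiv one_ne_zero) fun k l z => by
    obtain ⟨σ, hσ, h⟩ := hs k l
    rw [← fderiv_comp_add_right, funext (hamiltonian_add h)]
    rw [fderiv_fun_const_smul (hd.differentiable one_ne_zero z), norm_sign_smul hσ]
  exact ⟨C, lipschitzWith_of_nnnorm_fderiv_le (hd.differentiable one_ne_zero) hC⟩

/-- `γ` is a trajectory of the Hamiltonian vector field of `f`. -/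
def IsTrajectory (f : ℝ × ℝ → ℝ) (γ : ℝ → ℝ × ℝ) : Prop :=
  ∀ t, HasDerivAt γ (hamiltonian f (γ t)) t

theorem IsTrajectory.continuous {γ : ℝ → ℝ × ℝ} (hγ : IsTrajectory f γ) : Continuous γ :=
  continuous_iff_continuousAt.2 fun t => (hγ t).continuousAt

theorem IsTrajectory.const {γ : ℝ → ℝ × ℝ} (hγ : IsTrajectory f γ) (hf : Differentiable ℝ f)
    {t₀ : ℝ} (h0 : f (γ t₀) = 0) (t : ℝ) : f (γ t) = 0 := by
  have hd : ∀ t, HasDerivAt (f ∘ γ) 0 t := fun t => by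
    have := (hf (γ t)).hasFDerivAt.comp_hasDerivAt t (hγ t)
    rw [fderiv_apply_pair] at this
    rwa [mul_comm, sub_self] at this
  rw [← h0]
  exact is_const_of_deriv_eq_zero (fun t => (hd t).differentiableAt) (fun t => (hd t).deriv) t t₀

/-- Trajectories through equivalent points agree up to translation and time reversal. -/
theorem IsTrajectory.eq_of_lattice {γ η : ℝ → ℝ × ℝ} (hγ : IsTrajectory f γ)
    (hη : IsTrajectory f η) (hf : ContDiff ℝ 2 f) (hs : LatticeSemiinvariant f) {σ s t : ℝ}
    {w : ℝ × ℝ} (hw : ∀ z, f (z + w) = σ * f z)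
    (hst : η s = γ t + w) (τ : ℝ) : η (s + τ) = γ (t + σ * τ) + w := by
  obtain ⟨K, hK⟩ := exists_lipschitz_hamiltonian hf hs
  have := ODE_solution_unique_univ (v := fun _ => hamiltonian f) (s := fun _ => univ) (K := K)
    (f := fun τ => η (s + τ)) (g := fun τ => γ (t + σ * τ) + w) (t₀ := 0)
    (fun _ => hK.lipschitzOnWith) (fun τ => ⟨(hη (s + τ)).comp_const_add s τ, trivial⟩)
    (fun τ => ⟨?_, trivial⟩) (by simpa using hst)
  · exact congrFun this τ
  · rw [hamiltonian_add hw]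
    have h1 : HasDerivAt (fun τ : ℝ => t + σ * τ) σ τ := by
      simpa using ((hasDerivAt_id τ).const_mul σ).const_add t
    exact (HasDerivAt.scomp τ (hγ (t + σ * τ)) h1).add_const w

theorem hamiltonian_ne_zero (hreg : ∀ z, f z = 0 → fderiv ℝ f z ≠ 0) {z : ℝ × ℝ} (hz : f z = 0) :
    hamiltonian f z ≠ 0 := fun h => hreg z hz <|
  ContinuousLinearMap.ext fun w => by rw [fderiv_apply_pair, h]; simp

/-- Near a regular zero, the zero set is covered by short pieces of the trajectory. -/
theorem IsTrajectory.eventually_mem {η : ℝ → ℝ × ℝ} (hη : IsTrajectory f η)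
    (hf : ContDiff ℝ 2 f) (hreg : ∀ z, f z = 0 → fderiv ℝ f z ≠ 0) (h0 : f (η 0) = 0)
    {δ : ℝ} (hδ : 0 < δ) :
    ∀ᶠ z in 𝓝 (η 0), f z = 0 → ∃ s, |s| < δ ∧ η s = z := by
  have hdf := hf.differentiable two_ne_zero
  set p := hamiltonian f (η 0) with hp
  have hp0 : 0 < p.1 ^ 2 + p.2 ^ 2 := by
    have := hamiltonian_ne_zero hreg h0
    by_contra! h
    have h1 : p.1 ^ 2 = 0 := by nlinarith [sq_nonneg p.1, sq_nonneg p.2]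
    have h2 : p.2 ^ 2 = 0 := by nlinarith [sq_nonneg p.1, sq_nonneg p.2]
    exact this (Prod.ext (pow_eq_zero_iff two_ne_zero |>.1 h1)
      (pow_eq_zero_iff two_ne_zero |>.1 h2))
  set ν : ℝ × ℝ := (-p.2, p.1) with hν
  have hcd : Continuous fun z => fderiv ℝ f z ν :=
    (hf.continuous_fderiv two_ne_zero).clm_apply continuous_const
  have hpos : 0 < fderiv ℝ f (η 0) ν := by
    rw [fderiv_apply_pair, ← hp]; simp only [hν]; nlinarith
  obtain ⟨ρ, hρ, hball⟩ := Metric.eventually_nhds_iff_ball.1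
    (hcd.continuousAt.eventually (lt_mem_nhds hpos))
  let u : ℝ × ℝ → ℝ := fun z => p.1 * z.1 + p.2 * z.2
  have hu : Continuous u := by fun_prop
  have hηball : ∀ᶠ t in 𝓝 (0 : ℝ), η t ∈ ball (η 0) ρ :=
    hη.continuous.continuousAt.eventually (ball_mem_nhds _ hρ)
  obtain ⟨ε, hε, hηε⟩ := Metric.eventually_nhds_iff.1 hηball
  have hud : HasDerivAt (fun t => u (η t)) (p.1 ^ 2 + p.2 ^ 2) 0 := by
    have h1 := hasFDerivAt_fst.comp_hasDerivAt (0 : ℝ) (hη 0)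
    have h2 := hasFDerivAt_snd.comp_hasDerivAt (0 : ℝ) (hη 0)
    rw [sq, sq]
    exact (h1.const_mul p.1).add (h2.const_mul p.2)
  have hslope := hasDerivAt_iff_tendsto_slope.1 hud
  have hev : ∀ᶠ t in 𝓝[≠] (0 : ℝ), 0 < slope (fun t => u (η t)) 0 t :=
    hslope.eventually (lt_mem_nhds hp0)
  rw [eventually_nhdsWithin_iff, Metric.eventually_nhds_iff] at hev
  obtain ⟨ε', hε', hsl⟩ := hev
  set d := min δ (min ε ε') / 2 with hd
  have hd0 : 0 < d := by positivity
  have hdδ : d < δ := by rw [hd]; linarith [min_le_left δ (min ε ε'), lt_min hδ (lt_min hε hε')]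
  have hdε : d < ε := by
    rw [hd]; linarith [min_le_right δ (min ε ε'), min_le_left ε ε', lt_min hδ (lt_min hε hε')]
  have hdε' : d < ε' := by
    rw [hd]; linarith [min_le_right δ (min ε ε'), min_le_right ε ε', lt_min hδ (lt_min hε hε')]
  have hplus : u (η 0) < u (η d) := by
    have := hsl (y := d) (by simpa [abs_of_pos hd0]) hd0.ne'
    rw [slope_def_field, sub_zero, div_pos_iff_of_pos_right hd0] at this
    linarith
  have hminus : u (η (-d)) < u (η 0) := by
    have := hsl (y := -d) (by simpa [abs_of_pos hd0]) (by simpa using hd0.ne')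
    rw [slope_def_field, sub_zero, div_pos_iff] at this
    rcases this with h | h <;> linarith
  filter_upwards [ball_mem_nhds (η 0) hρ, hu.continuousAt.eventually (lt_mem_nhds hminus),
    hu.continuousAt.eventually (gt_mem_nhds hplus)] with z hz hz1 hz2 hfz
  obtain ⟨s, hs, hsz⟩ : ∃ s ∈ Icc (-d) d, u (η s) = u z :=
    intermediate_value_Icc (by linarith) (hu.comp hη.continuous).continuousOn ⟨hz1.le, hz2.le⟩
  have hsd : |s| ≤ d := abs_le.2 hs
  refine ⟨s, hsd.trans_lt hdδ, ?_⟩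
  have hsball : η s ∈ ball (η 0) ρ := hηε (by simpa using hsd.trans_lt hdε)
  obtain ⟨c, hc, hcd⟩ := domain_mvt (s := ball (η 0) ρ) (f' := fun z => fderiv ℝ f z)
    (fun z _ => (hdf z).hasFDerivAt.hasFDerivWithinAt) (convex_ball _ _) hsball hz
  rw [hfz, hη.const hdf h0 s, sub_zero] at hcd
  have hcpos := hball c ((convex_ball _ _).segment_subset hsball hz hc)
  have hperp : p.1 * (z - η s).1 + p.2 * (z - η s).2 = 0 := by
    simp only [u] at hsz
    simp only [Prod.fst_sub, Prod.snd_sub]; linarith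
  obtain ⟨r, hr⟩ : ∃ r : ℝ, z - η s = r • ν := by
    refine ⟨(p.1 * (z - η s).2 - p.2 * (z - η s).1) / (p.1 ^ 2 + p.2 ^ 2), ?_⟩
    ext
    · simp only [hν, Prod.smul_fst, smul_eq_mul]
      field_simp
      linear_combination p.1 * hperp
    · simp only [hν, Prod.smul_snd, smul_eq_mul]
      field_simp
      linear_combination p.2 * hperp
  rw [hr, map_smul, smul_eq_mul] at hcd
  have : r = 0 := by
    rcases mul_eq_zero.1 hcd.symm with h | h
    · exact h
    · exact absurd h hcpos.ne'
  rw [this, zero_smul, sub_eq_zero] at hr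
  exact hr.symm

/-- If a trajectory in the zero set meets the same point of the torus at two times, it is
periodic up to lattice translations. -/
theorem IsTrajectory.latticeRel_sub {γ : ℝ → ℝ × ℝ} (hγ : IsTrajectory f γ)
    (hf : ContDiff ℝ 2 f) (hs : LatticeSemiinvariant f)
    (hreg : ∀ z, f z = 0 → fderiv ℝ f z ≠ 0) (h0 : f (γ 0) = 0) {s t : ℝ}
    (hst : LatticeRel (γ s) (γ t)) : LatticeRel (γ 0) (γ (t - s)) := by
  obtain ⟨k, l, hkl⟩ := hst
  obtain ⟨σ, hσ, hw⟩ := hs k l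
  have key := hγ.eq_of_lattice hγ hf hs hw hkl
  rcases hσ with rfl | rfl
  · refine ⟨k, l, ?_⟩
    have := key (-s)
    rwa [one_mul, add_neg_cancel, ← sub_eq_add_neg] at this
  · exfalso
    have h1 := key ((s - t) / 2)
    rw [show t + (s - t) / 2 = s + -1 * ((s - t) / 2) by ring, left_eq_add] at h1
    simp only [h1, add_zero] at hw
    have h2 : f = fun _ => 0 := funext fun z => by linarith [hw z]
    exact hreg _ h0 (by rw [h2]; exact fderiv_const_apply 0)

theorem IsTrajectory.exists_recurrence {γ : ℝ → ℝ × ℝ} (hγ : IsTrajectory f γ)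
    (hf : ContDiff ℝ 2 f) (hs : LatticeSemiinvariant f)
    (hreg : ∀ z, f z = 0 → fderiv ℝ f z ≠ 0) (h0 : f (γ 0) = 0) :
    ∃ s t, s < t ∧ LatticeRel (γ s) (γ t) := by
  have hdf := hf.differentiable two_ne_zero
  choose k l hbox using fun n : ℕ => exists_latticeRel_mem_box (γ n)
  choose σ hσ hw using fun n => hs (k n) (l n)
  obtain ⟨z, -, φ, hφ, hlim⟩ := ((isCompact_Icc (a := (0 : ℝ)) (b := Real.pi)).prod
    (isCompact_Icc (a := (0 : ℝ)) (b := Real.pi))).tendsto_subseq hbox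
  have hzero : ∀ n : ℕ, f (γ n + latticeVec (k n) (l n)) = 0 := fun n => by
    rw [hw, hγ.const hdf h0, mul_zero]
  have hz : f z = 0 :=
    tendsto_nhds_unique ((hf.continuous.tendsto z).comp hlim)
      (by simp [Function.comp_def, hzero])
  obtain ⟨K, hK⟩ := exists_lipschitz_hamiltonian hf hs
  obtain ⟨L, hL⟩ := exists_bound_hamiltonian hf hs
  obtain ⟨η, hη0, hη⟩ := exists_global_integralCurve hK hL z
  subst hη0
  have hη : IsTrajectory f η := hη
  have hev := hlim.eventually (hη.eventually_mem hf hreg hz (δ := 1 / 4) (by norm_num))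
  obtain ⟨M, hM⟩ := eventually_atTop.1 hev
  have hpt : ∀ n ≥ M, ∃ t : ℝ, |t - φ n| < 1 / 4 ∧ LatticeRel (γ t) (η 0) := by
    intro n hn
    obtain ⟨s, hsδ, hseq⟩ := hM n hn (hzero _)
    have := hγ.eq_of_lattice hη hf hs (hw (φ n)) hseq (-s)
    rw [add_neg_cancel] at this
    refine ⟨_, ?_, _, _, this⟩
    rcases hσ (φ n) with h | h <;> rw [h] <;> simpa using hsδ
  obtain ⟨t₁, h1, r1⟩ := hpt M le_rfl
  obtain ⟨t₂, h2, r2⟩ := hpt (M + 1) (by omega)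
  refine ⟨t₁, t₂, ?_, r1.trans r2.symm⟩
  have h3 : (φ M : ℝ) + 1 ≤ φ (M + 1) := by exact_mod_cast hφ (Nat.lt_succ_self M)
  rw [abs_lt] at h1 h2
  linarith [h1.2, h2.1]

/-- Through each point of a regular zero set there passes a simple closed curve on the torus. -/
theorem exists_loop (hf : ContDiff ℝ 2 f) (hs : LatticeSemiinvariant f)
    (hreg : ∀ z, f z = 0 → fderiv ℝ f z ≠ 0) {z : ℝ × ℝ} (hz : f z = 0) :
    ∃ (γ : ℝ → ℝ × ℝ) (T : ℝ), Continuous γ ∧ γ 0 = z ∧ 0 < T ∧ (∀ t, f (γ t) = 0) ∧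
      LatticeRel (γ 0) (γ T) ∧
      ∀ s ∈ Ico 0 T, ∀ t ∈ Ico 0 T, LatticeRel (γ s) (γ t) → s = t := by
  have hdf := hf.differentiable two_ne_zero
  obtain ⟨K, hK⟩ := exists_lipschitz_hamiltonian hf hs
  obtain ⟨L, hL⟩ := exists_bound_hamiltonian hf hs
  obtain ⟨γ, rfl, hγ⟩ := exists_global_integralCurve hK hL z
  have hγ : IsTrajectory f γ := hγ
  have hclosed : IsClosed {t | LatticeRel (γ 0) (γ t)} := by
    simp only [latticeRel_iff_sin]
    have := hγ.continuous
    exact (isClosed_eq (by fun_prop) continuous_const).inter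
      (isClosed_eq (by fun_prop) continuous_const)
  obtain ⟨ε, hε, hε'⟩ : ∃ ε > 0, ∀ t, 0 < t → t < ε → ¬ LatticeRel (γ 0) (γ t) := by
    have h1 := (hγ 0).eventually_ne (c := γ 0) (hamiltonian_ne_zero hreg hz)
    have h2 : ∀ᶠ t in 𝓝 (0 : ℝ), γ t ∈ ball (γ 0) Real.pi :=
      hγ.continuous.continuousAt.eventually (ball_mem_nhds _ Real.pi_pos)
    rw [eventually_nhdsWithin_iff] at h1
    obtain ⟨ε, hε, h⟩ := Metric.eventually_nhds_iff.1 (h1.and h2)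
    refine ⟨ε, hε, fun t ht htε hrel => ?_⟩
    have h3 := h (y := t) (by simpa [abs_of_pos ht])
    refine h3.1 ht.ne' ?_
    have h4 := h3.2
    rw [mem_ball, Prod.dist_eq, max_lt_iff, Real.dist_eq, Real.dist_eq, abs_lt, abs_lt] at h4
    rw [latticeRel_iff_sin] at hrel
    have h5 := (Real.sin_eq_zero_iff_of_lt_of_lt h4.1.1 h4.1.2).1 hrel.1
    have h6 := (Real.sin_eq_zero_iff_of_lt_of_lt h4.2.1 h4.2.2).1 hrel.2
    ext <;> linarith
  set R := {t | LatticeRel (γ 0) (γ t)} ∩ Ici ε with hR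
  have hRne : R.Nonempty := by
    obtain ⟨s, t, hst, hrel⟩ := hγ.exists_recurrence hf hs hreg hz
    have := hγ.latticeRel_sub hf hs hreg hz hrel
    refine ⟨t - s, this, ?_⟩
    by_contra hc
    exact hε' _ (sub_pos.2 hst) (not_le.1 hc) this
  have hleast := (hclosed.inter isClosed_Ici).isLeast_csInf hRne ⟨ε, fun t ht => ht.2⟩
  set T := sInf R
  have hno : ∀ s ∈ Ico 0 T, ∀ t ∈ Ico 0 T, s < t → ¬ LatticeRel (γ s) (γ t) := by
    intro s hs' t ht' hst hrel
    have hr := hγ.latticeRel_sub hf hs hreg hz hrel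
    have h1 : ε ≤ t - s := by
      by_contra hc
      exact hε' _ (sub_pos.2 hst) (not_le.1 hc) hr
    have h2 := hleast.2 ⟨hr, h1⟩
    linarith [ht'.2, hs'.1]
  refine ⟨γ, T, hγ.continuous, rfl, hε.trans_le hleast.1.2, hγ.const hdf hz, hleast.1.1, ?_⟩
  intro s hs' t ht' hrel
  rcases lt_trichotomy s t with h | h | h
  · exact absurd hrel (hno s hs' t ht' h)
  · exact h
  · exact absurd hrel.symm (hno t ht' s hs' h)

end

end Loops

section LinearSystem
open Set Filter Topology

theorem exists_zero_Ioo {h : ℝ → ℝ} (hh : Continuous h) {a b : ℝ} (hab : a ≤ b)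
    (hneg : h a * h b < 0) : ∃ x ∈ Ioo a b, h x = 0 := by
  rcases mul_neg_iff.1 hneg with h1 | h1
  · exact intermediate_value_Ioo' hab hh.continuousOn ⟨h1.2, h1.1⟩
  · exact intermediate_value_Ioo hab hh.continuousOn h1

theorem exists_zero_of_antiperiodic {h : ℝ → ℝ} (hh : Continuous h) {T : ℝ} (hT : 0 < T)
    (hp : h T = -h 0) : ∃ x ∈ Ico 0 T, h x = 0 := by
  by_cases h0 : h 0 = 0
  · exact ⟨0, ⟨le_rfl, hT⟩, h0⟩
  · obtain ⟨x, hx, hx0⟩ := exists_zero_Ioo hh hT.le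
      (by rw [hp]; nlinarith [mul_self_pos.2 h0])
    exact ⟨x, Ioo_subset_Ico_self hx, hx0⟩

theorem exists_two_zeros_of_periodic {h : ℝ → ℝ} (hh : Continuous h) {T : ℝ} (hp : h T = h 0)
    {a b : ℝ} (ha : a ∈ Ioo 0 T) (hb : b ∈ Ioo 0 T) (hneg : h a * h b < 0) :
    ∃ x ∈ Ico 0 T, ∃ y ∈ Ico 0 T, x ≠ y ∧ h x = 0 ∧ h y = 0 := by
  wlog hab : a ≤ b generalizing a b
  · exact this hb ha (by rwa [mul_comm]) (le_of_not_ge hab)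
  have hT : 0 < T := ha.1.trans ha.2
  obtain ⟨x, hx, hx0⟩ := exists_zero_Ioo hh hab hneg
  have hxI : x ∈ Ico 0 T := ⟨(ha.1.trans hx.1).le, hx.2.trans hb.2⟩
  rcases lt_trichotomy (h 0 * h a) 0 with h1 | h1 | h1
  · obtain ⟨y, hy, hy0⟩ := exists_zero_Ioo hh ha.1.le h1
    exact ⟨x, hxI, y, ⟨hy.1.le, hy.2.trans ha.2⟩, (hy.2.trans hx.1).ne', hx0, hy0⟩
  · have h0 : h 0 = 0 := by
      rcases mul_eq_zero.1 h1 with h2 | h2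
      · exact h2
      · simp [h2] at hneg
    exact ⟨x, hxI, 0, ⟨le_rfl, hT⟩, (ha.1.trans hx.1).ne', hx0, h0⟩
  · have h2 : h b * h T < 0 := by
      rw [hp]
      rcases mul_neg_iff.1 hneg with h3 | h3 <;> rcases mul_pos_iff.1 h1 with h4 | h4 <;>
        nlinarith
    obtain ⟨y, hy, hy0⟩ := exists_zero_Ioo hh hb.2.le h2
    exact ⟨x, hxI, y, ⟨(hb.1.trans hy.1).le, hy.2⟩, (hx.2.trans hy.1).ne, hx0, hy0⟩

section
variable {V : Type*} [AddCommGroup V] [Module ℝ V] [FiniteDimensional ℝ V] {ι : Type*}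

/-- Points at which the values of the elements of `V` can be prescribed independently. -/
theorem exists_independent_points_fin (ev : ι → ℝ → V →ₗ[ℝ] ℝ) (I : ι → Set ℝ)
    (hne : ∀ j G, G ≠ 0 → ∃ t ∈ I j, ev j t G ≠ 0) :
    ∀ n ≤ Module.finrank ℝ V, ∀ L : Fin n → ι, ∃ t : Fin n → ℝ, (∀ i, t i ∈ I (L i)) ∧
      ∀ a : Fin n → ℝ, ∃ G, ∀ i, ev (L i) (t i) G = a i := by
  intro n
  induction n with
  | zero => exact fun _ L => ⟨fun i => i.elim0, fun i => i.elim0, fun a => ⟨0, fun i => i.elim0⟩⟩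
  | succ n ih =>
    intro hn L
    obtain ⟨t, ht, hsurj⟩ := ih (by omega) (fun i => L i.succ)
    obtain ⟨G, hG, hG0⟩ := (Submodule.ne_bot_iff _).1 (LinearMap.ker_ne_bot_of_finrank_lt
      (f := LinearMap.pi fun i => ev (L i.succ) (t i)) (by simpa using hn))
    have hG' : ∀ i, ev (L i.succ) (t i) G = 0 := fun i => congrFun (LinearMap.mem_ker.1 hG) i
    obtain ⟨t₀, ht₀, hne₀⟩ := hne (L 0) G hG0
    refine ⟨Fin.cons t₀ t, fun i => ?_, fun a => ?_⟩
    · refine Fin.cases ?_ (fun i => ?_) i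
      · simpa using ht₀
      · simpa using ht i
    · obtain ⟨H, hH⟩ := hsurj fun i => a i.succ
      refine ⟨H + ((a 0 - ev (L 0) t₀ H) / ev (L 0) t₀ G) • G, fun i => ?_⟩
      refine Fin.cases ?_ (fun i => ?_) i
      · simp only [Fin.cons_zero, map_add, map_smul, smul_eq_mul]
        field_simp
        ring
      · simp [hG', hH]

theorem exists_independent_points (ev : ι → ℝ → V →ₗ[ℝ] ℝ) (I : ι → Set ℝ)
    (hne : ∀ j G, G ≠ 0 → ∃ t ∈ I j, ev j t G ≠ 0) {S : Type*} [Fintype S]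
    (hS : Fintype.card S ≤ Module.finrank ℝ V) (L : S → ι) :
    ∃ t : S → ℝ, (∀ i, t i ∈ I (L i)) ∧ ∀ a : S → ℝ, ∃ G, ∀ i, ev (L i) (t i) G = a i := by
  let e := Fintype.equivFin S
  obtain ⟨t, ht, hsurj⟩ := exists_independent_points_fin ev I hne _ hS (L ∘ e.symm)
  refine ⟨t ∘ e, fun i => by simpa using ht (e i), fun a => ?_⟩
  obtain ⟨G, hG⟩ := hsurj (a ∘ e.symm)
  exact ⟨G, fun i => by simpa using hG (e i)⟩

/-- A linear system of dimension `N` on a union of closed loops, one of which is marked, contains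
an element with at least `N` plus the number of unmarked loops zeros. -/
theorem exists_many_zeros [Fintype ι] (j₀ : ι) {N : ℕ} (hV : Module.finrank ℝ V = N + 1)
    (hN : Fintype.card ι ≤ N + 1) (T : ι → ℝ)
    (ev : ι → ℝ → V →ₗ[ℝ] ℝ) (hc : ∀ j G, Continuous fun t => ev j t G) (hT : ∀ j, 0 < T j)
    (hε : ∀ j, ev j (T j) = ev j 0 ∨ ev j (T j) = -ev j 0)
    (hne : ∀ j G, G ≠ 0 → ∃ t ∈ Ioo 0 (T j), ev j t G ≠ 0) :
    ∃ G ≠ 0, ∃ A : Finset (ι × ℝ), A.card + 1 = N + Fintype.card ι ∧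
      ∀ s ∈ A, s.2 ∈ Ico 0 (T s.1) ∧ ev s.1 s.2 G = 0 := by
  classical
  let E := {j : ι // j ≠ j₀ ∧ ev j (T j) = ev j 0}
  have hι : Fintype.card {j : ι // j ≠ j₀} + 1 = Fintype.card ι := by
    have := Fintype.card_pos_iff.2 ⟨j₀⟩
    rw [Fintype.card_subtype_compl, Fintype.card_subtype_eq]
    omega
  have hE : Fintype.card E ≤ Fintype.card {j : ι // j ≠ j₀} :=
    Fintype.card_subtype_mono _ _ fun _ h => h.1
  let S := E ⊕ Fin (N - Fintype.card E)
  have hS : Fintype.card S = N := by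
    simp only [S, Fintype.card_sum, Fintype.card_fin]; omega
  let L : S → ι := Sum.elim (fun j => j.1) fun _ => j₀
  obtain ⟨t, ht, hsurj⟩ := exists_independent_points ev (fun j => Ioo 0 (T j)) hne
    (S := S) (by omega) L
  obtain ⟨G₀, hG₀, hG₀0⟩ := (Submodule.ne_bot_iff _).1 (LinearMap.ker_ne_bot_of_finrank_lt
      (f := LinearMap.pi fun i => ev (L i) (t i))
      (by rw [Module.finrank_fintype_fun_eq_card, hV, hS]; omega))
  have hG₀' : ∀ i, ev (L i) (t i) G₀ = 0 := fun i => congrFun (LinearMap.mem_ker.1 hG₀) i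
  choose c hcI hcne using fun j => hne j G₀ hG₀0
  obtain ⟨H, hH⟩ := hsurj (Sum.elim (fun j => -ev j.1 (c j.1) G₀) fun _ => 0)
  obtain ⟨δ, hδ, hδ0⟩ : ∃ δ : ℝ, (∀ j, 0 < ev j (c j) G₀ * ev j (c j) (G₀ + δ • H)) ∧ 0 < δ := by
    have h1 : ∀ᶠ δ : ℝ in 𝓝 0, ∀ j, 0 < ev j (c j) G₀ * ev j (c j) (G₀ + δ • H) := by
      refine eventually_all.2 fun j => ?_
      have hcont : Continuous fun δ : ℝ => ev j (c j) G₀ * ev j (c j) (G₀ + δ • H) := by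
        simp only [map_add, map_smul, smul_eq_mul]; fun_prop
      exact hcont.continuousAt.eventually (lt_mem_nhds (by simpa using mul_self_pos.2 (hcne j)))
    exact ((h1.filter_mono nhdsWithin_le_nhds).and self_mem_nhdsWithin).exists (f := 𝓝[>] 0)
  set G := G₀ + δ • H with hG
  have hGS : ∀ i, ev (L i) (t i) G = δ * ev (L i) (t i) H := fun i => by simp [hG, hG₀']
  have hEz : ∀ j : E, ∃ x ∈ Ico 0 (T j.1), ∃ y ∈ Ico 0 (T j.1), x ≠ y ∧
      ev j.1 x G = 0 ∧ ev j.1 y G = 0 := fun j => by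
    refine exists_two_zeros_of_periodic (hc j.1 G) (by rw [j.2.2]) (hcI j.1) (ht (.inl j)) ?_
    have h1 : ev j.1 (t (.inl j)) G = -(δ * ev j.1 (c j.1) G₀) := by
      have := hGS (.inl j)
      rw [hH] at this
      simpa [L] using this
    rw [h1]
    nlinarith [mul_pos hδ0 (hδ j.1)]
  choose x hxI y hyI hxy hx0 hy0 using hEz
  have hz : ∀ j : {j : ι // j ≠ j₀}, ∃ z ∈ Ico 0 (T j.1), ev j.1 z G = 0 ∧
      ∀ h : ev j.1 (T j.1) = ev j.1 0, z = y ⟨j.1, j.2, h⟩ := fun j => by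
    by_cases h : ev j.1 (T j.1) = ev j.1 0
    · exact ⟨_, hyI ⟨j.1, j.2, h⟩, hy0 ⟨j.1, j.2, h⟩, fun _ => rfl⟩
    · obtain ⟨z, hz, hz0⟩ := exists_zero_of_antiperiodic (hc j.1 G) (hT j.1)
        (by rw [(hε j.1).resolve_left h]; simp)
      exact ⟨z, hz, hz0, fun h' => absurd h' h⟩
  choose z hzI hz0 hzy using hz
  let s : S ⊕ {j : ι // j ≠ j₀} → ι × ℝ :=
    Sum.elim (Sum.elim (fun j => (j.1, x j)) fun i => (j₀, t (.inr i))) fun j => (j.1, z j)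
  have ht_inj : Function.Injective fun i : Fin (N - Fintype.card E) => t (.inr i) := by
    intro i i' hii
    by_contra hne'
    obtain ⟨Q, hQ⟩ := hsurj (Pi.single (.inr i) 1)
    have h1 := hQ (.inr i)
    have h2 := hQ (.inr i')
    rw [Pi.single_eq_same] at h1
    rw [Pi.single_eq_of_ne (fun h => hne' (Sum.inr_injective h).symm)] at h2
    simp only [L, Sum.elim_inr] at h1 h2 hii
    rw [hii, h2] at h1
    exact zero_ne_one h1
  have hs_inj : Function.Injective s := by
    rintro ((a | a) | a) ((b | b) | b) hab <;>
      simp only [s, Sum.elim_inl, Sum.elim_inr, Prod.mk.injEq] at hab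
    · rw [Subtype.ext hab.1]
    · exact absurd hab.1 a.2.1
    · have h1 : b = ⟨a.1, a.2.1⟩ := Subtype.ext hab.1.symm
      subst h1
      exact absurd (hab.2.trans (hzy _ a.2.2)) (hxy a)
    · exact absurd hab.1.symm b.2.1
    · rw [ht_inj hab.2]
    · exact absurd hab.1.symm b.2
    · have h1 : a = ⟨b.1, b.2.1⟩ := Subtype.ext hab.1
      subst h1
      exact absurd (hab.2.symm.trans (hzy _ b.2.2)) (hxy b)
    · exact absurd hab.1 a.2
    · rw [Subtype.ext hab.1]
  refine ⟨G, fun h => ?_, Finset.univ.map ⟨s, hs_inj⟩, ?_, ?_⟩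
  · have := hδ j₀
    rw [h] at this
    simp at this
  · rw [Finset.card_map, Finset.card_univ, Fintype.card_sum, hS]
    omega
  · intro p hp
    obtain ⟨i, -, rfl⟩ := Finset.mem_map.1 hp
    rcases i with (i | i) | i
    · exact ⟨hxI i, hx0 i⟩
    · refine ⟨Ioo_subset_Ico_self (ht (.inr i)), ?_⟩
      have := hGS (.inr i)
      rw [hH, Sum.elim_inr, mul_zero] at this
      exact this
    · exact ⟨hzI i, hz0 i⟩
end

end LinearSystem

section Forms
open Set Filter Topology MvPolynomial

theorem eval_scale_of_mem_bihom {K : Type*} [Field K] {m : ℕ × ℕ} {H : MvPolynomial (Fin 4) K}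
    (hH : H ∈ bihom K m) (s t : K) (P : Fin 4 → K) :
    eval ![s * P 0, s * P 1, t * P 2, t * P 3] H = s ^ m.1 * t ^ m.2 * eval P H := by
  rw [eval_eq', eval_eq', Finset.mul_sum]
  refine Finset.sum_congr rfl fun d hd => ?_
  obtain ⟨h1, h2⟩ := mem_bihom_iff.1 hH d hd
  simp only [Fin.prod_univ_four, ← h1, ← h2, pow_add, mul_pow, Matrix.cons_val]
  ring

/-- Chain rule for a polynomial along a curve. -/
theorem hasDerivAt_eval {σ : Type*} [Fintype σ] (H : MvPolynomial σ ℝ) {c : ℝ → σ → ℝ}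
    {c' : σ → ℝ} {t : ℝ} (hc : ∀ i, HasDerivAt (fun t => c t i) (c' i) t) :
    HasDerivAt (fun t => eval (c t) H) (∑ i, c' i * eval (c t) (pderiv i H)) t := by
  classical
  induction H using MvPolynomial.induction_on with
  | C a => simpa using hasDerivAt_const t a
  | add p q hp hq =>
    simp only [map_add, mul_add, Finset.sum_add_distrib]
    exact hp.add hq
  | mul_X p i hp =>
    have := hp.mul (hc i)
    simp only [eval_mul, eval_X]
    refine this.congr_deriv ?_
    have hX : ∀ j, eval (c t) (pderiv j (X i : MvPolynomial σ ℝ)) = if j = i then 1 else 0 :=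
      fun j => by
        rw [pderiv_X, Pi.single_apply, apply_ite (eval (c t)), map_one, map_zero]
        simp only [eq_comm]
    simp only [Derivation.leibniz, smul_eq_mul, map_add, map_mul, eval_X, hX, mul_add,
      Finset.sum_add_distrib, mul_ite, mul_one, mul_zero, Finset.sum_ite_eq', Finset.mem_univ,
      if_true, Finset.sum_mul]
    rw [add_comm, mul_comm (c' i)]
    exact congrArg _ (Finset.sum_congr rfl fun j _ => by ring)

/-- The point of `ℝ² × ℝ²` with angular coordinates `z`. -/
def circlePoint (z : ℝ × ℝ) : Fin 4 → ℝ :=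
  ![Real.cos z.1, Real.sin z.1, Real.cos z.2, Real.sin z.2]

/-- A bihomogeneous form as a function of the angles. -/
def formFun (H : MvPolynomial (Fin 4) ℝ) (z : ℝ × ℝ) : ℝ := eval (circlePoint z) H

theorem contDiff_formFun (H : MvPolynomial (Fin 4) ℝ) {n : WithTop ℕ∞} :
    ContDiff ℝ n (formFun H) := by
  unfold formFun
  induction H using MvPolynomial.induction_on with
  | C a => simpa using contDiff_const
  | add p q hp hq => simpa using hp.add hq
  | mul_X p i hp =>
    simp only [eval_mul, eval_X]
    refine hp.mul ?_
    fin_cases i <;> simp only [circlePoint, Fin.zero_eta, Fin.mk_one, Fin.reduceFinMk,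
      Matrix.cons_val]
    · exact Real.contDiff_cos.comp contDiff_fst
    · exact Real.contDiff_sin.comp contDiff_fst
    · exact Real.contDiff_cos.comp contDiff_snd
    · exact Real.contDiff_sin.comp contDiff_snd

theorem formFun_add_latticeVec {m : ℕ × ℕ} {H : MvPolynomial (Fin 4) ℝ} (hH : H ∈ bihom ℝ m)
    (k l : ℤ) (z : ℝ × ℝ) :
    formFun H (z + latticeVec k l) = (((-1) ^ k) ^ m.1 * ((-1) ^ l) ^ m.2) * formFun H z := by
  rw [formFun, formFun, ← eval_scale_of_mem_bihom hH]
  simp [circlePoint, latticeVec, Real.cos_add_int_mul_pi, Real.sin_add_int_mul_pi]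

theorem sign_eq_or (k l : ℤ) (m : ℕ × ℕ) :
    ((-1 : ℝ) ^ k) ^ m.1 * ((-1) ^ l) ^ m.2 = 1 ∨ ((-1 : ℝ) ^ k) ^ m.1 * ((-1) ^ l) ^ m.2 = -1 := by
  have h : ∀ (k : ℤ) (n : ℕ), ((-1 : ℝ) ^ k) ^ n = 1 ∨ ((-1 : ℝ) ^ k) ^ n = -1 := fun k n => by
    rcases Int.even_or_odd k with hk | hk
    · simp [hk.neg_one_zpow]
    · rw [hk.neg_one_zpow]; exact neg_one_pow_eq_or ℝ n
  rcases h k m.1 with h1 | h1 <;> rcases h l m.2 with h2 | h2 <;> simp [h1, h2]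

theorem latticeSemiinvariant_formFun {m : ℕ × ℕ} {H : MvPolynomial (Fin 4) ℝ}
    (hH : H ∈ bihom ℝ m) : LatticeSemiinvariant (formFun H) := fun k l =>
  ⟨_, sign_eq_or k l m, formFun_add_latticeVec hH k l⟩

theorem circlePoint_fst_ne_zero (z : ℝ × ℝ) : circlePoint z 0 ≠ 0 ∨ circlePoint z 1 ≠ 0 := by
  by_contra! h
  have := Real.cos_sq_add_sin_sq z.1
  simp only [circlePoint, Matrix.cons_val] at h
  simp [h] at this

theorem circlePoint_snd_ne_zero (z : ℝ × ℝ) : circlePoint z 2 ≠ 0 ∨ circlePoint z 3 ≠ 0 := by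
  by_contra! h
  have := Real.cos_sq_add_sin_sq z.2
  simp only [circlePoint, Matrix.cons_val] at h
  simp [h] at this

/-- Euler's identities at a zero of a bihomogeneous form. -/
theorem euler_of_mem_bihom {m : ℕ × ℕ} {F : MvPolynomial (Fin 4) ℝ} (hF : F ∈ bihom ℝ m)
    {P : Fin 4 → ℝ} (hP : eval P F = 0) :
    P 0 * eval P (pderiv 0 F) + P 1 * eval P (pderiv 1 F) = 0 ∧
      P 2 * eval P (pderiv 2 F) + P 3 * eval P (pderiv 3 F) = 0 := by
  constructor
  · have h := hasDerivAt_eval F (c := fun s => ![s * P 0, s * P 1, 1 * P 2, 1 * P 3])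
      (c' := ![P 0, P 1, 0, 0]) (t := 1) (fun i => by
        fin_cases i <;> simp
        · simpa using (hasDerivAt_id (1 : ℝ)).mul_const (P 0)
        · simpa using (hasDerivAt_id (1 : ℝ)).mul_const (P 1)
        · exact hasDerivAt_const _ _
        · exact hasDerivAt_const _ _)
    simp only [eval_scale_of_mem_bihom hF, hP, mul_zero] at h
    have e : ![P 0, P 1, P 2, P 3] = P := by ext i; fin_cases i <;> rfl
    simpa [Fin.sum_univ_four, e] using h.unique (hasDerivAt_const _ _)
  · have h := hasDerivAt_eval F (c := fun s => ![1 * P 0, 1 * P 1, s * P 2, s * P 3])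
      (c' := ![0, 0, P 2, P 3]) (t := 1) (fun i => by
        fin_cases i <;> simp
        · exact hasDerivAt_const _ _
        · exact hasDerivAt_const _ _
        · simpa using (hasDerivAt_id (1 : ℝ)).mul_const (P 2)
        · simpa using (hasDerivAt_id (1 : ℝ)).mul_const (P 3))
    simp only [eval_scale_of_mem_bihom hF, hP, mul_zero] at h
    have e : ![P 0, P 1, P 2, P 3] = P := by ext i; fin_cases i <;> rfl
    simpa [Fin.sum_univ_four, e] using h.unique (hasDerivAt_const _ _)

theorem eq_zero_of_rotation {c s a b : ℝ} (hcs : c ^ 2 + s ^ 2 = 1) (h1 : c * a + s * b = 0)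
    (h2 : -s * a + c * b = 0) : a = 0 ∧ b = 0 :=
  ⟨by linear_combination c * h1 - s * h2 - a * hcs, by linear_combination s * h1 + c * h2 - b * hcs⟩

theorem pderiv_eq_zero_of_fderiv {m : ℕ × ℕ} {F : MvPolynomial (Fin 4) ℝ} (hF : F ∈ bihom ℝ m)
    {z : ℝ × ℝ} (hz : formFun F z = 0) (hd : fderiv ℝ (formFun F) z = 0) (i : Fin 4) :
    eval (circlePoint z) (pderiv i F) = 0 := by
  obtain ⟨e1, e2⟩ := euler_of_mem_bihom hF (P := circlePoint z) hz
  have hfd : HasFDerivAt (formFun F) (0 : ℝ × ℝ →L[ℝ] ℝ) z := by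
    rw [← hd]; exact ((contDiff_formFun F (n := 1)).differentiable one_ne_zero z).hasFDerivAt
  have h1 : HasDerivAt (fun t => formFun F (t, z.2)) 0 z.1 := by
    exact HasFDerivAt.comp_hasDerivAt (f := fun t : ℝ => (t, z.2)) z.1 hfd
      ((hasDerivAt_id z.1).prodMk (hasDerivAt_const z.1 z.2))
  have h2 : HasDerivAt (fun t => formFun F (z.1, t)) 0 z.2 := by
    exact HasFDerivAt.comp_hasDerivAt (f := fun t : ℝ => (z.1, t)) z.2 hfd
      ((hasDerivAt_const z.2 z.1).prodMk (hasDerivAt_id z.2))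
  have h1' := h1.unique (hasDerivAt_eval F (c := fun t => circlePoint (t, z.2))
    (c' := ![-Real.sin z.1, Real.cos z.1, 0, 0]) (fun i => by
      fin_cases i <;> simp [circlePoint]
      · exact Real.hasDerivAt_cos _
      · exact Real.hasDerivAt_sin _
      · exact hasDerivAt_const _ _
      · exact hasDerivAt_const _ _))
  have h2' := h2.unique (hasDerivAt_eval F (c := fun t => circlePoint (z.1, t))
    (c' := ![0, 0, -Real.sin z.2, Real.cos z.2]) (fun i => by
      fin_cases i <;> simp [circlePoint]
      · exact hasDerivAt_const _ _
      · exact hasDerivAt_const _ _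
      · exact Real.hasDerivAt_cos _
      · exact Real.hasDerivAt_sin _))
  simp only [Fin.sum_univ_four, Matrix.cons_val, zero_mul, add_zero, zero_add, Prod.mk.eta]
    at h1' h2'
  have r1 := eq_zero_of_rotation (Real.cos_sq_add_sin_sq z.1) e1 h1'.symm
  have r2 := eq_zero_of_rotation (Real.cos_sq_add_sin_sq z.2) e2 h2'.symm
  fin_cases i
  exacts [r1.1, r1.2, r2.1, r2.2]

theorem circlePoint_det (z z' : ℝ × ℝ) (h : ¬ LatticeRel z z') :
    circlePoint z 0 * circlePoint z' 1 - circlePoint z 1 * circlePoint z' 0 ≠ 0 ∨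
      circlePoint z 2 * circlePoint z' 3 - circlePoint z 3 * circlePoint z' 2 ≠ 0 := by
  rw [latticeRel_iff_sin, Real.sin_sub, Real.sin_sub] at h
  by_contra! hc
  simp only [circlePoint, Matrix.cons_val] at hc
  exact h ⟨by linarith [hc.1], by linarith [hc.2]⟩

/-- A simple closed curve, on the torus, in the zero set of `f`. -/
structure IsLoop (f : ℝ × ℝ → ℝ) (γ : ℝ → ℝ × ℝ) (T : ℝ) : Prop where
  continuous : Continuous γ
  pos : 0 < T
  zero : ∀ t, f (γ t) = 0
  closed : LatticeRel (γ 0) (γ T)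
  simple : ∀ s ∈ Ico 0 T, ∀ t ∈ Ico 0 T, LatticeRel (γ s) (γ t) → s = t

/-- The number of disjoint simple closed curves in the zero set of an irreducible form. -/
theorem card_loops_le {a b : ℕ} {F : MvPolynomial (Fin 4) ℝ} (hF : F ∈ bihom ℝ (a + 1, b + 1))
    (hp : Prime F) {γ : Fin (a * b + 2) → ℝ → ℝ × ℝ} {T : Fin (a * b + 2) → ℝ}
    (hl : ∀ j, IsLoop (formFun F) (γ j) (T j))
    (hdisj : ∀ i j, i ≠ j → ∀ s t, ¬ LatticeRel (γ i s) (γ j t)) : False := by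
  have hcount : ∀ G : bihom ℝ (a, b + 1), G ≠ 0 → ∀ A : Finset (Fin (a * b + 2) × ℝ),
      (∀ s ∈ A, s.2 ∈ Ico 0 (T s.1) ∧ formFun G.1 (γ s.1 s.2) = 0) →
      A.card ≤ (a + 1) * (b + 1) + (b + 1) * a := by
    intro G hG A hA
    have hG0 : G.1 ≠ 0 := fun h => hG (Subtype.ext h)
    have hdvd : ¬ F ∣ G.1 := by
      rintro ⟨Q, hQ⟩
      have := (bidegree_le_of_mul (A := Q) hF (by rw [mul_comm, ← hQ]; exact G.2)
        (by rwa [mul_comm, ← hQ])).1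
      simp at this
    have := card_le_of_common_zeros hF G.2 hG0 hp hdvd (ι := A)
      (fun s => circlePoint (γ s.1.1 s.1.2)) (fun s => circlePoint_fst_ne_zero _)
      (fun s => circlePoint_snd_ne_zero _) (fun s s' hss => circlePoint_det _ _ fun hrel => ?_)
      (fun s => (hl s.1.1).zero _) (fun s => (hA s.1 s.2).2)
    · simpa using this
    · obtain ⟨⟨j, t⟩, hs⟩ := s
      obtain ⟨⟨j', t'⟩, hs'⟩ := s'
      by_cases hj : j = j'
      · subst hj
        exact hss (by rw [Subtype.mk.injEq, Prod.mk.injEq]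
                      exact ⟨rfl, (hl j).simple _ (hA _ hs).1 _ (hA _ hs').1 hrel⟩)
      · exact hdisj _ _ hj _ _ hrel
  obtain ⟨G, hG0, A, hAcard, hA⟩ := exists_many_zeros (V := bihom ℝ (a, b + 1))
    (0 : Fin (a * b + 2)) (N := a * (b + 2) + b + 1)
    (by rw [finrank_bihom]; ring) (by rw [Fintype.card_fin]; nlinarith) T
    (fun j t => (aeval (circlePoint (γ j t))).toLinearMap ∘ₗ (bihom ℝ (a, b + 1)).subtype)
    (fun j G => ((contDiff_formFun G.1 (n := 0)).continuous.comp (hl j).continuous))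
    (fun j => (hl j).pos)
    (fun j => by
      obtain ⟨k, l, h⟩ := (hl j).closed
      have := fun G : bihom ℝ (a, b + 1) => formFun_add_latticeVec G.2 k l (γ j 0)
      rw [← h] at this
      rcases sign_eq_or k l (a, b + 1) with hs | hs <;> rw [hs] at this
      · exact .inl (LinearMap.ext fun G => by simpa [formFun] using this G)
      · exact .inr (LinearMap.ext fun G => by simpa [formFun] using this G))
    (fun j G hG => by
      by_contra! hc
      obtain ⟨B, hB, hBcard⟩ := (Ioo_infinite (hl j).pos).exists_subset_card_eq
        ((a + 1) * (b + 1) + (b + 1) * a + 1)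
      have := hcount G hG (B.map ⟨fun t => (j, t), fun _ _ h => (Prod.mk.inj h).2⟩) (by
        intro s hs
        obtain ⟨t, ht, rfl⟩ := Finset.mem_map.1 hs
        exact ⟨Ioo_subset_Ico_self (hB ht), hc t (hB ht)⟩)
      rw [Finset.card_map, hBcard] at this
      omega)
  have := hcount G hG0 A hA
  rw [Fintype.card_fin] at hAcard
  nlinarith

end Forms

open Set Filter Topology MvPolynomial

theorem circle_ne_zero (θ : ℝ) : ![Real.cos θ, Real.sin θ] ≠ 0 := fun h => by
  have := Real.cos_sq_add_sin_sq θ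
  have h0 := congrFun h 0
  have h1 := congrFun h 1
  simp only [Matrix.cons_val, Pi.zero_apply] at h0 h1
  simp [h0, h1] at this

/-- The point of `ℝP¹` with angle `θ`. -/
def angleMk (θ : ℝ) : RP1 := Projectivization.mk ℝ ![Real.cos θ, Real.sin θ] (circle_ne_zero θ)

theorem continuous_angleMk : Continuous angleMk := by
  have h : Continuous fun θ : ℝ =>
      (⟨![Real.cos θ, Real.sin θ], circle_ne_zero θ⟩ : {v : Fin 2 → ℝ // v ≠ 0}) := by
    refine Continuous.subtype_mk (continuous_pi fun i => ?_) _
    fin_cases i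
    · exact Real.continuous_cos
    · exact Real.continuous_sin
  exact (continuous_quotient_mk' (s := projectivizationSetoid ℝ (Fin 2 → ℝ))).comp h

theorem surjective_angleMk : Function.Surjective angleMk := by
  intro x
  induction x using Projectivization.ind with
  | h v hv =>
    refine ⟨Complex.arg ⟨v 0, v 1⟩, ?_⟩
    rw [angleMk, Projectivization.mk_eq_mk_iff']
    have hr : ‖(⟨v 0, v 1⟩ : ℂ)‖ ≠ 0 := fun h => hv <| by
      have := norm_eq_zero.1 h
      ext i
      fin_cases i
      · exact congrArg Complex.re this
      · exact congrArg Complex.im this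
    have h1 := Complex.norm_mul_cos_arg ⟨v 0, v 1⟩
    have h2 := Complex.norm_mul_sin_arg ⟨v 0, v 1⟩
    refine ⟨‖(⟨v 0, v 1⟩ : ℂ)‖⁻¹, ?_⟩
    ext i
    fin_cases i
    · simp only [Fin.zero_eta, Pi.smul_apply, smul_eq_mul, Matrix.cons_val]
      rw [inv_mul_eq_iff_eq_mul₀ hr]; exact h1.symm
    · simp only [Fin.mk_one, Pi.smul_apply, smul_eq_mul, Matrix.cons_val]
      rw [inv_mul_eq_iff_eq_mul₀ hr]; exact h2.symm

theorem angleMk_add_int_mul_pi (θ : ℝ) (k : ℤ) : angleMk (θ + k * Real.pi) = angleMk θ := by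
  rw [angleMk, angleMk, Projectivization.mk_eq_mk_iff']
  refine ⟨(-1) ^ k, ?_⟩
  ext i
  fin_cases i <;> simp [Real.cos_add_int_mul_pi, Real.sin_add_int_mul_pi]

/-- The universal covering `ℝ² → ℝP¹ × ℝP¹`. -/
def torusMk (z : ℝ × ℝ) : RP1 × RP1 := (angleMk z.1, angleMk z.2)

theorem LatticeRel.torusMk_eq {z z' : ℝ × ℝ} : LatticeRel z z' → torusMk z = torusMk z' := by
  rintro ⟨k, l, rfl⟩
  simp [torusMk, latticeVec, angleMk_add_int_mul_pi]

theorem continuous_torusMk : Continuous torusMk :=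
  (continuous_angleMk.comp continuous_fst).prodMk (continuous_angleMk.comp continuous_snd)

theorem surjective_torusMk : Function.Surjective torusMk :=
  surjective_angleMk.prodMap surjective_angleMk

/-- The real points of the curve `F = 0`. -/
abbrev realPoints (F : MvPolynomial (Fin 4) ℝ) : Set (RP1 × RP1) :=
  {pq : RP1 × RP1 | eval ![pq.1.rep 0, pq.1.rep 1, pq.2.rep 0, pq.2.rep 1] F = 0}

theorem torusMk_mem_realPoints {m : ℕ × ℕ} {F : MvPolynomial (Fin 4) ℝ} (hF : F ∈ bihom ℝ m)
    (z : ℝ × ℝ) : torusMk z ∈ realPoints F ↔ formFun F z = 0 := by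
  obtain ⟨s, hs⟩ := Projectivization.exists_smul_eq_mk_rep ℝ _ (circle_ne_zero z.1)
  obtain ⟨t, ht⟩ := Projectivization.exists_smul_eq_mk_rep ℝ _ (circle_ne_zero z.2)
  have h := eval_scale_of_mem_bihom hF (s : ℝ) (t : ℝ) (circlePoint z)
  simp only [realPoints, mem_ofPred_eq, torusMk, angleMk, ← hs, ← ht]
  simp only [circlePoint, Matrix.cons_val] at h
  simp only [Units.smul_def, Pi.smul_apply, smul_eq_mul, Matrix.cons_val]
  rw [h, mul_eq_zero, or_iff_right (by simp)]
  rfl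

/-- Over each real point of a nonsingular curve there is a loop in its component. -/
theorem exists_isLoop {m : ℕ × ℕ} {F : MvPolynomial (Fin 4) ℝ} (hF : F ∈ bihom ℝ m)
    (hreg : ∀ z, formFun F z = 0 → fderiv ℝ (formFun F) z ≠ 0) (x : realPoints F) :
    ∃ γ T, IsLoop (formFun F) γ T ∧ ∀ t (h : torusMk (γ t) ∈ realPoints F),
      ConnectedComponents.mk (⟨torusMk (γ t), h⟩ : realPoints F) = ConnectedComponents.mk x := by
  obtain ⟨x, hx⟩ := x
  obtain ⟨z, rfl⟩ := surjective_torusMk x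
  have hz : formFun F z = 0 := (torusMk_mem_realPoints hF z).1 hx
  obtain ⟨γ, T, h1, h2, h3, h4, h5, h6⟩ :=
    exists_loop (contDiff_formFun F) (latticeSemiinvariant_formFun hF) hreg hz
  refine ⟨γ, T, ⟨h1, h3, h4, h5, h6⟩, fun t h => ?_⟩
  rw [ConnectedComponents.coe_eq_coe']
  have hcont : Continuous fun t =>
      (⟨torusMk (γ t), (torusMk_mem_realPoints hF _).2 (h4 t)⟩ : realPoints F) :=
    (continuous_torusMk.comp h1).subtype_mk _
  have h0 : (⟨torusMk z, hx⟩ : realPoints F) ∈ range fun t =>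
      (⟨torusMk (γ t), (torusMk_mem_realPoints hF _).2 (h4 t)⟩ : realPoints F) :=
    ⟨0, Subtype.ext (congrArg torusMk h2)⟩
  exact (isPreconnected_range hcont).subset_connectedComponent h0 ⟨t, rfl⟩

theorem fderiv_formFun_ne_zero {m : ℕ × ℕ} {F : MvPolynomial (Fin 4) ℝ} (hF : F ∈ bihom ℝ m)
    (hns : ∀ u v : Fin 2 → ℂ, u ≠ 0 → v ≠ 0 →
      eval ![u 0, u 1, v 0, v 1] (map (algebraMap ℝ ℂ) F) = 0 →
      ∃ i : Fin 4, eval ![u 0, u 1, v 0, v 1] (pderiv i (map (algebraMap ℝ ℂ) F)) ≠ 0)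
    (z : ℝ × ℝ) (hz : formFun F z = 0) : fderiv ℝ (formFun F) z ≠ 0 := by
  intro hd
  have hmap : ∀ H : MvPolynomial (Fin 4) ℝ,
      eval ![(Real.cos z.1 : ℂ), Real.sin z.1, Real.cos z.2, Real.sin z.2]
        (map (algebraMap ℝ ℂ) H) = (eval (circlePoint z) H : ℝ) := fun H => by
    have e : ![(Real.cos z.1 : ℂ), Real.sin z.1, Real.cos z.2, Real.sin z.2] =
        algebraMap ℝ ℂ ∘ circlePoint z := by ext i; fin_cases i <;> rfl
    rw [e, eval_map, ← eval₂_comp]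
    rfl
  have hne : ∀ θ : ℝ, ![(Real.cos θ : ℂ), Real.sin θ] ≠ 0 := fun θ h => circle_ne_zero θ <| by
    ext i
    have := congrFun h i
    fin_cases i
    · exact Complex.ofReal_eq_zero.1 this
    · exact Complex.ofReal_eq_zero.1 this
  obtain ⟨i, hi⟩ := hns _ _ (hne z.1) (hne z.2) (by
    simp only [Matrix.cons_val]
    rw [hmap]
    exact Complex.ofReal_eq_zero.2 hz)
  refine hi ?_
  simp only [Matrix.cons_val]
  rw [pderiv_map, hmap, pderiv_eq_zero_of_fderiv hF hz hd, Complex.ofReal_zero]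

theorem Finite.card_le_of_not_embedding {α : Type*} {n : ℕ} (h : IsEmpty (Fin (n + 1) ↪ α)) :
    Finite α ∧ Nat.card α ≤ n := by
  have hfin : Finite α := by
    by_contra hinf
    rw [not_finite_iff_infinite] at hinf
    exact h.elim (Fin.valEmbedding.trans (Infinite.natEmbedding α))
  refine ⟨hfin, ?_⟩
  by_contra! hc
  have := Fintype.ofFinite α
  obtain ⟨e⟩ := Function.Embedding.nonempty_of_card_le (α := Fin (n + 1)) (β := α)
    (by rw [Fintype.card_fin, ← Nat.card_eq_fintype_card]; exact hc)
  exact h.elim e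

/-- Harnack's inequality on a quadric: a real curve of bidegree `(m₁, m₂)` on `ℙ¹ × ℙ¹`,
nonsingular over `ℂ`, has at most `(m₁ - 1)(m₂ - 1) + 1` connected components of its real
point set in `ℝP¹ × ℝP¹`. -/
theorem stmt_17 (m₁ m₂ : ℕ) (hm₁ : 1 ≤ m₁) (hm₂ : 1 ≤ m₂)
    (F : MvPolynomial (Fin 4) ℝ) (hF0 : F ≠ 0)
    (hbihom : ∀ d ∈ F.support, d 0 + d 1 = m₁ ∧ d 2 + d 3 = m₂)
    (hns : ∀ u v : Fin 2 → ℂ, u ≠ 0 → v ≠ 0 →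
      MvPolynomial.eval ![u 0, u 1, v 0, v 1] (MvPolynomial.map (algebraMap ℝ ℂ) F) = 0 →
      ∃ i : Fin 4, MvPolynomial.eval ![u 0, u 1, v 0, v 1]
        (MvPolynomial.pderiv i (MvPolynomial.map (algebraMap ℝ ℂ) F)) ≠ 0) :
    Finite (ConnectedComponents
      ↥{pq : RP1 × RP1 |
        MvPolynomial.eval ![pq.1.rep 0, pq.1.rep 1, pq.2.rep 0, pq.2.rep 1] F = 0}) ∧
    Nat.card (ConnectedComponents
      ↥{pq : RP1 × RP1 |
        MvPolynomial.eval ![pq.1.rep 0, pq.1.rep 1, pq.2.rep 0, pq.2.rep 1] F = 0})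
      ≤ (m₁ - 1) * (m₂ - 1) + 1 := by
  have hF : F ∈ bihom ℝ (m₁, m₂) := mem_bihom_iff.2 hbihom
  have hp := prime_of_nonsingular hm₁ hm₂ hF0 hF hns
  have hreg := fderiv_formFun_ne_zero hF hns
  obtain ⟨a, rfl⟩ : ∃ a, m₁ = a + 1 := ⟨m₁ - 1, by omega⟩
  obtain ⟨b, rfl⟩ : ∃ b, m₂ = b + 1 := ⟨m₂ - 1, by omega⟩
  simp only [Nat.add_sub_cancel]
  refine Finite.card_le_of_not_embedding (α := ConnectedComponents (realPoints F)) ⟨fun e => ?_⟩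
  choose x hx using fun j => ConnectedComponents.surjective_coe (e j)
  choose γ T hl hcomp using fun j => exists_isLoop hF hreg (x j)
  refine card_loops_le hF hp hl fun i j hij s t hrel => hij (e.injective ?_)
  have hs := (torusMk_mem_realPoints hF _).2 ((hl i).zero s)
  have ht := (torusMk_mem_realPoints hF _).2 ((hl j).zero t)
  rw [← hx i, ← hx j, ← hcomp i s hs, ← hcomp j t ht]
  exact congrArg _ (Subtype.ext hrel.torusMk_eq)
end
end
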